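/- arXiv:2011.06972 — 5 statements merged into one kernel-verified Lean document; each statement's English description precedes it below -/
import Mathlib

section
/- Let π_ℙ(x) denote the number of primes p ≤ x. Then lim_{x→∞} π_ℙ(x)·(log x)/x = 1 (the Prime Number Theorem). -/
open Filter Real MeasureTheory

noncomputable def ptri (t : ℝ) : ℝ := max 0 (1 - |t|)

theorem ptri_cont : Continuous ptri := by unfold ptri; fun_prop
theorem ptri_nonneg (t : ℝ) : 0 ≤ ptri t := le_max_left _ _
theorem ptri_le_one (t : ℝ) : ptri t ≤ 1 := max_le zero_le_one (by linarith [abs_nonneg t])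
theorem ptri_zero {t : ℝ} (h : 1 ≤ |t|) : ptri t = 0 := max_eq_left (by linarith)

theorem ptri_supp : HasCompactSupport ptri := by
  refine HasCompactSupport.intro (isCompact_Icc (a := (-1:ℝ)) (b := 1)) ?_
  intro x hx
  apply ptri_zero
  by_contra h
  exact hx ⟨by linarith [(abs_lt.mp (not_le.mp h)).1], by linarith [(abs_lt.mp (not_le.mp h)).2]⟩

theorem ptri_int1 (c : ℂ) (hc : c ≠ 0) :
    ∫ t in (0:ℝ)..1, (ptri t : ℂ) * Complex.exp (c * t) = Complex.exp c / c^2 - 1/c - 1/c^2 := by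
  have h : ∀ t ∈ Set.uIcc (0:ℝ) 1,
      HasDerivAt (fun t : ℝ => ((1 - t)/c + 1/c^2) * Complex.exp (c * t))
        ((ptri t : ℂ) * Complex.exp (c * t)) t := by
    intro t ht
    rw [Set.uIcc_of_le zero_le_one] at ht
    have e : ptri t = 1 - t := by
      rw [ptri, abs_of_nonneg ht.1, max_eq_right (by linarith [ht.2])]
    have h1 : HasDerivAt (fun t : ℝ => (t:ℂ)) 1 t := Complex.ofRealCLM.hasDerivAt
    have := (((h1.const_sub 1).div_const c).add_const (1/c^2)).mul ((h1.const_mul c).cexp)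
    refine this.congr_deriv ?_
    rw [e]; push_cast; field_simp; ring
  rw [intervalIntegral.integral_eq_sub_of_hasDerivAt h]
  · simp; ring
  · have := ptri_cont
    exact Continuous.intervalIntegrable (by fun_prop) _ _

theorem ptri_int2 (c : ℂ) (hc : c ≠ 0) :
    ∫ t in (-1:ℝ)..0, (ptri t : ℂ) * Complex.exp (c * t) = Complex.exp (-c) / c^2 + 1/c - 1/c^2 := by
  have := ptri_int1 (-c) (neg_ne_zero.mpr hc)
  have h2 := intervalIntegral.integral_comp_neg (a := 0) (b := 1)
    (fun t : ℝ => (ptri t : ℂ) * Complex.exp (c * t))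
  simp only [neg_zero] at h2
  rw [← h2]
  rw [show Complex.exp (-c) / c^2 + 1/c - 1/c^2 = Complex.exp (-c) / (-c)^2 - 1/(-c) - 1/(-c)^2 by
    field_simp; ring, ← this]
  congr 1; ext t
  simp [ptri]

theorem ptri_fourier (v : ℝ) :
    ∫ t : ℝ, (ptri t : ℂ) * Complex.exp (-(Complex.I * t * v)) = ((sinc (v/2))^2 : ℝ) := by
  have hs : ∫ t : ℝ, (ptri t : ℂ) * Complex.exp (-(Complex.I * t * v)) =
      ∫ t in (-1:ℝ)..1, (ptri t : ℂ) * Complex.exp (-(Complex.I * t * v)) := by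
    rw [intervalIntegral.integral_of_le (by norm_num)]
    symm
    apply setIntegral_eq_integral_of_forall_compl_eq_zero
    intro x hx
    rw [ptri_zero]; · simp
    by_contra h
    exact hx ⟨by linarith [(abs_lt.mp (not_le.mp h)).1], by linarith [(abs_lt.mp (not_le.mp h)).2]⟩
  have hi : ∀ a b : ℝ, IntervalIntegrable
      (fun t : ℝ => (ptri t : ℂ) * Complex.exp (-(Complex.I * t * v))) volume a b := by
    intro a b
    have := ptri_cont
    exact Continuous.intervalIntegrable (by fun_prop) _ _
  rw [hs]
  by_cases hv : v = 0
  · subst hv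
    simp only [Complex.ofReal_zero, mul_zero, neg_zero, Complex.exp_zero, mul_one, zero_div,
      sinc_zero]
    rw [intervalIntegral.integral_ofReal]
    congr 1
    have c := ptri_cont
    have h1 : ∫ t in (0:ℝ)..1, ptri t = 1/2 := by
      rw [intervalIntegral.integral_congr (g := fun t => 1 - t)]
      · rw [intervalIntegral.integral_sub (by simp) (by simp)]; simp; norm_num
      · intro t ht
        rw [Set.uIcc_of_le zero_le_one] at ht
        simp only [ptri]
        rw [abs_of_nonneg ht.1, max_eq_right (by linarith [ht.2])]
    have h2 := intervalIntegral.integral_comp_neg (a := 0) (b := 1) ptri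
    rw [show (fun t => ptri (-t)) = ptri by ext; simp [ptri], h1, neg_zero] at h2
    rw [← intervalIntegral.integral_add_adjacent_intervals (b := 0)
      (c.intervalIntegrable _ _) (c.intervalIntegrable _ _), h1, ← h2]
    norm_num
  · rw [← intervalIntegral.integral_add_adjacent_intervals (hi (-1) 0) (hi 0 1)]
    have hc : -(Complex.I * v) ≠ 0 := by simpa using hv
    have e : ∀ t : ℝ, -(Complex.I * t * v) = -(Complex.I * v) * t := by intro t; ring
    simp only [e]
    rw [ptri_int1 _ hc, ptri_int2 _ hc, sinc_of_ne_zero (by simpa using hv)]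
    have hv' : (v:ℂ) ≠ 0 := by exact_mod_cast hv
    have hI : Complex.I ≠ 0 := Complex.I_ne_zero
    have key : Complex.exp (-(-(Complex.I * v))) + Complex.exp (-(Complex.I * v)) - 2
        = - 4 * (Complex.sin (v/2))^2 := by
      have h1 : Complex.cos v = 1 - 2 * (Complex.sin (v/2))^2 := by
        have h2 := Complex.cos_two_mul (v/2)
        rw [show (2:ℂ) * (v/2) = v by ring] at h2
        rw [h2]
        linear_combination 2 * Complex.sin_sq_add_cos_sq (v/2:ℂ)
      have h3 : Complex.cos v = (Complex.exp (v * Complex.I) + Complex.exp (-v * Complex.I))/2 := rfl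
      rw [show -(-(Complex.I * (v:ℂ))) = v * Complex.I by ring,
        show -(Complex.I * (v:ℂ)) = -v * Complex.I by ring]
      linear_combination (-2) * h3 + 2 * h1
    have : (-(Complex.I * (v:ℂ)))^2 = - v^2 := by
      rw [neg_sq, mul_pow, Complex.I_sq]; ring
    push_cast
    rw [this]
    rw [eq_sub_of_add_eq (eq_add_of_sub_eq key)]
    field_simp
    ring

noncomputable def fej (v : ℝ) : ℝ := (sinc (v/2))^2

theorem fej_cont : Continuous fej := by
  unfold fej; exact (continuous_sinc.comp (by fun_prop)).pow 2
theorem fej_nonneg (v : ℝ) : 0 ≤ fej v := sq_nonneg _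
theorem fej_le (v : ℝ) : fej v ≤ 5 * (1 + v^2)⁻¹ := by
  have h1 : fej v ≤ 1 := by
    have := abs_sinc_le_one (v/2)
    unfold fej; rw [← sq_abs]; nlinarith [abs_nonneg (sinc (v/2))]
  have h2 : fej v * v^2 ≤ 4 := by
    by_cases hv : v = 0
    · subst hv; norm_num
    · unfold fej; rw [sinc_of_ne_zero (by simpa using hv)]
      have := sin_sq_le_one (v/2)
      field_simp
      linarith
  rw [← div_eq_mul_inv, le_div_iff₀ (by positivity)]
  linarith
theorem fej_int : Integrable fej := by
  refine (integrable_inv_one_add_sq.const_mul 5).mono' fej_cont.aestronglyMeasurable ?_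
  filter_upwards with v
  rw [norm_of_nonneg (fej_nonneg v)]; exact fej_le v
theorem fej_pos : 0 < ∫ v, fej v := by
  apply integral_pos_of_integrable_nonneg_nonzero fej_cont fej_int fej_nonneg (x := 0)
  simp [fej]

theorem fej_fourier (l : ℝ) (hl : 0 < l) (v : ℝ) :
    ∫ t : ℝ, (ptri (t / l) : ℂ) * Complex.exp (-(Complex.I * t * v)) = (l * fej (l * v) : ℝ) := by
  have := Measure.integral_comp_div
    (fun t : ℝ => (ptri t : ℂ) * Complex.exp (-(Complex.I * t * (l * v : ℝ)))) l
  rw [ptri_fourier] at this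
  rw [fej]
  have h : (l:ℂ) ≠ 0 := by exact_mod_cast hl.ne'
  rw [show (fun t : ℝ => (ptri (t / l) : ℂ) * Complex.exp (-(Complex.I * t * v))) = 
    fun x : ℝ => ↑(ptri (x / l)) * Complex.exp (-(Complex.I * ↑(x / l) * ↑(l * v))) by
    ext x; congr 2; push_cast; field_simp, this, abs_of_pos hl]
  simp

theorem wiener_swap (f : ℝ → ℝ) (hf : Measurable f) (B : ℝ) (hB : ∀ u, |f u| ≤ B) (G : ℂ → ℂ)
    (hL : ∀ s : ℂ, 1 < s.re →
      ∫ u in Set.Ioi (0:ℝ), (f u : ℂ) * Complex.exp (-((s - 1) * u)) = G s)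
    (l : ℝ) (hl : 0 < l) (δ : ℝ) (hδ : 0 < δ) (y : ℝ) :
    ∫ u in Set.Ioi (0:ℝ), ((f u * rexp (-δ * u) * (l * fej (l * (u - y))) : ℝ) : ℂ) =
      ∫ t : ℝ, (ptri (t / l) : ℂ) * Complex.exp (Complex.I * t * y)
        * G (1 + δ + Complex.I * t) := by
  have hint : Integrable (fun u => f u * rexp (-δ * u)) (volume.restrict (Set.Ioi (0:ℝ))) := by
    refine ((exp_neg_integrableOn_Ioi 0 hδ).const_mul B).mono'
      (by fun_prop) ?_
    filter_upwards with u
    rw [norm_mul, norm_eq_abs, norm_of_nonneg (exp_pos _).le]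
    exact mul_le_mul_of_nonneg_right (hB u) (exp_pos _).le
  have hcs : HasCompactSupport (fun t => ptri (t / l)) := by
    have := ptri_supp.comp_homeomorph (Homeomorph.mulRight₀ l⁻¹ (inv_ne_zero hl.ne'))
    simpa [Function.comp_def, div_eq_mul_inv] using this
  have hc : Continuous (fun t => ptri (t / l)) := by
    have := ptri_cont
    fun_prop
  have hint2 : Integrable (fun t => ptri (t / l)) := hc.integrable_of_hasCompactSupport hcs
  calc ∫ u in Set.Ioi (0:ℝ), ((f u * rexp (-δ * u) * (l * fej (l * (u - y))) : ℝ) : ℂ)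
      = ∫ u in Set.Ioi (0:ℝ), ∫ t : ℝ, ((f u * rexp (-δ * u) : ℝ) : ℂ) *
          ((ptri (t / l) : ℂ) * Complex.exp (-(Complex.I * t * (u - y : ℝ)))) := by
        congr 1; ext u
        rw [integral_const_mul, fej_fourier l hl]
        push_cast; ring
    _ = ∫ t : ℝ, ∫ u in Set.Ioi (0:ℝ), ((f u * rexp (-δ * u) : ℝ) : ℂ) *
          ((ptri (t / l) : ℂ) * Complex.exp (-(Complex.I * t * (u - y : ℝ)))) := by
        apply integral_integral_swap
        refine (hint.mul_prod hint2).norm.mono' ?_ ?_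
        · have := ptri_cont
          apply Measurable.aestronglyMeasurable
          simp only [Function.uncurry_def]
          have h2 := this.measurable
          fun_prop
        · filter_upwards with p
          simp only [Function.uncurry_def]
          have : ‖Complex.exp (-(Complex.I * p.2 * (p.1 - y : ℝ)))‖ = 1 := by
            rw [Complex.norm_exp]; simp
          rw [norm_mul, norm_mul, this, mul_one, norm_mul, Complex.norm_real, Complex.norm_real]
    _ = _ := by
        congr 1; ext t
        rw [← hL (1 + δ + Complex.I * t) (by simpa using hδ), ← integral_const_mul]
        congr 1; ext u
        push_cast
        rw [show -(Complex.I * t * (u - y)) = Complex.I * t * y + -(Complex.I * t * u) by ring,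
          Complex.exp_add,
          show -((1 + δ + Complex.I * t - 1) * (u:ℂ)) = -δ * u + -(Complex.I * t * u) by ring,
          Complex.exp_add]
        ring

theorem wiener_eq (f : ℝ → ℝ) (hf : Measurable f) (B : ℝ) (hB : ∀ u, |f u| ≤ B) (G : ℂ → ℂ)
    (hG : ContinuousOn G {s | 1 ≤ s.re})
    (hL : ∀ s : ℂ, 1 < s.re →
      ∫ u in Set.Ioi (0:ℝ), (f u : ℂ) * Complex.exp (-((s - 1) * u)) = G s)
    (l : ℝ) (hl : 0 < l) (y : ℝ) :
    ∫ u in Set.Ioi (0:ℝ), ((f u * (l * fej (l * (u - y))) : ℝ) : ℂ) =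
      ∫ t : ℝ, (ptri (t / l) : ℂ) * Complex.exp (Complex.I * t * y)
        * G (1 + Complex.I * t) := by
  have hB0 : 0 ≤ B := (abs_nonneg _).trans (hB 0)
  have hfi : Integrable (fun u => l * fej (l * (u - y))) := by
    have h1 := (fej_int.comp_mul_left' hl.ne').comp_sub_right y
    exact h1.const_mul l
  have hlim1 : Tendsto (fun δ : ℝ => ∫ u in Set.Ioi (0:ℝ),
      ((f u * rexp (-δ * u) * (l * fej (l * (u - y))) : ℝ) : ℂ)) (nhdsWithin 0 (Set.Ioi 0))
      (nhds (∫ u in Set.Ioi (0:ℝ), ((f u * (l * fej (l * (u - y))) : ℝ) : ℂ))) := by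
    apply tendsto_integral_filter_of_dominated_convergence (fun u => B * (l * fej (l * (u - y))))
    · filter_upwards with δ
      have := fej_cont.measurable
      apply Measurable.aestronglyMeasurable
      fun_prop
    · filter_upwards [self_mem_nhdsWithin] with δ hδ
      filter_upwards [ae_restrict_mem measurableSet_Ioi] with u hu
      have hp : 0 ≤ l * fej (l * (u - y)) := mul_nonneg hl.le (fej_nonneg _)
      rw [Complex.norm_real, norm_mul, norm_mul, norm_of_nonneg hp]
      apply mul_le_mul_of_nonneg_right _ hp
      rw [norm_of_nonneg (exp_pos _).le]
      have h1 : rexp (-δ * u) ≤ 1 := by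
        rw [exp_le_one_iff]
        have : 0 < δ * u := mul_pos hδ hu
        linarith
      calc ‖f u‖ * rexp (-δ * u) ≤ B * 1 := mul_le_mul (hB u) h1 (exp_pos _).le hB0
        _ = B := mul_one B
    · exact (hfi.const_mul B).integrableOn
    · filter_upwards with u
      have : Continuous (fun δ : ℝ =>
        ((f u * rexp (-δ * u) * (l * fej (l * (u - y))) : ℝ) : ℂ)) := by fun_prop
      have h := (this.tendsto 0).mono_left (nhdsWithin_le_nhds (s := Set.Ioi 0))
      simpa using h
  have hlim2 : Tendsto (fun δ : ℝ => ∫ t : ℝ, (ptri (t / l) : ℂ) * Complex.exp (Complex.I * t * y)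
        * G (1 + δ + Complex.I * t)) (nhdsWithin 0 (Set.Ioi 0))
      (nhds (∫ t : ℝ, (ptri (t / l) : ℂ) * Complex.exp (Complex.I * t * y)
        * G (1 + Complex.I * t))) := by
    have hGc : ContinuousOn (fun p : ℝ × ℝ => G (1 + p.1 + Complex.I * p.2))
        (Set.Icc 0 1 ×ˢ Set.Icc (-l) l) := by
      refine hG.comp (by fun_prop) ?_
      intro p hp
      simpa using hp.1.1
    obtain ⟨M, hM⟩ := (isCompact_Icc.prod isCompact_Icc).exists_bound_of_continuousOn hGc
    have hz : ∀ t, t ∉ Set.Icc (-l) l → ptri (t / l) = 0 := by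
      intro t ht
      apply ptri_zero
      rw [abs_div, abs_of_pos hl, le_div_iff₀ hl, one_mul]
      by_contra h
      exact ht ⟨by linarith [(abs_lt.mp (not_le.mp h)).1], by linarith [(abs_lt.mp (not_le.mp h)).2]⟩
    have hGt : ∀ δ : ℝ, 0 ≤ δ → Continuous (fun t : ℝ => G (1 + δ + Complex.I * t)) := by
      intro δ hδ
      refine hG.comp_continuous (by fun_prop) ?_
      intro t; simpa using hδ
    apply tendsto_integral_filter_of_dominated_convergence
      ((Set.Icc (-l) l).indicator (fun _ => M))
    · filter_upwards [self_mem_nhdsWithin] with δ hδ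
      have h1 := hGt δ (le_of_lt hδ)
      have h2 := ptri_cont
      apply Continuous.aestronglyMeasurable
      exact ((Complex.continuous_ofReal.comp (h2.comp (continuous_id.div_const l))).mul
        (by fun_prop)).mul h1
    · filter_upwards [Ioo_mem_nhdsGT (zero_lt_one' ℝ)] with δ hδ
      filter_upwards with t
      by_cases ht : t ∈ Set.Icc (-l) l
      · rw [Set.indicator_of_mem ht, norm_mul, norm_mul]
        have e1 : ‖Complex.exp (Complex.I * t * y)‖ = 1 := by
          rw [Complex.norm_exp]; simp
        rw [e1, mul_one, Complex.norm_real, norm_of_nonneg (ptri_nonneg _)]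
        have h3 := hM (δ, t) ⟨⟨hδ.1.le, hδ.2.le⟩, ht⟩
        simp only at h3
        have h4 := ptri_le_one (t / l)
        have h5 := ptri_nonneg (t / l)
        nlinarith [norm_nonneg (G (1 + δ + Complex.I * t))]
      · rw [Set.indicator_of_notMem ht, hz t ht]; simp
    · exact (integrable_indicator_iff measurableSet_Icc).mpr (by simp)
    · filter_upwards with t
      apply Tendsto.const_mul
      have h1 : Tendsto (fun δ : ℝ => (1 + δ + Complex.I * t : ℂ)) (nhdsWithin 0 (Set.Ioi 0))
          (nhdsWithin (1 + Complex.I * t) {s | 1 ≤ s.re}) := by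
        apply tendsto_nhdsWithin_of_tendsto_nhds_of_eventually_within
        · have : Continuous (fun δ : ℝ => (1 + δ + Complex.I * t : ℂ)) := by fun_prop
          have h := (this.tendsto 0).mono_left (nhdsWithin_le_nhds (s := Set.Ioi 0))
          simpa using h
        · filter_upwards [self_mem_nhdsWithin] with δ hδ
          simpa using (le_of_lt hδ)
      exact (hG (1 + Complex.I * t) (by simp)).tendsto.comp h1
  refine tendsto_nhds_unique hlim1 (hlim2.congr' ?_)
  filter_upwards [self_mem_nhdsWithin] with δ hδ
  exact (wiener_swap f hf B hB G hL l hl δ hδ y).symm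

theorem wiener (f : ℝ → ℝ) (hf : Measurable f) (B : ℝ) (hB : ∀ u, |f u| ≤ B) (G : ℂ → ℂ)
    (hG : ContinuousOn G {s | 1 ≤ s.re})
    (hL : ∀ s : ℂ, 1 < s.re →
      ∫ u in Set.Ioi (0:ℝ), (f u : ℂ) * Complex.exp (-((s - 1) * u)) = G s)
    (l : ℝ) (hl : 0 < l) :
    Tendsto (fun y => ∫ u in Set.Ioi (0:ℝ), f u * (l * fej (l * (u - y)))) atTop (nhds 0) := by
  have h1 := Real.tendsto_integral_exp_smul_cocompact
    (fun t : ℝ => (ptri (t / l) : ℂ) * G (1 + Complex.I * t))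
  have h2 : Tendsto (fun y : ℝ => -(y / (2 * π))) atTop (cocompact ℝ) := by
    refine Tendsto.mono_right ?_ atBot_le_cocompact
    exact tendsto_neg_atTop_atBot.comp (tendsto_id.atTop_div_const (by positivity))
  have h3 := h1.comp h2
  have h4 : Tendsto (fun y => ((∫ u in Set.Ioi (0:ℝ), f u * (l * fej (l * (u - y))) : ℝ) : ℂ))
      atTop (nhds 0) := by
    refine h3.congr ?_
    intro y
    refine Eq.trans ?_ (integral_ofReal (𝕜 := ℂ)
      (f := fun u => f u * (l * fej (l * (u - y)))) (μ := volume.restrict (Set.Ioi (0:ℝ))))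
    refine Eq.trans ?_ (wiener_eq f hf B hB G hG hL l hl y).symm
    simp only [Function.comp]
    congr 1; ext t
    rw [Circle.smul_def, Real.fourierChar_apply, smul_eq_mul]
    have : (2 * (π:ℂ) * ((-(t * -(y / (2 * π))) : ℝ) : ℂ) * Complex.I) = Complex.I * t * y := by
      have : (π:ℂ) ≠ 0 := by exact_mod_cast pi_ne_zero
      push_cast; field_simp
    push_cast at this ⊢
    rw [this]
    ring
  simpa [Function.comp_def] using (Complex.continuous_re.tendsto 0).comp h4

noncomputable def hpsi (u : ℝ) : ℝ := Chebyshev.psi (rexp u) * rexp (-u)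

theorem hpsi_nonneg (u : ℝ) : 0 ≤ hpsi u := mul_nonneg (Chebyshev.psi_nonneg _) (exp_pos _).le
theorem hpsi_meas : Measurable hpsi := by
  have := Chebyshev.psi_mono.measurable
  unfold hpsi; fun_prop
theorem hpsi_le (u : ℝ) : hpsi u ≤ log 4 + 4 := by
  have h := Chebyshev.psi_le_const_mul_self (exp_pos u).le
  have := mul_le_mul_of_nonneg_right h (exp_pos (-u)).le
  rw [mul_assoc, ← exp_add, add_neg_cancel, exp_zero, mul_one] at this
  exact this
theorem hpsi_slow (u v : ℝ) (h : u ≤ v) : hpsi u * rexp (-(v - u)) ≤ hpsi v := by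
  have h1 := Chebyshev.psi_mono (exp_le_exp.mpr h)
  unfold hpsi
  rw [mul_assoc, ← exp_add, show -u + -(v - u) = -v by ring]
  exact mul_le_mul_of_nonneg_right h1 (exp_pos _).le

theorem hpsi_bdd (u : ℝ) : |hpsi u - 1| ≤ log 4 + 4 := by
  have h1 := hpsi_nonneg u
  have h2 := hpsi_le u
  have : 0 ≤ log 4 := log_nonneg (by norm_num)
  rw [abs_le]; constructor <;> linarith

theorem LSeries_hpsi (s : ℂ) (hs : 1 < s.re) :
    LSeries (fun n => (ArithmeticFunction.vonMangoldt n : ℂ)) s =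
      s * ∫ u in Set.Ioi (0:ℝ), (hpsi u : ℂ) * Complex.exp (-((s - 1) * u)) := by
  have hpsiN : ∀ x : ℝ, Chebyshev.psi x = ∑ k ∈ Finset.Icc 1 ⌊x⌋₊, ArithmeticFunction.vonMangoldt k := by
    intro x
    rw [Chebyshev.psi]
    rfl
  have h := LSeries_eq_mul_integral_of_nonneg (fun n => ArithmeticFunction.vonMangoldt n)
    (r := 1) zero_le_one hs (by
      refine Asymptotics.IsBigO.of_bound (log 4 + 4) ?_
      filter_upwards with n
      have h1 := hpsiN n
      rw [Nat.floor_natCast] at h1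
      rw [← h1, norm_of_nonneg (Chebyshev.psi_nonneg _), rpow_one, norm_of_nonneg n.cast_nonneg]
      exact Chebyshev.psi_le_const_mul_self n.cast_nonneg)
    (fun n => ArithmeticFunction.vonMangoldt_nonneg)
  rw [h]
  congr 1
  have him : rexp '' Set.Ioi 0 = Set.Ioi 1 := by
    ext x
    constructor
    · rintro ⟨u, hu, rfl⟩
      exact one_lt_exp_iff.mpr hu
    · intro hx
      exact ⟨log x, log_pos hx, exp_log (by linarith [Set.mem_Ioi.mp hx])⟩
  rw [← him, integral_image_eq_integral_abs_deriv_smul measurableSet_Ioi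
    (fun x _ => (hasDerivAt_exp x).hasDerivWithinAt) exp_injective.injOn]
  congr 1; ext u
  rw [abs_of_pos (exp_pos _), ← Complex.ofReal_sum, ← hpsiN, hpsi, Complex.real_smul,
    Complex.cpow_def_of_ne_zero (by exact_mod_cast (exp_pos u).ne'),
    ← Complex.ofReal_log (exp_pos u).le, log_exp]
  push_cast
  rw [mul_assoc, ← Complex.exp_add, mul_left_comm, ← Complex.exp_add]
  congr 2; ring

theorem laplace_hpsi (s : ℂ) (hs : 1 < s.re) :
    ∫ u in Set.Ioi (0:ℝ), ((hpsi u - 1 : ℝ) : ℂ) * Complex.exp (-((s - 1) * u)) =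
      (ArithmeticFunction.vonMangoldt.LFunctionResidueClassAux (1 : ZMod 1) s - 1) / s := by
  have h1 := ArithmeticFunction.vonMangoldt.eqOn_LFunctionResidueClassAux (a := (1 : ZMod 1))
    isUnit_one hs
  have e : (fun n => (ArithmeticFunction.vonMangoldt.residueClass (1 : ZMod 1) n : ℂ)) =
      (fun n => (ArithmeticFunction.vonMangoldt n : ℂ)) := by
    ext n
    rw [ArithmeticFunction.vonMangoldt.residueClass, Set.indicator_of_mem]
    exact Subsingleton.elim _ _
  simp only [] at h1
  rw [e, LSeries_hpsi s hs] at h1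
  rw [h1]
  have hre : (-(s - 1)).re < 0 := by simpa using hs
  have hint := integrableOn_exp_mul_complex_Ioi hre 0
  have hval := integral_exp_mul_complex_Ioi hre 0
  have hint2 : IntegrableOn (fun u : ℝ => (hpsi u : ℂ) * Complex.exp (-(s - 1) * u))
      (Set.Ioi 0) := by
    refine Integrable.bdd_mul (c := log 4 + 4) hint ?_ ?_
    · exact (Complex.measurable_ofReal.comp hpsi_meas).aestronglyMeasurable
    · filter_upwards with u
      rw [Complex.norm_real, norm_of_nonneg (hpsi_nonneg u)]; exact hpsi_le u
  have hs0 : s ≠ 0 := by rintro rfl; simp at hs; linarith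
  have hs1 : s - 1 ≠ 0 := by
    intro h
    rw [sub_eq_zero.mp h] at hs; simp at hs
  simp only [← neg_mul]
  have : ∀ u : ℝ, ((hpsi u - 1 : ℝ) : ℂ) * Complex.exp (-(s - 1) * u) =
    (hpsi u : ℂ) * Complex.exp (-(s - 1) * u) - Complex.exp (-(s - 1) * u) := by
    intro u; push_cast; ring
  simp only [this]
  rw [integral_sub hint2 hint, hval]
  simp only [Nat.totient_one, Complex.ofReal_zero, mul_zero, Complex.exp_zero, Nat.cast_one, inv_one]
  field_simp
  ring

theorem wiener_hpsi (l : ℝ) (hl : 0 < l) :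
    Tendsto (fun y => ∫ u in Set.Ioi (0:ℝ), (hpsi u - 1) * (l * fej (l * (u - y))))
      atTop (nhds 0) := by
  refine wiener (fun u => hpsi u - 1) (hpsi_meas.sub_const 1) _ hpsi_bdd
    (fun s => (ArithmeticFunction.vonMangoldt.LFunctionResidueClassAux (1 : ZMod 1) s - 1) / s)
    ?_ laplace_hpsi l hl
  refine ContinuousOn.div ((ArithmeticFunction.vonMangoldt.continuousOn_LFunctionResidueClassAux
    (1 : ZMod 1)).sub continuousOn_const) continuousOn_id ?_
  rintro s hs rfl
  simp at hs
  linarith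

theorem fej_tail (e : ℝ) (he : 0 < e) :
    ∃ R : ℝ, 0 < R ∧ ∫ v, {v : ℝ | R < |v|}.indicator fej v < e := by
  have hms : ∀ R : ℝ, MeasurableSet {v : ℝ | R < |v|} := fun R =>
    (isOpen_lt continuous_const continuous_abs).measurableSet
  have h : Tendsto (fun R : ℝ => ∫ v, {v : ℝ | R < |v|}.indicator fej v) atTop
      (nhds (∫ v : ℝ, (0:ℝ))) := by
    apply tendsto_integral_filter_of_dominated_convergence fej
    · filter_upwards with R
      exact fej_cont.aestronglyMeasurable.indicator (hms R)
    · filter_upwards with R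
      filter_upwards with v
      rw [norm_of_nonneg (Set.indicator_nonneg (fun v _ => fej_nonneg v) v)]
      exact Set.indicator_le_self' (fun v _ => fej_nonneg v) v
    · exact fej_int
    · filter_upwards with v
      refine tendsto_const_nhds.congr' ?_
      filter_upwards [eventually_ge_atTop |v|] with R hR
      rw [Set.indicator_of_notMem]
      simpa using hR
  rw [integral_zero] at h
  obtain ⟨R, h1, h2⟩ := ((h.eventually (gt_mem_nhds he)).and (eventually_gt_atTop 0)).exists
  exact ⟨R, h2, h1⟩

theorem no_plateau (g : ℝ → ℝ) (hg : Measurable g) (B : ℝ) (hB : ∀ u, |g u| ≤ B)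
    (hT : ∀ l : ℝ, 0 < l →
      Tendsto (fun y => ∫ u in Set.Ioi (0:ℝ), g u * (l * fej (l * (u - y)))) atTop (nhds 0))
    (ε η : ℝ) (hε : 0 < ε) (hη : 0 < η) :
    ∀ᶠ y in atTop, ¬ ∀ u, |u - y| ≤ η → ε ≤ g u := by
  have hB0 : 0 ≤ B := (abs_nonneg _).trans (hB 0)
  obtain ⟨R, hR, htail⟩ := fej_tail (ε * (∫ v, fej v) / (2 * (B + ε)))
    (div_pos (mul_pos hε fej_pos) (by positivity))
  have hl : 0 < R / η := div_pos hR hη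
  have hev := (hT (R / η) hl).eventually
    (gt_mem_nhds (show 0 < ε * (∫ v, fej v) / 2 from half_pos (mul_pos hε fej_pos)))
  filter_upwards [hev, eventually_gt_atTop η] with y hy hyη hcon
  set l := R / η with hldef
  set g' : ℝ → ℝ := (Set.Ioi (0:ℝ)).indicator g with hg'
  have hg'm : Measurable g' := hg.indicator measurableSet_Ioi
  have hg'B : ∀ u, |g' u| ≤ B := by
    intro u
    by_cases hu : u ∈ Set.Ioi (0:ℝ)
    · rw [hg', Set.indicator_of_mem hu]; exact hB u
    · rw [hg', Set.indicator_of_notMem hu]; simpa using hB0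
  have e1 : ∫ u in Set.Ioi (0:ℝ), g u * (l * fej (l * (u - y))) =
      ∫ v, g' (y + v / l) * fej v := by
    rw [← integral_indicator measurableSet_Ioi]
    have h1 := Measure.integral_comp_mul_left (fun v => g' (y + v / l) * (l * fej v)) l
    have h2 := integral_sub_right_eq_self (μ := volume)
      (fun u => g' (y + l * u / l) * (l * fej (l * u))) y
    rw [h1, abs_of_pos (inv_pos.mpr hl), smul_eq_mul] at h2
    have h3 : ∀ v, g' (y + v / l) * (l * fej v) = l * (g' (y + v / l) * fej v) := by
      intro v; ring
    simp only [h3, integral_const_mul] at h2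
    rw [inv_mul_cancel_left₀ hl.ne'] at h2
    rw [← h2, ← integral_const_mul]
    congr 1; ext u
    rw [mul_div_cancel_left₀ _ hl.ne', add_sub_cancel]
    by_cases hu : u ∈ Set.Ioi (0:ℝ)
    · rw [hg', Set.indicator_of_mem hu, Set.indicator_of_mem hu]; ring
    · rw [hg', Set.indicator_of_notMem hu, Set.indicator_of_notMem hu]; ring
  rw [e1] at hy
  have hms : MeasurableSet {v : ℝ | R < |v|} :=
    (isOpen_lt continuous_const continuous_abs).measurableSet
  have hind : Integrable ({v : ℝ | R < |v|}.indicator fej) := fej_int.indicator hms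
  have hge : ∫ v, (ε * fej v - (B + ε) * {v : ℝ | R < |v|}.indicator fej v) ≤
      ∫ v, g' (y + v / l) * fej v := by
    apply integral_mono ((fej_int.const_mul _).sub (hind.const_mul _))
    · refine Integrable.bdd_mul (c := B) fej_int ?_ ?_
      · exact (hg'm.comp (by fun_prop)).aestronglyMeasurable
      · filter_upwards with v; exact hg'B _
    · intro v
      have hk := fej_nonneg v
      by_cases hv : R < |v|
      · simp only [Pi.sub_apply]
        rw [Set.indicator_of_mem (show v ∈ {v : ℝ | R < |v|} from hv)]
        have := (abs_le.mp (hg'B (y + v / l))).1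
        nlinarith
      · simp only [Pi.sub_apply]
        rw [Set.indicator_of_notMem (show v ∉ {v : ℝ | R < |v|} from hv)]
        have h1 : |v / l| ≤ η := by
          rw [abs_div, abs_of_pos hl, div_le_iff₀ hl, hldef, mul_div_cancel₀ _ hη.ne']
          exact not_lt.mp hv
        have h2 : y + v / l ∈ Set.Ioi (0:ℝ) := by
          have := (abs_le.mp h1).1
          simp only [Set.mem_Ioi]; linarith
        have h3 := hcon (y + v / l) (by simpa using h1)
        rw [hg', Set.indicator_of_mem h2]
        nlinarith
  rw [integral_sub (fej_int.const_mul _) (hind.const_mul _), integral_const_mul,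
    integral_const_mul] at hge
  rw [lt_div_iff₀ (by positivity)] at htail
  nlinarith

theorem hpsi_tendsto : Tendsto hpsi atTop (nhds 1) := by
  have hup := no_plateau (fun u => hpsi u - 1) (hpsi_meas.sub_const 1) _ hpsi_bdd wiener_hpsi
  have hlo := no_plateau (fun u => -(hpsi u - 1)) (hpsi_meas.sub_const 1).neg (log 4 + 4)
    (by intro u; rw [abs_neg]; exact hpsi_bdd u)
    (by intro l hl
        have := (wiener_hpsi l hl).neg
        simpa only [neg_mul, integral_neg, neg_zero] using this)
  rw [Metric.tendsto_nhds]
  intro ε hε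
  have ht1 : Tendsto (fun η : ℝ => (1 + ε) * rexp (-(2 * η))) (nhdsWithin 0 (Set.Ioi 0))
      (nhds (1 + ε)) := by
    have : Continuous (fun η : ℝ => (1 + ε) * rexp (-(2 * η))) := by fun_prop
    simpa using (this.tendsto 0).mono_left (nhdsWithin_le_nhds (s := Set.Ioi 0))
  have ht2 : Tendsto (fun η : ℝ => (1 - ε) * rexp (2 * η)) (nhdsWithin 0 (Set.Ioi 0))
      (nhds (1 - ε)) := by
    have : Continuous (fun η : ℝ => (1 - ε) * rexp (2 * η)) := by fun_prop
    simpa using (this.tendsto 0).mono_left (nhdsWithin_le_nhds (s := Set.Ioi 0))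
  obtain ⟨η, ⟨h1, h2⟩, hη⟩ := ((((ht1.eventually
    (lt_mem_nhds (show 1 + ε / 2 < 1 + ε by linarith))).and
    (ht2.eventually (gt_mem_nhds (show 1 - ε < 1 - ε / 2 by linarith))))).and
      self_mem_nhdsWithin).exists
  have hη : 0 < η := hη
  have hu := (tendsto_atTop_add_const_right atTop η tendsto_id).eventually
    (hup (ε / 2) η (half_pos hε) hη)
  have hd := (tendsto_atTop_add_const_right atTop (-η) tendsto_id).eventually
    (hlo (ε / 2) η (half_pos hε) hη)
  filter_upwards [hu, hd] with x hx1 hx2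
  rw [Real.dist_eq]
  by_contra hcon
  rw [not_lt, le_abs] at hcon
  rcases hcon with hcon | hcon
  · apply hx1
    intro u hu
    simp only [id] at hu
    rw [abs_le] at hu
    have h3 := hpsi_slow x u (by linarith)
    have h4 : rexp (-(2 * η)) ≤ rexp (-(u - x)) := exp_le_exp.mpr (by linarith)
    have h5 : (1 + ε) * rexp (-(2 * η)) ≤ hpsi x * rexp (-(u - x)) :=
      mul_le_mul (by linarith) h4 (exp_pos _).le (hpsi_nonneg x)
    linarith
  · apply hx2
    intro u hu
    simp only [id] at hu
    rw [abs_le] at hu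
    have h3 := hpsi_slow u x (by linarith)
    have h4 : hpsi u ≤ hpsi x * rexp (x - u) := by
      have := mul_le_mul_of_nonneg_right h3 (exp_pos (x - u)).le
      rwa [mul_assoc, ← exp_add, neg_add_cancel, exp_zero, mul_one] at this
    have h5 : hpsi x * rexp (x - u) ≤ (1 - ε) * rexp (2 * η) :=
      mul_le_mul (by linarith) (exp_le_exp.mpr (by linarith)) (exp_pos _).le
        (by linarith [hpsi_nonneg x])
    linarith

theorem psi_div_tendsto : Tendsto (fun x => Chebyshev.psi x / x) atTop (nhds 1) := by
  refine (hpsi_tendsto.comp tendsto_log_atTop).congr' ?_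
  filter_upwards [eventually_gt_atTop 0] with x hx
  simp only [Function.comp, hpsi]
  rw [exp_neg, exp_log hx, div_eq_mul_inv]

theorem theta_div_tendsto : Tendsto (fun x => Chebyshev.theta x / x) atTop (nhds 1) := by
  obtain ⟨C, hC⟩ := Chebyshev.psi_sub_theta_le_mul_sqrt
  have h1 : Tendsto (fun x : ℝ => C * (√x)⁻¹) atTop (nhds 0) := by
    simpa using (tendsto_sqrt_atTop.inv_tendsto_atTop).const_mul C
  have h2 : Tendsto (fun x => (Chebyshev.psi x - Chebyshev.theta x) / x) atTop (nhds 0) := by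
    refine tendsto_of_tendsto_of_tendsto_of_le_of_le' tendsto_const_nhds h1 ?_ ?_
    · filter_upwards [eventually_gt_atTop 0] with x hx
      exact div_nonneg (sub_nonneg.mpr (Chebyshev.theta_le_psi x)) hx.le
    · filter_upwards [eventually_gt_atTop 0] with x hx
      rw [div_le_iff₀ hx]
      refine (hC x).trans (le_of_eq ?_)
      have h3 : √x ≠ 0 := (sqrt_pos.mpr hx).ne'
      have h4 := mul_self_sqrt hx.le
      have h5 : (√x)⁻¹ * x = √x := by
        nth_rewrite 2 [← h4]
        rw [inv_mul_cancel_left₀ h3]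
      rw [mul_assoc, h5]
  have := psi_div_tendsto.sub h2
  rw [sub_zero] at this
  refine this.congr ?_
  intro x; ring

/-- **The Prime Number Theorem.** Let `π_ℙ(x)` denote the number of primes `p ≤ x`.
Then `π_ℙ(x) · (log x) / x → 1` as `x → ∞`. -/
theorem prime_number_theorem :
    Tendsto (fun x : ℝ => (Nat.primeCounting ⌊x⌋₊ : ℝ) * Real.log x / x)
      atTop (nhds 1) := by
  have h1 : Tendsto (fun x : ℝ => (∫ t in 2..x, Chebyshev.theta t / (t * log t ^ 2)) /
      (x / log x)) atTop (nhds 0) := Chebyshev.integral_theta_div_log_sq_isLittleO.tendsto_div_nhds_zero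
  have h2 := theta_div_tendsto.add h1
  rw [add_zero] at h2
  refine h2.congr' ?_
  filter_upwards [eventually_ge_atTop 2] with x hx
  rw [Chebyshev.primeCounting_eq_theta_div_log_add_integral hx]
  have hx0 : x ≠ 0 := by linarith
  have hlx : log x ≠ 0 := (log_pos (by linarith)).ne'
  field_simp
end

section
/- (Wiener–Ikehara–Korevaar theorem, main direction.) Let S : [0,∞) → ℝ be non-decreasing and suppose its Laplace transform 𝓛S(s) = ∫₀^∞ S(u)e^{−su} du converges for every s with Re s > 1. Let A ∈ ℝ and set g(s) = 𝓛S(s) − A/(s−1) for Re s > 1. Suppose that for every R > 0 there exists a bounded measurable function v : ℝ → ℂ with v(x) → 0 as |x| → ∞, such that for every smooth compactly supported φ : ℝ → ℂ with support contained in [−R, R], lim_{ε→0⁺} ∫_ℝ g(1+ε+it) φ(t) dt = ∫_ℝ v(x) φ̂(x) dx, where φ̂(x) = ∫_ℝ φ(t) e^{−ixt} dt. Then lim_{u→∞} S(u)/e^u = A. -/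
open MeasureTheory Set Filter

open scoped FourierTransform Convolution in
lemma wik_exists_kernel : ∃ (φ : ℝ → ℂ) (k : ℝ → ℝ) (r : ℝ), 0 < r ∧ ContDiff ℝ (⊤ : ℕ∞) φ ∧
    HasCompactSupport φ ∧ tsupport φ ⊆ Icc (-r) r ∧
    (∀ u : ℝ, ∫ t : ℝ, φ t * Complex.exp (-Complex.I * u * t) = (k u : ℂ)) ∧
    (∀ u, 0 ≤ k u) ∧ Continuous k ∧ Integrable k ∧ ∫ u, k u = 1 := by
  let f : ContDiffBump (0 : ℝ) := ⟨1, 2, one_pos, one_lt_two⟩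
  let ψ : ℝ → ℂ := fun t => (f t : ℂ)
  have hψs : ContDiff ℝ (⊤ : ℕ∞) ψ := Complex.ofRealCLM.contDiff.comp f.contDiff
  have hψc : HasCompactSupport ψ := f.hasCompactSupport.comp_left (g := fun x : ℝ => (x : ℂ)) (by simp)
  have hψi : Integrable ψ := hψs.continuous.integrable_of_hasCompactSupport hψc
  let φ : ℝ → ℂ := ψ ⋆[ContinuousLinearMap.mul ℝ ℂ] ψ
  have hφs : ContDiff ℝ (⊤ : ℕ∞) φ :=
    hψc.contDiff_convolution_right (ContinuousLinearMap.mul ℝ ℂ) hψi.locallyIntegrable hψs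
  have hφc : HasCompactSupport φ := hψc.convolution (ContinuousLinearMap.mul ℝ ℂ) hψc
  have hreal : ∀ ξ, (starRingEnd ℂ) (𝓕 ψ ξ) = 𝓕 ψ ξ := by
    intro ξ
    rw [Real.fourier_real_eq_integral_exp_smul, ← integral_conj, ← integral_neg_eq_self]
    congr 1 with t
    simp only [ψ, f.neg, smul_eq_mul, map_mul, Complex.conj_ofReal, ← Complex.exp_conj]
    congr 2
    simp
  have hF : ∀ ξ, 𝓕 φ ξ = (((𝓕 ψ ξ).re ^ 2 : ℝ) : ℂ) := by
    intro ξ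
    have h1 := Complex.conj_eq_iff_re.1 (hreal ξ)
    have h2 : 𝓕 φ ξ = 𝓕 ψ ξ * 𝓕 ψ ξ := Real.fourier_mul_convolution_eq hψi hψi ξ
    rw [h2]
    push_cast
    rw [h1, sq]
  let Φ := hφc.toSchwartzMap hφs
  have hΦ : ∀ ξ, (𝓕 Φ) ξ = 𝓕 φ ξ := fun ξ => by
    rw [SchwartzMap.fourier_coe]; rfl
  let k0 : ℝ → ℝ := fun ξ => (𝓕 ψ ξ).re ^ 2
  have hk0 : k0 = fun ξ => ((𝓕 Φ) ξ).re := by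
    ext ξ; rw [hΦ, hF]; simp only [k0, Complex.ofReal_re]
  have hk0c : Continuous k0 := by
    rw [hk0]; exact Complex.continuous_re.comp (𝓕 Φ).continuous
  have hk0i : Integrable k0 := by
    rw [hk0]; exact (𝓕 Φ).integrable.re
  have hk00 : 0 < k0 0 := by
    have : 𝓕 ψ 0 = ((∫ t, f t : ℝ) : ℂ) := by
      rw [Real.fourier_real_eq_integral_exp_smul]
      simp [ψ, integral_complex_ofReal]
    simp only [k0, this, Complex.ofReal_re]
    have := f.integral_pos (μ := volume)
    positivity
  have hpi : (1 / (2 * Real.pi)) ≠ 0 := by positivity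
  let k1 : ℝ → ℝ := fun u => k0 (1 / (2 * Real.pi) * u)
  have hk1c : Continuous k1 := hk0c.comp (by fun_prop)
  have hk1i : Integrable k1 := (integrable_comp_mul_left_iff k0 hpi).2 hk0i
  have hk1n : ∀ u, 0 ≤ k1 u := fun u => sq_nonneg _
  have hI : 0 < ∫ u, k1 u := by
    exact integral_pos_of_integrable_nonneg_nonzero hk1c hk1i hk1n (x := 0) (by simpa [k1] using hk00.ne')
  obtain ⟨r, hr⟩ := hφc.isCompact.isBounded.subset_closedBall 0
  refine ⟨fun t => ((∫ u, k1 u : ℝ) : ℂ)⁻¹ * φ t, fun u => (∫ u, k1 u)⁻¹ * k1 u, max r 1, by positivity,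
    contDiff_const.mul hφs, hφc.mul_left, ?_, ?_, ?_, ?_, ?_, ?_⟩
  · refine (tsupport_mul_subset_right (f := fun _ => ((∫ u, k1 u : ℝ) : ℂ)⁻¹) (g := φ)).trans (hr.trans ?_)
    rw [Real.closedBall_eq_Icc]
    apply Icc_subset_Icc <;> simp
  · intro u
    have h := hF (1 / (2 * Real.pi) * u)
    rw [Real.fourier_real_eq_integral_exp_smul] at h
    simp_rw [mul_assoc, integral_const_mul]
    push_cast
    congr 1
    have : (k1 u : ℂ) = (((𝓕 ψ (1 / (2 * Real.pi) * u)).re ^ 2 : ℝ) : ℂ) := rfl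
    rw [this, ← h]
    congr 1 with t
    rw [smul_eq_mul, mul_comm]
    congr 2
    push_cast
    have : (Real.pi : ℂ) ≠ 0 := by exact_mod_cast Real.pi_ne_zero
    field_simp
  · intro u
    exact mul_nonneg (inv_nonneg.2 hI.le) (hk1n u)
  · exact continuous_const.mul hk1c
  · exact hk1i.const_mul _
  · rw [integral_const_mul, inv_mul_cancel₀ hI.ne']

lemma wik_scaled_kernel (δ η : ℝ) (hδ : 0 < δ) (hη : 0 < η) :
    ∃ (φ : ℝ → ℂ) (k : ℝ → ℝ) (r : ℝ), 0 < r ∧ ContDiff ℝ (⊤ : ℕ∞) φ ∧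
    HasCompactSupport φ ∧ tsupport φ ⊆ Icc (-r) r ∧
    (∀ u : ℝ, ∫ t : ℝ, φ t * Complex.exp (-Complex.I * u * t) = (k u : ℂ)) ∧
    (∀ u, 0 ≤ k u) ∧ Continuous k ∧ Integrable k ∧ ∫ u, k u = 1 ∧
    1 - η ≤ ∫ u in Icc (-δ) δ, k u := by
  obtain ⟨φ, k, r, hr, hs, hc, hsup, hF, hk0, hkc, hki, hk1⟩ := wik_exists_kernel
  have h1 : Tendsto (fun l : ℝ => ∫ u in (-(l * δ))..(l * δ), k u) atTop (nhds 1) := by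
    rw [← hk1]
    have h2 : Tendsto (fun l : ℝ => l * δ) atTop atTop := tendsto_id.atTop_mul_const hδ
    exact intervalIntegral_tendsto_integral hki (tendsto_neg_atTop_atBot.comp h2) h2
  obtain ⟨l, hl, hl0⟩ := ((h1.eventually_const_le (show 1 - η < 1 by linarith)).and
    (eventually_gt_atTop 0)).exists
  have hcomp : HasCompactSupport fun t => φ (l⁻¹ * t) :=
    hc.comp_homeomorph (Homeomorph.mulLeft₀ l⁻¹ (inv_ne_zero hl0.ne'))
  refine ⟨fun t => φ (l⁻¹ * t), fun u => l * k (l * u), l * r, by positivity,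
    hs.comp (by fun_prop), hcomp, ?_, ?_, ?_, by fun_prop, ?_, ?_, ?_⟩
  · refine closure_minimal ?_ isClosed_Icc
    intro t ht
    have := hsup (subset_tsupport φ ht)
    rw [mem_Icc] at this ⊢
    have e : t = l * (l⁻¹ * t) := by field_simp
    constructor
    · rw [e]; nlinarith
    · rw [e]; nlinarith
  · intro u
    have h := Measure.integral_comp_mul_left (fun s : ℝ => φ s * Complex.exp (-Complex.I * (l * u : ℝ) * s)) l⁻¹
    rw [hF] at h
    rw [abs_of_pos (by positivity), inv_inv, Complex.real_smul] at h
    push_cast at h ⊢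
    rw [← h]
    congr 1 with t
    congr 2
    have : (l : ℂ) ≠ 0 := by exact_mod_cast hl0.ne'
    field_simp
  · intro u
    exact mul_nonneg hl0.le (hk0 _)
  · exact ((integrable_comp_mul_left_iff k hl0.ne').2 hki).const_mul _
  · rw [integral_const_mul, Measure.integral_comp_mul_left, hk1, abs_of_pos (by positivity)]
    simp [hl0.ne']
  · rw [integral_Icc_eq_integral_Ioc, ← intervalIntegral.integral_of_le (by linarith),
      intervalIntegral.integral_const_mul, intervalIntegral.integral_comp_mul_left _ hl0.ne']
    rw [smul_eq_mul, mul_inv_cancel_left₀ hl0.ne', mul_neg]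
    exact hl

lemma wik_tauber (W : ℝ → ℝ) (A : ℝ) (hW0 : ∀ u, 0 ≤ W u) (hWz : ∀ u ≤ 0, W u = 0)
    (hWm : ∀ u v, u ≤ v → W u * Real.exp u ≤ W v * Real.exp v)
    (H : ∀ δ : ℝ, 0 < δ → ∃ k : ℝ → ℝ, (∀ u, 0 ≤ k u) ∧ Integrable k ∧ ∫ u, k u = 1 ∧
      1 - δ ≤ ∫ u in Icc (-δ) δ, k u ∧ (∀ x, Integrable (fun y => W (y + x) * k y)) ∧
      Tendsto (fun x => ∫ y, W (y + x) * k y) atTop (nhds A)) :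
    Tendsto W atTop (nhds A) := by
  have hcmp : ∀ δ u v, u ≤ v → v ≤ u + 2 * δ → W u * Real.exp (-(2 * δ)) ≤ W v := by
    intro δ u v h1 h2
    have h := hWm u v h1
    have e : W u * Real.exp (u - v) ≤ W v := by
      rw [Real.exp_sub, ← mul_div_assoc, div_le_iff₀ (Real.exp_pos _)]; exact h
    refine le_trans (mul_le_mul_of_nonneg_left (Real.exp_le_exp.2 (by linarith)) (hW0 u)) e
  -- step 1
  have hlow : ∀ (δ : ℝ) (k : ℝ → ℝ), (∀ u, 0 ≤ k u) → Integrable k →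
      1 - δ ≤ ∫ u in Icc (-δ) δ, k u → (∀ x, Integrable (fun y => W (y + x) * k y)) →
      ∀ x, W (x - δ) * Real.exp (-(2 * δ)) * (1 - δ) ≤ ∫ y, W (y + x) * k y := by
    intro δ k hk0 hki hkδ hInteg x
    calc W (x - δ) * Real.exp (-(2 * δ)) * (1 - δ)
        ≤ W (x - δ) * Real.exp (-(2 * δ)) * ∫ u in Icc (-δ) δ, k u :=
          mul_le_mul_of_nonneg_left hkδ (mul_nonneg (hW0 _) (Real.exp_pos _).le)
      _ = ∫ u in Icc (-δ) δ, W (x - δ) * Real.exp (-(2 * δ)) * k u := by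
          rw [integral_const_mul]
      _ ≤ ∫ u in Icc (-δ) δ, W (u + x) * k u := by
          refine setIntegral_mono_on (hki.const_mul _).integrableOn (hInteg x).integrableOn
            measurableSet_Icc ?_
          intro u hu
          exact mul_le_mul_of_nonneg_right (hcmp δ _ _ (by linarith [hu.1]) (by linarith [hu.2])) (hk0 u)
      _ ≤ ∫ y, W (y + x) * k y :=
          setIntegral_le_integral (hInteg x) (ae_of_all _ fun y => mul_nonneg (hW0 _) (hk0 _))
  have hA : 0 ≤ A := by
    obtain ⟨k, hk0, hki, hk1, hkδ, hInteg, hlim⟩ := H 1 one_pos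
    exact ge_of_tendsto' hlim fun x => integral_nonneg fun y => mul_nonneg (hW0 _) (hk0 _)
  -- step 2
  obtain ⟨B, hB⟩ : ∃ B, ∀ u, W u ≤ B := by
    obtain ⟨k, hk0, hki, hk1, hkδ, hInteg, hlim⟩ := H (1 / 2) (by norm_num)
    obtain ⟨X, hX⟩ := eventually_atTop.1 (hlim.eventually_le_const (show A < A + 1 by linarith))
    refine ⟨max (W (max X 0) * Real.exp (max X 0)) ((A + 1) * 2 * Real.exp 1), fun u => ?_⟩
    rcases le_total u (max X 0) with hu | hu
    · refine le_trans ?_ (le_max_left _ _)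
      refine le_trans ?_ (hWm _ _ hu)
      rcases le_total u 0 with h0 | h0
      · simp [hWz u h0]
      · exact le_mul_of_one_le_right (hW0 u) (Real.one_le_exp h0)
    · refine le_trans ?_ (le_max_right _ _)
      have h1 := hlow _ k hk0 hki hkδ hInteg (u + 1 / 2)
      have h2 := hX (u + 1 / 2) (by linarith [le_max_left X 0])
      have h3 : W u * Real.exp (-1) * (1 / 2) ≤ A + 1 := by
        refine le_trans (le_of_eq ?_) (h1.trans h2)
        norm_num
      rw [Real.exp_neg, ← div_eq_mul_inv, ← div_eq_mul_one_div, div_div,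
        div_le_iff₀ (by positivity)] at h3
      linarith
  have hB0 : 0 ≤ B := (hW0 0).trans (hB 0)
  -- step 3
  have hup : ∀ (δ : ℝ) (k : ℝ → ℝ), (∀ u, 0 ≤ k u) → Integrable k → ∫ u, k u = 1 →
      1 - δ ≤ ∫ u in Icc (-δ) δ, k u → (∀ x, Integrable (fun y => W (y + x) * k y)) →
      ∀ x, ∫ y, W (y + x) * k y ≤ W (x + δ) * Real.exp (2 * δ) + B * δ := by
    intro δ k hk0 hki hk1 hkδ hInteg x
    have hs : MeasurableSet (Icc (-δ) δ) := measurableSet_Icc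
    have h1 := integral_add_compl hs hki
    have h2 := hki.indicator hs.compl
    calc ∫ y, W (y + x) * k y
        ≤ ∫ y, (W (x + δ) * Real.exp (2 * δ) * k y + B * (Icc (-δ) δ)ᶜ.indicator k y) := by
          refine integral_mono (hInteg x) ((hki.const_mul _).add (h2.const_mul _)) ?_
          intro y
          have hnn : 0 ≤ W (x + δ) * Real.exp (2 * δ) := mul_nonneg (hW0 _) (Real.exp_pos _).le
          by_cases hy : y ∈ Icc (-δ) δ
          · have hy' : y ∉ (Icc (-δ) δ)ᶜ := fun h => h hy
            simp only [indicator_of_notMem hy', mul_zero, add_zero]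
            refine mul_le_mul_of_nonneg_right ?_ (hk0 y)
            have := hcmp δ (y + x) (x + δ) (by linarith [hy.2]) (by linarith [hy.1])
            rw [Real.exp_neg, ← div_eq_mul_inv, div_le_iff₀ (Real.exp_pos _)] at this
            exact this
          · have hy' : y ∈ (Icc (-δ) δ)ᶜ := hy
            simp only [indicator_of_mem hy']
            have a1 := mul_le_mul_of_nonneg_right (hB (y + x)) (hk0 y)
            have a2 := mul_nonneg hnn (hk0 y)
            linarith
      _ = W (x + δ) * Real.exp (2 * δ) + B * ∫ y in (Icc (-δ) δ)ᶜ, k y := by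
          rw [integral_add (hki.const_mul _) (h2.const_mul _), integral_const_mul,
            integral_const_mul, hk1, mul_one, integral_indicator hs.compl]
      _ ≤ _ := by
          have : ∫ y in (Icc (-δ) δ)ᶜ, k y ≤ δ := by linarith
          have := mul_le_mul_of_nonneg_left this hB0
          linarith
  rw [tendsto_order]
  constructor
  · intro a ha
    have hc : Tendsto (fun δ : ℝ => a * Real.exp (2 * δ) + B * δ) (nhdsWithin 0 (Ioi 0)) (nhds a) := by
      have : Continuous (fun δ : ℝ => a * Real.exp (2 * δ) + B * δ) := by fun_prop
      have h := this.tendsto 0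
      simp only [mul_zero, Real.exp_zero, mul_one, add_zero] at h
      exact h.mono_left nhdsWithin_le_nhds
    obtain ⟨δ, hδ, hδ0⟩ := ((hc.eventually_lt_const ha).and self_mem_nhdsWithin).exists
    obtain ⟨k, hk0, hki, hk1, hkδ, hInteg, hlim⟩ := H δ hδ0
    have h1 := hlim.eventually_const_lt hδ
    have h2 : Tendsto (fun u : ℝ => u - δ) atTop atTop := tendsto_atTop_add_const_right _ (-δ) tendsto_id
    filter_upwards [h2.eventually h1] with u hu
    have h3 := hup δ k hk0 hki hk1 hkδ hInteg (u - δ)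
    rw [sub_add_cancel] at h3
    have h4 : a * Real.exp (2 * δ) < W u * Real.exp (2 * δ) := by linarith
    exact lt_of_mul_lt_mul_right h4 (Real.exp_pos _).le
  · intro b hb
    have hc : Tendsto (fun δ : ℝ => b * Real.exp (-(2 * δ)) * (1 - δ)) (nhdsWithin 0 (Ioi 0)) (nhds b) := by
      have : Continuous (fun δ : ℝ => b * Real.exp (-(2 * δ)) * (1 - δ)) := by fun_prop
      have h := this.tendsto 0
      simp only [mul_zero, neg_zero, Real.exp_zero, mul_one, sub_zero] at h
      exact h.mono_left nhdsWithin_le_nhds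
    have hlt1 : ∀ᶠ δ : ℝ in nhdsWithin 0 (Ioi 0), δ < 1 :=
      nhdsWithin_le_nhds (eventually_lt_nhds one_pos)
    obtain ⟨δ, ⟨hδ, hδ1⟩, hδ0⟩ := (((hc.eventually_const_lt hb).and hlt1).and self_mem_nhdsWithin).exists
    obtain ⟨k, hk0, hki, hk1, hkδ, hInteg, hlim⟩ := H δ hδ0
    have h1 := hlim.eventually_lt_const hδ
    have h2 : Tendsto (fun u : ℝ => u + δ) atTop atTop := tendsto_atTop_add_const_right _ δ tendsto_id
    filter_upwards [h2.eventually h1] with u hu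
    have h3 := hlow δ k hk0 hki hkδ hInteg (u + δ)
    rw [add_sub_cancel_right] at h3
    have h4 := h3.trans_lt hu
    have h5 := lt_of_mul_lt_mul_right h4 (by linarith)
    exact lt_of_mul_lt_mul_right h5 (Real.exp_pos _).le

lemma wik_fubini (F φ : ℝ → ℂ) (hF : Integrable F) (hφ : Integrable φ) :
    ∫ t : ℝ, (∫ u : ℝ, F u * Complex.exp (-Complex.I * t * u)) * φ t =
      ∫ u : ℝ, F u * ∫ t : ℝ, φ t * Complex.exp (-Complex.I * u * t) := by
  simp_rw [← integral_mul_const, ← integral_const_mul]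
  rw [integral_integral_swap]
  · congr 1 with u
    congr 1 with t
    rw [mul_assoc, mul_comm (Complex.exp _), mul_right_comm (-Complex.I)]
  · have h : Integrable (fun p : ℝ × ℝ => φ p.1 * F p.2) (volume.prod volume) := hφ.mul_prod hF
    refine h.mono ?_ ?_
    · have h1 : (Function.uncurry fun (t u : ℝ) => F u * Complex.exp (-Complex.I * t * u) * φ t) =
          fun p : ℝ × ℝ => Complex.exp (-Complex.I * p.1 * p.2) * (φ p.1 * F p.2) := by
        ext p; simp only [Function.uncurry]; ring
      rw [h1]
      exact Continuous.aestronglyMeasurable (by fun_prop) |>.mul h.aestronglyMeasurable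
    · refine ae_of_all _ fun p => ?_
      have : ‖Complex.exp (-Complex.I * p.1 * p.2)‖ = 1 := by
        rw [Complex.norm_exp]; simp
      simp only [Function.uncurry, norm_mul, this, mul_one]
      rw [mul_comm]

lemma wik_limit (W q : ℝ → ℝ) (L : ℝ) (hW : ∀ u, 0 ≤ W u) (hW0 : ∀ u ≤ 0, W u = 0)
    (hq : ∀ u, 0 ≤ q u) (hWm : Measurable W) (hqm : Measurable q)
    (hInteg : ∀ ε : ℝ, 0 < ε → Integrable (fun u => W u * Real.exp (-ε * u) * q u))
    (hlim : Tendsto (fun ε : ℝ => ∫ u, W u * Real.exp (-ε * u) * q u) (nhdsWithin 0 (Ioi 0))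
      (nhds L)) :
    Integrable (fun u => W u * q u) ∧ ∫ u, W u * q u = L := by
  have hseq : Tendsto (fun n : ℕ => 1 / ((n : ℝ) + 1)) atTop (nhdsWithin 0 (Ioi 0)) :=
    tendsto_nhdsWithin_iff.2 ⟨tendsto_one_div_add_atTop_nhds_zero_nat,
      Eventually.of_forall fun n => by simp only [mem_Ioi]; positivity⟩
  have hpt : ∀ u, Tendsto (fun ε : ℝ => W u * Real.exp (-ε * u) * q u) (nhdsWithin 0 (Ioi 0))
      (nhds (W u * q u)) := by
    intro u
    have : Continuous (fun ε : ℝ => W u * Real.exp (-ε * u) * q u) := by fun_prop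
    have h := this.tendsto 0
    simp only [neg_zero, zero_mul, Real.exp_zero, mul_one] at h
    exact h.mono_left nhdsWithin_le_nhds
  have hnn : ∀ ε u : ℝ, 0 ≤ W u * Real.exp (-ε * u) * q u := fun ε u =>
    mul_nonneg (mul_nonneg (hW u) (Real.exp_pos _).le) (hq u)
  have hI : Integrable (fun u => W u * q u) := by
    refine integrable_of_tendsto (G := fun (n : ℕ) u => W u * Real.exp (-(1 / ((n : ℝ) + 1)) * u) * q u)
      (ae_of_all _ fun u => (hpt u).comp hseq)
      (fun n => (hInteg _ (by positivity)).aestronglyMeasurable) ?_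
    have h1 : Tendsto (fun n : ℕ => ∫⁻ u, ‖W u * Real.exp (-(1 / ((n : ℝ) + 1)) * u) * q u‖ₑ) atTop
        (nhds (ENNReal.ofReal L)) := by
      refine (ENNReal.tendsto_ofReal (hlim.comp hseq)).congr fun n => ?_
      simp only [Function.comp]
      rw [ofReal_integral_eq_lintegral_ofReal (hInteg _ (by positivity)) (ae_of_all _ fun u => hnn _ u)]
      congr 1 with u
      rw [Real.enorm_of_nonneg (hnn _ u)]
    rw [h1.liminf_eq]
    exact ENNReal.ofReal_ne_top
  refine ⟨hI, tendsto_nhds_unique ?_ hlim⟩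
  refine tendsto_integral_filter_of_dominated_convergence (fun u => W u * q u) ?_ ?_ hI
    (ae_of_all _ hpt)
  · exact Eventually.of_forall fun ε => Measurable.aestronglyMeasurable (by fun_prop)
  · filter_upwards [self_mem_nhdsWithin] with ε hε
    refine ae_of_all _ fun u => ?_
    rw [Real.norm_of_nonneg (hnn ε u)]
    refine mul_le_mul_of_nonneg_right ?_ (hq u)
    rcases le_total u 0 with h | h
    · simp [hW0 u h]
    · refine mul_le_of_le_one_right (hW u) (Real.exp_le_one_iff.2 ?_)
      have : 0 ≤ ε * u := mul_nonneg (le_of_lt hε) h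
      linarith

lemma wik_shift (v : ℝ → ℂ) (k : ℝ → ℝ) (C : ℝ) (l : ℂ) (hv : Measurable v)
    (hC : ∀ x, ‖v x‖ ≤ C) (hl : Tendsto v atTop (nhds l)) (hk : Integrable k) :
    Tendsto (fun x : ℝ => ∫ y : ℝ, v y * (k (y - x) : ℂ)) atTop (nhds (l * ((∫ y, k y : ℝ) : ℂ))) := by
  have e : ∀ x : ℝ, ∫ y : ℝ, v y * (k (y - x) : ℂ) = ∫ y : ℝ, v (y + x) * (k y : ℂ) := by
    intro x
    rw [← integral_add_right_eq_self _ x]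
    simp
  simp_rw [e]
  rw [← integral_complex_ofReal, ← integral_const_mul]
  refine tendsto_integral_filter_of_dominated_convergence (fun y => C * ‖k y‖) ?_ ?_
    (hk.norm.const_mul C) ?_
  · refine Eventually.of_forall fun x => ?_
    exact (hv.comp (measurable_add_const x)).aestronglyMeasurable.mul hk.ofReal.aestronglyMeasurable
  · refine Eventually.of_forall fun x => ae_of_all _ fun y => ?_
    rw [norm_mul, Complex.norm_real]
    exact mul_le_mul_of_nonneg_right (hC _) (norm_nonneg _)
  · refine ae_of_all _ fun y => ?_
    exact (hl.comp (tendsto_atTop_add_const_left _ y tendsto_id)).mul_const _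

/-- the representation of the boundary integrals -/
lemma wik_boundary (S : ℝ → ℝ) (A : ℝ)
    (hconv : ∀ s : ℂ, 1 < s.re →
      IntegrableOn (fun u : ℝ => (S u : ℂ) * Complex.exp (-s * u)) (Ioi 0))
    (g : ℂ → ℂ)
    (hg : ∀ s : ℂ, 1 < s.re →
      g s = (∫ u in Ioi (0 : ℝ), (S u : ℂ) * Complex.exp (-s * u)) - A / (s - 1))
    (φ : ℝ → ℂ) (hφ : Integrable φ) (ε : ℝ) (hε : 0 < ε) :
    Integrable ((Ioi (0 : ℝ)).indicator fun u : ℝ => (S u * Real.exp (-u) - A) * Real.exp (-ε * u)) ∧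
    ∫ t : ℝ, g (1 + ε + Complex.I * t) * φ t =
      ∫ u : ℝ, (((Ioi (0 : ℝ)).indicator
        (fun u : ℝ => (S u * Real.exp (-u) - A) * Real.exp (-ε * u)) u : ℝ) : ℂ) *
        ∫ t : ℝ, φ t * Complex.exp (-Complex.I * u * t) := by
  have e1 : ∀ t u : ℝ, (((S u * Real.exp (-u) - A) * Real.exp (-ε * u) : ℝ) : ℂ) *
      Complex.exp (-Complex.I * t * u) =
      (S u : ℂ) * Complex.exp (-(1 + ε + Complex.I * t) * u) -
        A * Complex.exp (-(ε + Complex.I * t) * u) := by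
    intro t u
    have a1 : Complex.exp (-(1 + ε + Complex.I * t) * u) =
      Complex.exp (-u) * Complex.exp (-ε * u) * Complex.exp (-Complex.I * t * u) := by
      rw [← Complex.exp_add, ← Complex.exp_add]; congr 1; ring
    have a2 : Complex.exp (-(ε + Complex.I * t) * u) =
      Complex.exp (-ε * u) * Complex.exp (-Complex.I * t * u) := by
      rw [← Complex.exp_add]; congr 1; ring
    rw [a1, a2]; push_cast; ring
  have hre : ∀ t : ℝ, (-(ε + Complex.I * t) : ℂ).re < 0 := fun t => by simpa using hε
  have hre1 : ∀ t : ℝ, 1 < (1 + ε + Complex.I * t : ℂ).re := fun t => by simpa using hε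
  have i1 : ∀ t : ℝ, IntegrableOn (fun u : ℝ => (A : ℂ) * Complex.exp (-(ε + Complex.I * t) * u)) (Ioi 0) :=
    fun t => (integrableOn_exp_mul_complex_Ioi (hre t) 0).const_mul _
  have hInteg : IntegrableOn (fun u : ℝ => (((S u * Real.exp (-u) - A) * Real.exp (-ε * u) : ℝ) : ℂ)) (Ioi 0) := by
    refine ((hconv _ (hre1 0)).sub (i1 0)).congr (ae_of_all _ fun u => ?_)
    have := e1 0 u
    simp only [Pi.sub_apply]
    rw [← this]
    simp
  have hintR : IntegrableOn (fun u : ℝ => (S u * Real.exp (-u) - A) * Real.exp (-ε * u)) (Ioi 0) := by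
    have := hInteg.re
    exact this
  have hI := (integrable_indicator_iff measurableSet_Ioi).2 hintR
  refine ⟨hI, ?_⟩
  rw [← wik_fubini (fun u => (((Ioi (0 : ℝ)).indicator
        (fun u : ℝ => (S u * Real.exp (-u) - A) * Real.exp (-ε * u)) u : ℝ) : ℂ)) φ hI.ofReal hφ]
  congr 1 with t
  congr 1
  rw [hg _ (hre1 t)]
  have e2 : ∀ u : ℝ, (((Ioi (0 : ℝ)).indicator
        (fun u : ℝ => (S u * Real.exp (-u) - A) * Real.exp (-ε * u)) u : ℝ) : ℂ) * Complex.exp (-Complex.I * t * u)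
      = (Ioi (0 : ℝ)).indicator (fun u : ℝ => (S u : ℂ) * Complex.exp (-(1 + ε + Complex.I * t) * u) -
        A * Complex.exp (-(ε + Complex.I * t) * u)) u := by
    intro u
    by_cases hu : u ∈ Ioi (0 : ℝ)
    · simp only [indicator_of_mem hu]
      exact e1 t u
    · simp only [indicator_of_notMem hu]; simp
  simp_rw [e2]
  rw [integral_indicator measurableSet_Ioi, integral_sub (hconv _ (hre1 t)) (i1 t),
    integral_const_mul, integral_exp_mul_complex_Ioi (hre t)]
  congr 1
  have : (ε + Complex.I * t : ℂ) ≠ 0 := fun h => by have := hre t; rw [h] at this; simp at this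
  have h2 : (1 + ε + Complex.I * t - 1 : ℂ) = ε + Complex.I * t := by ring
  rw [h2]
  simp only [Complex.ofReal_zero, mul_zero, Complex.exp_zero]
  rw [neg_div_neg_eq, mul_one_div]

/-- **Wiener–Ikehara–Korevaar theorem, main direction.**
Let `S : [0,∞) → ℝ` be non-decreasing with Laplace transform `𝓛S(s) = ∫₀^∞ S(u)e^{−su} du`
converging for `Re s > 1`, let `A ∈ ℝ` and `g(s) = 𝓛S(s) − A/(s−1)`.  If for every `R > 0`
there is a bounded measurable `v : ℝ → ℂ` vanishing at infinity such that for every smooth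
compactly supported `φ` with support in `[−R,R]`,
`lim_{ε→0⁺} ∫ g(1+ε+it) φ(t) dt = ∫ v(x) φ̂(x) dx` (with `φ̂(x) = ∫ φ(t) e^{−ixt} dt`),
then `S(u)/e^u → A` as `u → ∞`. -/
theorem wiener_ikehara_korevaar
    (S : ℝ → ℝ) (hmono : MonotoneOn S (Ici (0 : ℝ))) (A : ℝ)
    (hconv : ∀ s : ℂ, 1 < s.re →
      IntegrableOn (fun u : ℝ => (S u : ℂ) * Complex.exp (-s * u)) (Ioi 0))
    (g : ℂ → ℂ)
    (hg : ∀ s : ℂ, 1 < s.re →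
      g s = (∫ u in Ioi (0 : ℝ), (S u : ℂ) * Complex.exp (-s * u)) - A / (s - 1))
    (hpseudo : ∀ R : ℝ, 0 < R →
      ∃ v : ℝ → ℂ, Measurable v ∧ (∃ C : ℝ, ∀ x : ℝ, ‖v x‖ ≤ C) ∧
        Tendsto v (cocompact ℝ) (nhds 0) ∧
        ∀ φ : ℝ → ℂ, ContDiff ℝ (⊤ : ℕ∞) φ → HasCompactSupport φ →
          tsupport φ ⊆ Icc (-R) R →
          Tendsto (fun ε : ℝ => ∫ t : ℝ, g (1 + ε + Complex.I * t) * φ t)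
            (nhdsWithin 0 (Ioi 0))
            (nhds (∫ x : ℝ, v x * ∫ t : ℝ, φ t * Complex.exp (-Complex.I * x * t)))) :
    Tendsto (fun u : ℝ => S u / Real.exp u) atTop (nhds A) := by
  set W : ℝ → ℝ := (Ioi (0 : ℝ)).indicator (fun u => (S u - S 0) * Real.exp (-u)) with hWdef
  set P : ℝ → ℝ := (Ioi (0 : ℝ)).indicator (fun u => S 0 * Real.exp (-u) - A) with hPdef
  have hWpos : ∀ u, 0 < u → W u = (S u - S 0) * Real.exp (-u) := fun u hu =>
    indicator_of_mem (mem_Ioi.2 hu) _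
  have hWz : ∀ u ≤ 0, W u = 0 := fun u hu => indicator_of_notMem (by simpa using hu) _
  have hPpos : ∀ u, 0 < u → P u = S 0 * Real.exp (-u) - A := fun u hu =>
    indicator_of_mem (mem_Ioi.2 hu) _
  have hPz : ∀ u ≤ 0, P u = 0 := fun u hu => indicator_of_notMem (by simpa using hu) _
  have hS0 : ∀ u, 0 < u → 0 ≤ S u - S 0 := fun u hu =>
    sub_nonneg.2 (hmono (mem_Ici.2 le_rfl) (mem_Ici.2 hu.le) hu.le)
  have hW0 : ∀ u, 0 ≤ W u := by
    intro u
    rcases le_or_gt u 0 with h | h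
    · rw [hWz u h]
    · rw [hWpos u h]; exact mul_nonneg (hS0 u h) (Real.exp_pos _).le
  have hWexp : ∀ u, 0 < u → W u * Real.exp u = S u - S 0 := by
    intro u hu
    rw [hWpos u hu, mul_assoc, ← Real.exp_add]; simp
  have hWm : ∀ u v, u ≤ v → W u * Real.exp u ≤ W v * Real.exp v := by
    intro u v huv
    rcases le_or_gt u 0 with h | h
    · rw [hWz u h, zero_mul]; exact mul_nonneg (hW0 v) (Real.exp_pos _).le
    · rw [hWexp u h, hWexp v (h.trans_le huv)]
      have := hmono (mem_Ici.2 h.le) (mem_Ici.2 (h.le.trans huv)) huv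
      linarith
  have hWmeas : Measurable W := by
    have h1 : Measurable (fun u => W u * Real.exp u) := Monotone.measurable fun u v h => hWm u v h
    have h2 : W = fun u => (W u * Real.exp u) * Real.exp (-u) := by
      ext u; rw [mul_assoc, ← Real.exp_add]; simp
    rw [h2]
    exact h1.mul (by fun_prop)
  have hPmeas : Measurable P := Measurable.indicator (by fun_prop) measurableSet_Ioi
  have hPb : ∀ u ε : ℝ, 0 ≤ ε → |P u * Real.exp (-ε * u)| ≤ |S 0| + |A| := by
    intro u ε hε
    rcases le_or_gt u 0 with h | h
    · rw [hPz u h, zero_mul, abs_zero]; positivity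
    · rw [hPpos u h, abs_mul, abs_of_pos (Real.exp_pos _)]
      have h1 : Real.exp (-ε * u) ≤ 1 := Real.exp_le_one_iff.2 (by nlinarith)
      have h2 : Real.exp (-u) ≤ 1 := Real.exp_le_one_iff.2 (by linarith)
      have h3 : |S 0 * Real.exp (-u) - A| ≤ |S 0| + |A| := by
        refine (abs_sub _ _).trans ?_
        rw [abs_mul, abs_of_pos (Real.exp_pos _)]
        have := mul_le_of_le_one_right (abs_nonneg (S 0)) h2
        linarith
      exact (mul_le_of_le_one_right (abs_nonneg _) h1).trans h3
  have hPb0 : ∀ u, |P u| ≤ |S 0| + |A| := fun u => by simpa using hPb u 0 le_rfl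
  have hPlim : Tendsto P atTop (nhds (-A)) := by
    have h1 : Tendsto (fun u : ℝ => S 0 * Real.exp (-u) - A) atTop (nhds (S 0 * 0 - A)) :=
      (Real.tendsto_exp_neg_atTop_nhds_zero.const_mul _).sub_const _
    rw [mul_zero, zero_sub] at h1
    refine h1.congr' ?_
    filter_upwards [eventually_gt_atTop 0] with u hu
    rw [hPpos u hu]
  -- the Tauberian step
  have hWlim : Tendsto W atTop (nhds A) := by
    refine wik_tauber W A hW0 hWz hWm ?_
    intro δ hδ
    obtain ⟨φ, k, r, hr, hs, hc, hsup, hF, hk0, hkc, hki, hk1, hkδ⟩ := wik_scaled_kernel δ δ hδ hδ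
    obtain ⟨v, hvm, ⟨C, hC⟩, hv0, hlim⟩ := hpseudo r hr
    have hkb : ∀ u, |k u| ≤ ∫ t, ‖φ t‖ := by
      intro u
      have h1 : ‖(k u : ℂ)‖ ≤ ∫ t, ‖φ t‖ := by
        rw [← hF u]
        refine (norm_integral_le_integral_norm _).trans (le_of_eq ?_)
        congr 1 with t
        have : ‖Complex.exp (-Complex.I * u * t)‖ = 1 := by
          rw [Complex.norm_exp]; simp
        rw [norm_mul, this, mul_one]
      simpa using h1
    have key : ∀ x : ℝ, Integrable (fun u => W u * k (u - x)) ∧ ∫ u, W u * k (u - x) =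
        (∫ y : ℝ, v y * (k (y - x) : ℂ)).re - ∫ u, P u * k (u - x) := by
      intro x
      have hkxi : Integrable (fun u => k (u - x)) := hki.comp_sub_right x
      have hkxc : Continuous (fun u => k (u - x)) := by fun_prop
      have hPi : ∀ ε : ℝ, 0 ≤ ε → Integrable (fun u => P u * Real.exp (-ε * u) * k (u - x)) := by
        intro ε hε
        refine hkxi.bdd_mul (c := |S 0| + |A|) ?_ (ae_of_all _ fun u => ?_)
        · exact Measurable.aestronglyMeasurable (by fun_prop)
        · exact hPb u ε hε
      let ψ : ℝ → ℂ := fun t => φ t * Complex.exp (Complex.I * x * t)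
      have hψs : ContDiff ℝ (⊤ : ℕ∞) ψ := by
        refine hs.mul ?_
        exact (contDiff_const.mul Complex.ofRealCLM.contDiff).cexp
      have hψc : HasCompactSupport ψ := hc.mul_right
      have hψi : Integrable ψ := hψs.continuous.integrable_of_hasCompactSupport hψc
      have hψF : ∀ u : ℝ, ∫ t : ℝ, ψ t * Complex.exp (-Complex.I * u * t) = (k (u - x) : ℂ) := by
        intro u
        rw [← hF]
        congr 1 with t
        simp only [ψ]
        rw [mul_assoc, ← Complex.exp_add]
        congr 2
        push_cast
        ring
      have h1 := hlim ψ hψs hψc ((tsupport_mul_subset_left).trans hsup)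
      simp_rw [hψF] at h1
      have hsplit : ∀ ε u : ℝ, (Ioi (0 : ℝ)).indicator
          (fun u : ℝ => (S u * Real.exp (-u) - A) * Real.exp (-ε * u)) u =
          W u * Real.exp (-ε * u) + P u * Real.exp (-ε * u) := by
        intro ε u
        rcases le_or_gt u 0 with h | h
        · rw [hWz u h, hPz u h, indicator_of_notMem (by simpa using h)]; ring
        · rw [hWpos u h, hPpos u h, indicator_of_mem (mem_Ioi.2 h)]; ring
      have hWi : ∀ ε : ℝ, 0 < ε → Integrable (fun u => W u * Real.exp (-ε * u) * k (u - x)) := by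
        intro ε hε
        have h2 := (wik_boundary S A hconv g hg ψ hψi ε hε).1
        have h3 := h2.mul_bdd (g := fun u => k (u - x)) (c := ∫ t, ‖φ t‖)
          hkxc.aestronglyMeasurable (ae_of_all _ fun u => hkb _)
        refine (h3.sub (hPi ε hε.le)).congr (ae_of_all _ fun u => ?_)
        simp only [Pi.sub_apply]
        rw [hsplit]; ring
      have h4 : ∀ ε : ℝ, 0 < ε → (∫ t : ℝ, g (1 + ε + Complex.I * t) * ψ t).re
          - ∫ u, P u * Real.exp (-ε * u) * k (u - x) = ∫ u, W u * Real.exp (-ε * u) * k (u - x) := by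
        intro ε hε
        rw [(wik_boundary S A hconv g hg ψ hψi ε hε).2]
        have h5 : (∫ u : ℝ, (((Ioi (0 : ℝ)).indicator
            (fun u : ℝ => (S u * Real.exp (-u) - A) * Real.exp (-ε * u)) u : ℝ) : ℂ) *
            ∫ t : ℝ, ψ t * Complex.exp (-Complex.I * u * t)) =
            ((∫ u, (W u * Real.exp (-ε * u) * k (u - x) +
              P u * Real.exp (-ε * u) * k (u - x)) : ℝ) : ℂ) := by
          rw [← integral_complex_ofReal]
          congr 1 with u
          rw [hψF, hsplit]
          push_cast
          ring
        rw [h5, Complex.ofReal_re, integral_add (hWi ε hε) (hPi ε hε.le)]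
        ring
      have h6 : Tendsto (fun ε : ℝ => ∫ u, P u * Real.exp (-ε * u) * k (u - x))
          (nhdsWithin 0 (Ioi 0)) (nhds (∫ u, P u * k (u - x))) := by
        refine tendsto_integral_filter_of_dominated_convergence
          (fun u => (|S 0| + |A|) * ‖k (u - x)‖) ?_ ?_ (hkxi.norm.const_mul _) ?_
        · exact Eventually.of_forall fun ε => Measurable.aestronglyMeasurable (by fun_prop)
        · filter_upwards [self_mem_nhdsWithin] with ε hε
          refine ae_of_all _ fun u => ?_
          rw [norm_mul]
          exact mul_le_mul_of_nonneg_right (hPb u ε (le_of_lt hε)) (norm_nonneg _)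
        · refine ae_of_all _ fun u => ?_
          have : Continuous (fun ε : ℝ => P u * Real.exp (-ε * u) * k (u - x)) := by fun_prop
          have h := this.tendsto 0
          simp only [neg_zero, zero_mul, Real.exp_zero, mul_one] at h
          exact h.mono_left nhdsWithin_le_nhds
      refine wik_limit W (fun u => k (u - x)) _ hW0 hWz (fun u => hk0 _) hWmeas hkxc.measurable
        hWi ?_
      refine (((Complex.continuous_re.tendsto _).comp h1).sub h6).congr' ?_
      filter_upwards [self_mem_nhdsWithin] with ε hε
      exact h4 ε hε
    refine ⟨k, hk0, hki, hk1, hkδ, ?_, ?_⟩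
    · intro x
      have := (key x).1.comp_add_right x
      simpa using this
    · have e : ∀ x : ℝ, ∫ y, W (y + x) * k y = ∫ u, W u * k (u - x) := by
        intro x
        rw [← integral_add_right_eq_self (fun u => W u * k (u - x)) x]
        simp
      simp_rw [e, fun x => (key x).2]
      have l1 := wik_shift v k C 0 hvm hC
        (hv0.mono_left atTop_le_cocompact) hki
      have l2 := wik_shift (fun u => (P u : ℂ)) k (|S 0| + |A|) ((-A : ℝ) : ℂ)
        (Complex.measurable_ofReal.comp hPmeas)
        (fun u => by simpa using hPb0 u)
        ((Complex.continuous_ofReal.tendsto _).comp hPlim) hki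
      have l1' := (Complex.continuous_re.tendsto _).comp l1
      have l2' := (Complex.continuous_re.tendsto _).comp l2
      have l3 := l1'.sub l2'
      rw [hk1] at l3
      simp only [Complex.ofReal_one, mul_one, Complex.zero_re, Complex.ofReal_re, zero_sub,
        neg_neg] at l3
      refine l3.congr fun x => ?_
      simp only [Function.comp]
      congr 1
      rw [← Complex.ofReal_re (∫ u, P u * k (u - x)), ← integral_complex_ofReal]
      simp
  have h1 : Tendsto (fun u : ℝ => W u + S 0 * Real.exp (-u)) atTop (nhds (A + S 0 * 0)) :=
    hWlim.add (Real.tendsto_exp_neg_atTop_nhds_zero.const_mul _)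
  rw [mul_zero, add_zero] at h1
  refine h1.congr' ?_
  filter_upwards [eventually_gt_atTop 0] with u hu
  rw [hWpos u hu, Real.exp_neg]
  ring
end

section
/- (Main theorem, forward direction.) Let S : [0,∞) → ℝ be non-decreasing, suppose G(s) = ∫₀^∞ S(e^u) e^{−su} du converges for every s with Re s > 1, and suppose lim_{u→∞} S(e^u)/e^u = A for some A ∈ ℝ. Then for every L > 0, writing I = [−L/2, L/2], there exists a compact operator Ψ on L²(I) such that for all f, g ∈ L²(I), lim_{ε→0⁺} (1/π) ∫_I ∫_I f(τ) · Re G(1+ε+i(t−τ)) · conj(g(t)) dτ dt = A⟨f, g⟩ + ⟨Ψf, g⟩, where ⟨·,·⟩ is the inner product of L²(I). -/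
open MeasureTheory Set Filter

open scoped FourierTransform ContDiff SchwartzMap in
theorem fourier_toLp_ae {f : ℝ → ℂ} (hf1 : Integrable f) (hf2 : MemLp f 2) :
    ∀ᵐ x, (𝓕 (hf2.toLp f) : Lp ℂ 2 (volume : Measure ℝ)) x = 𝓕 f x := by
  have hcont : Continuous (𝓕 f) := by
    exact VectorFourier.fourierIntegral_continuous Real.continuous_fourierChar
      (by exact continuous_inner) hf1
  apply ae_eq_of_integral_contDiff_smul_eq
  · exact (Lp.memLp _).locallyIntegrable (by norm_num)
  · exact hcont.locallyIntegrable
  · intro φ hφ hs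
    have hφ' : ContDiff ℝ ∞ (fun x => (φ x : ℂ)) := Complex.ofRealCLM.contDiff.comp hφ
    have hs' : HasCompactSupport (fun x => (φ x : ℂ)) := hs.comp_left (g := fun x : ℝ => (x : ℂ)) (by simp)
    let ψ : 𝓢(ℝ, ℂ) := hs'.toSchwartzMap hφ'
    have hψ : ∀ x, ψ x = (φ x : ℂ) := fun x => by simp [ψ]
    have h1 := congrArg (fun T => T ψ) (Lp.fourier_toTemperedDistribution_eq (hf2.toLp f))
    simp only [TemperedDistribution.fourier_apply, Lp.toTemperedDistribution_apply] at h1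
    have h2 : ∫ x, 𝓕 (ψ : ℝ → ℂ) x • f x = ∫ x, ψ x • 𝓕 f x := by
      simpa using! (VectorFourier.integral_fourierIntegral_smul_eq_flip (L := innerₗ ℝ)
        Real.continuous_fourierChar continuous_inner ψ.integrable hf1)
    have h3 : ∫ x, (𝓕 ψ) x • (hf2.toLp f) x = ∫ x, 𝓕 (ψ : ℝ → ℂ) x • f x := by
      apply integral_congr_ae
      filter_upwards [hf2.coeFn_toLp] with x hx
      rw [hx, SchwartzMap.fourier_coe]
    rw [h3, h2] at h1
    simpa [hψ] using h1.symm

open scoped FourierTransform in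
theorem plancherel_L1L2 {f g : ℝ → ℂ} (hf1 : Integrable f) (hf2 : MemLp f 2)
    (hg1 : Integrable g) (hg2 : MemLp g 2) :
    Integrable (fun x => 𝓕 f x * (starRingEnd ℂ) (𝓕 g x)) ∧
    ∫ x, 𝓕 f x * (starRingEnd ℂ) (𝓕 g x) = ∫ x, f x * (starRingEnd ℂ) (g x) := by
  have h := Lp.inner_fourier_eq (hg2.toLp g) (hf2.toLp f)
  have hi := L2.integrable_inner (𝕜 := ℂ) (𝓕 (hg2.toLp g) : Lp ℂ 2 (volume : Measure ℝ)) (𝓕 (hf2.toLp f))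
  have e1 : (fun x => inner ℂ ((𝓕 (hg2.toLp g) : Lp ℂ 2 (volume : Measure ℝ)) x) ((𝓕 (hf2.toLp f): Lp ℂ 2 (volume : Measure ℝ)) x)) =ᵐ[volume] (fun x => 𝓕 f x * (starRingEnd ℂ) (𝓕 g x)) := by
    filter_upwards [fourier_toLp_ae hf1 hf2, fourier_toLp_ae hg1 hg2] with x h1 h2
    rw [h1, h2]; simp
  refine ⟨hi.congr e1, ?_⟩
  rw [L2.inner_def, L2.inner_def, integral_congr_ae e1] at h
  rw [h]
  apply integral_congr_ae
  filter_upwards [hf2.coeFn_toLp, hg2.coeFn_toLp] with x h1 h2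
  rw [h1, h2]; simp

theorem plancherel_Icc {a b : ℝ} {f g : ℝ → ℂ} (hf : MemLp f 2 (volume.restrict (Icc a b)))
    (hg : MemLp g 2 (volume.restrict (Icc a b))) :
    Integrable (fun u : ℝ => (∫ x in Icc a b, f x * Complex.exp (-(Complex.I * x * u))) *
      (starRingEnd ℂ) (∫ x in Icc a b, g x * Complex.exp (-(Complex.I * x * u)))) ∧
    ∫ u : ℝ, (∫ x in Icc a b, f x * Complex.exp (-(Complex.I * x * u))) *
      (starRingEnd ℂ) (∫ x in Icc a b, g x * Complex.exp (-(Complex.I * x * u)))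
      = 2 * Real.pi * ∫ x in Icc a b, f x * (starRingEnd ℂ) (g x) := by
  have key : ∀ {h : ℝ → ℂ}, ∀ u : ℝ, 
    (∫ x in Icc a b, h x * Complex.exp (-(Complex.I * x * u))) = 
      FourierTransform.fourier ((Icc a b).indicator h) (u / (2 * Real.pi)) := by
    intro h u
    rw [Real.fourier_eq', ← integral_indicator measurableSet_Icc]
    congr 1 with x
    by_cases hx : x ∈ Icc a b
    · simp only [hx, indicator_of_mem, smul_eq_mul]
      rw [mul_comm]; congr 2
      have : (Real.pi : ℂ) ≠ 0 := by exact_mod_cast Real.pi_ne_zero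
      simp
      field_simp
    · simp [hx]
  have m2 : ∀ {h : ℝ → ℂ}, MemLp h 2 (volume.restrict (Icc a b)) → MemLp ((Icc a b).indicator h) 2 :=
    fun hh => (memLp_indicator_iff_restrict measurableSet_Icc).2 hh
  have m1 : ∀ {h : ℝ → ℂ}, MemLp h 2 (volume.restrict (Icc a b)) → Integrable ((Icc a b).indicator h) :=
    fun hh => (integrable_indicator_iff measurableSet_Icc).2 (hh.integrable (by norm_num))
  obtain ⟨p1, p2⟩ := plancherel_L1L2 (m1 hf) (m2 hf) (m1 hg) (m2 hg)
  simp only [key]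
  constructor
  · exact p1.comp_div (by positivity)
  · rw [Measure.integral_comp_div (fun u => FourierTransform.fourier ((Icc a b).indicator f) u * (starRingEnd ℂ) (FourierTransform.fourier ((Icc a b).indicator g) u)), p2,
      ← integral_indicator measurableSet_Icc, abs_of_pos (by positivity)]
    simp only [Complex.real_smul]
    push_cast
    congr 2 with x
    by_cases hx : x ∈ Icc a b <;> simp [hx]



theorem isCompactOperator_integral {H : Type*} [NormedAddCommGroup H] [InnerProductSpace ℂ H]
    [CompleteSpace H] {μ : Measure ℝ} [IsFiniteMeasure μ] (T : ℝ → H →L[ℂ] H)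
    (hT : Integrable T μ) (hc : ∀ u, IsCompactOperator (T u)) :
    IsCompactOperator (∫ u, T u ∂μ : H →L[ℂ] H) := by
  rcases eq_or_ne μ 0 with h | h
  · subst h
    simpa using! (isCompactOperator_zero : IsCompactOperator (0 : H → H))
  · have : NeZero μ := ⟨h⟩
    rw [← measure_smul_average]
    have hconv : Convex ℝ {A : H →L[ℂ] H | IsCompactOperator A} := by
      intro A hA B hB a b _ _ _
      exact (IsCompactOperator.smul hA a).add (IsCompactOperator.smul hB b)
    have hcl : IsClosed {A : H →L[ℂ] H | IsCompactOperator A} := 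
      isClosed_setOfPred_isCompactOperator
    have := hconv.average_mem hcl (μ := μ) (f := T) (Eventually.of_forall hc) hT
    exact IsCompactOperator.smul this _

theorem isCompactOperator_rankOne {H : Type*} [NormedAddCommGroup H] [InnerProductSpace ℂ H]
    (x y : H) : IsCompactOperator (InnerProductSpace.rankOne ℂ x y) := by
  rw [InnerProductSpace.rankOne_def']
  exact (isCompactOperator_of_locallyCompactSpace_dom (innerSL ℂ y)).clm_comp
    (ContinuousLinearMap.toSpanSingleton ℂ x)

theorem frame_bound {H : Type*} [NormedAddCommGroup H] [InnerProductSpace ℂ H]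
    (e : ℝ → H) (he : Continuous e) (c : ℝ)
    (hfr : ∀ f : H, Integrable (fun u => ‖inner ℂ (e u) f‖ ^ 2) ∧
      ∫ u, ‖inner ℂ (e u) f‖ ^ 2 = c * ‖f‖ ^ 2) (f g : H) :
    Integrable (fun u => ‖inner ℂ (e u) f * inner ℂ g (e u)‖) ∧
    ∫ u, ‖inner ℂ (e u) f * inner ℂ g (e u)‖ ≤ c * ‖f‖ * ‖g‖ := by
  have hm : ∀ f : H, MemLp (fun u => inner ℂ (e u) f) 2 := fun f => by
    refine (memLp_two_iff_integrable_sq_norm ?_).2 (hfr f).1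
    exact (he.inner continuous_const).aestronglyMeasurable
  have hs : ∀ u, ‖inner ℂ g (e u)‖ = ‖inner ℂ (e u) g‖ := fun u => norm_inner_symm _ _
  simp only [norm_mul, hs]
  constructor
  · exact (hm f).norm.integrable_mul (hm g).norm
  · have h1 := integral_mul_norm_le_Lp_mul_Lq (μ := volume) (p := 2) (q := 2) Real.HolderConjugate.two_two
      (f := fun u => inner ℂ (e u) f) (g := fun u => inner ℂ (e u) g) (by simpa using hm f) (by simpa using hm g)
    refine h1.trans ?_
    simp only [Real.rpow_two, (hfr _).2]
    rw [← Real.sqrt_eq_rpow, ← Real.sqrt_eq_rpow]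
    have hc : 0 ≤ c * ‖f‖^2 := (hfr f).2 ▸ integral_nonneg (fun _ => by positivity)
    rw [← Real.sqrt_mul hc]
    rcases eq_or_ne f 0 with h | h
    · simp [h]
    have hc' : 0 ≤ c := by
      by_contra! hn
      have : 0 < ‖f‖^2 := by positivity
      nlinarith
    rw [show c * ‖f‖ ^ 2 * (c * ‖g‖ ^ 2) = (c * ‖f‖ * ‖g‖)^2 by ring, Real.sqrt_sq (by positivity)]

theorem exists_compact_multiplier {H : Type*} [NormedAddCommGroup H] [InnerProductSpace ℂ H]
    [CompleteSpace H] (e : ℝ → H) (he : Continuous e) (c : ℝ)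
    (hfr : ∀ f : H, Integrable (fun u => ‖inner ℂ (e u) f‖ ^ 2) ∧
      ∫ u, ‖inner ℂ (e u) f‖ ^ 2 = c * ‖f‖ ^ 2)
    (r : ℝ → ℂ) (hr : AEStronglyMeasurable r) (B : ℝ) (hB : ∀ u, ‖r u‖ ≤ B)
    (hr0 : ∀ δ > 0, ∃ N : ℕ, ∀ u : ℝ, (N : ℝ) ≤ |u| → ‖r u‖ ≤ δ) :
    ∃ Ψ : H →L[ℂ] H, IsCompactOperator Ψ ∧
      ∀ f g, inner ℂ g (Ψ f) = ∫ u, r u * (inner ℂ (e u) f * inner ℂ g (e u)) := by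
  classical
  set P : H → H → ℝ → ℂ := fun f g u => inner ℂ (e u) f * inner ℂ g (e u) with hP
  have hPi : ∀ f g, Integrable (P f g) := fun f g => by
    refine (integrable_norm_iff ?_).1 (frame_bound e he c hfr f g).1
    exact ((he.inner continuous_const).mul (continuous_const.inner he)).aestronglyMeasurable
  let J : ℕ → Set ℝ := fun n => Icc (-(n:ℝ)) n
  let R : ℝ → H →L[ℂ] H := fun u => r u • InnerProductSpace.rankOne ℂ (e u) (e u)
  have hRi : ∀ n, IntegrableOn R (J n) := by
    intro n
    have hcont : Continuous (fun u => InnerProductSpace.rankOne ℂ (e u) (e u)) := by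
      exact ((InnerProductSpace.rankOne ℂ (E := H) (F := H)).flip.cont.comp he).clm_apply he
    have hK : IntegrableOn (fun u => InnerProductSpace.rankOne ℂ (e u) (e u)) (J n) :=
      hcont.continuousOn.integrableOn_compact isCompact_Icc
    exact hK.bdd_smul B hr.restrict (Eventually.of_forall hB)
  let T : ℕ → H →L[ℂ] H := fun n => ∫ u in J n, R u
  have hTc : ∀ n, IsCompactOperator (T n) := fun n => by
    refine isCompactOperator_integral R (hRi n) (fun u => ?_)
    exact (isCompactOperator_rankOne (e u) (e u)).smul (r u)
  have hTin : ∀ n f g, inner ℂ g (T n f) = ∫ u, (J n).indicator r u * P f g u := by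
    intro n f g
    have h1 : T n f = ∫ u in J n, R u f := 
      ContinuousLinearMap.integral_apply (hRi n) f
    have h2 : inner ℂ g (∫ u in J n, R u f) = ∫ u in J n, inner ℂ g (R u f) :=
      (integral_inner ((ContinuousLinearMap.apply ℂ H f).integrable_comp (hRi n)) g).symm
    rw [h1, h2, ← integral_indicator measurableSet_Icc]
    congr 1 with u
    by_cases hu : u ∈ J n
    · rw [indicator_of_mem hu, indicator_of_mem hu]
      simp [R, hP]
    · rw [indicator_of_notMem hu, indicator_of_notMem hu]; simp
  have hai : ∀ n f g, Integrable (fun u => (J n).indicator r u * P f g u) := fun n f g => by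
    refine (hPi f g).bdd_mul (c := B) (hr.indicator measurableSet_Icc) (Eventually.of_forall fun u => ?_)
    exact (norm_indicator_le_norm_self r u).trans (hB u)
  have hri : ∀ f g, Integrable (fun u => r u * P f g u) := fun f g => 
    (hPi f g).bdd_mul hr (Eventually.of_forall hB)
  have hbd : ∀ (a : ℝ → ℂ) (δ : ℝ), 0 ≤ δ → (∀ u, ‖a u‖ ≤ δ) → ∀ f g, 
      ‖∫ u, a u * P f g u‖ ≤ δ * (c * ‖f‖ * ‖g‖) := by
    intro a δ hδ ha f g
    obtain ⟨h1, h2⟩ := frame_bound e he c hfr f g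
    calc _ ≤ ∫ u, δ * ‖P f g u‖ := by
          refine norm_integral_le_of_norm_le (h1.const_mul δ) (Eventually.of_forall fun u => ?_)
          rw [norm_mul]
          exact mul_le_mul_of_nonneg_right (ha u) (norm_nonneg _)
      _ = δ * ∫ u, ‖P f g u‖ := integral_const_mul _ _
      _ ≤ _ := by gcongr
  have hsmall : ∀ δ > 0, ∃ N : ℕ, ∀ n ≥ N, ∀ u, ‖r u - (J n).indicator r u‖ ≤ δ := by
    intro δ hδ
    obtain ⟨N, hN⟩ := hr0 δ hδ
    refine ⟨N, fun n hn u => ?_⟩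
    by_cases hu : u ∈ J n
    · rw [indicator_of_mem hu]; simpa using hδ.le
    · rw [indicator_of_notMem hu, sub_zero]
      apply hN
      by_contra! h
      apply hu
      have : (N:ℝ) ≤ n := by exact_mod_cast hn
      exact ⟨by linarith [neg_abs_le u], by linarith [le_abs_self u]⟩
  have hc0 : ∀ f : H, 0 ≤ c * ‖f‖ := fun f => by
    have h0 := (frame_bound e he c hfr f f).2
    have h1 : 0 ≤ c * ‖f‖ * ‖f‖ := le_trans (integral_nonneg fun _ => norm_nonneg _) h0
    rcases eq_or_ne f 0 with h | h
    · simp [h]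
    · exact nonneg_of_mul_nonneg_left h1 (norm_pos_iff.2 h)
  have hcau : CauchySeq T := by
    rw [Metric.cauchySeq_iff']
    intro ε hε
    set δ := ε / (4 * (|c| + 1)) with hδ
    have hδ0 : 0 < δ := by positivity
    obtain ⟨N, hN⟩ := hsmall δ hδ0
    refine ⟨N, fun n hn => ?_⟩
    rw [dist_eq_norm]
    have : ‖T n - T N‖ ≤ 2 * δ * |c| := by
      refine ContinuousLinearMap.opNorm_le_bound _ (by positivity) fun f => ?_
      set g := (T n - T N) f with hg
      have h1 : inner ℂ g g = ∫ u, ((J n).indicator r u - (J N).indicator r u) * P f g u := by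
        conv_lhs => rw [hg, ← hg]
        nth_rewrite 2 [hg]
        rw [sub_apply, inner_sub_right, hTin, hTin, ← integral_sub (hai _ _ _) (hai _ _ _)]
        simp only [sub_mul]
      have h2 := hbd (fun u => (J n).indicator r u - (J N).indicator r u) (2 * δ) (by positivity)
        (fun u => by
          have e1 := hN n hn u
          have e2 := hN N le_rfl u
          calc _ = ‖(r u - (J N).indicator r u) - (r u - (J n).indicator r u)‖ := by congr 1; ring
            _ ≤ _ := norm_sub_le _ _
            _ ≤ _ := by linarith) f g
      rw [← h1, inner_self_eq_norm_sq_to_K] at h2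
      have h3 : ‖g‖ * ‖g‖ ≤ (2 * δ * |c| * ‖f‖) * ‖g‖ := by
        calc ‖g‖ * ‖g‖ ≤ 2 * δ * (c * ‖f‖ * ‖g‖) := by simpa [sq] using h2
          _ ≤ 2 * δ * (|c| * ‖f‖ * ‖g‖) := by gcongr; exact le_abs_self c
          _ = _ := by ring
      rcases eq_or_ne g 0 with h | h
      · rw [h, norm_zero]; positivity
      · exact le_of_mul_le_mul_right h3 (norm_pos_iff.2 h)
    calc _ ≤ 2 * δ * |c| := this
      _ ≤ 2 * δ * (|c| + 1) := by gcongr; linarith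
      _ = ε / 2 := by rw [hδ]; field_simp; norm_num
      _ < ε := by linarith
  obtain ⟨Ψ, hΨ⟩ := cauchySeq_tendsto_of_complete hcau
  refine ⟨Ψ, isCompactOperator_of_tendsto hΨ (Eventually.of_forall hTc), fun f g => ?_⟩
  have l1 : Tendsto (fun n => inner ℂ g (T n f)) atTop (nhds (inner ℂ g (Ψ f))) := by
    have h2 : Tendsto (fun n => T n f) atTop (nhds (Ψ f)) :=
      ((ContinuousLinearMap.apply ℂ H f).continuous.tendsto Ψ).comp hΨ
    exact tendsto_const_nhds.inner h2
  have l2 : Tendsto (fun n => inner ℂ g (T n f)) atTop (nhds (∫ u, r u * P f g u)) := by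
    simp only [hTin]
    refine tendsto_integral_of_dominated_convergence (fun u => B * ‖P f g u‖) 
      (fun n => (hai n f g).1) ((hPi f g).norm.const_mul B) ?_ ?_
    · intro n
      refine Eventually.of_forall fun u => ?_
      rw [norm_mul]
      exact mul_le_mul_of_nonneg_right ((norm_indicator_le_norm_self r u).trans (hB u)) (norm_nonneg _)
    · refine Eventually.of_forall fun u => ?_
      refine Tendsto.congr' ?_ tendsto_const_nhds
      obtain ⟨N, hN⟩ := exists_nat_ge |u|
      filter_upwards [eventually_ge_atTop N] with n hn
      have : (N:ℝ) ≤ n := by exact_mod_cast hn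
      rw [indicator_of_mem]
      exact ⟨by linarith [neg_abs_le u], by linarith [le_abs_self u]⟩
  exact tendsto_nhds_unique l1 l2

theorem memLp_expI (a b u : ℝ) : MemLp (fun t : ℝ => Complex.exp (Complex.I * t * u)) 2
    (volume.restrict (Icc a b)) := by
  refine MemLp.of_bound (Continuous.aestronglyMeasurable (by fun_prop)) 1 (Eventually.of_forall fun t => ?_)
  rw [show Complex.I * t * u = ((t * u : ℝ) : ℂ) * Complex.I by push_cast; ring,
    Complex.norm_exp_ofReal_mul_I]

/-- The exponential `t ↦ exp (i t u)` as an element of `L²([a, b])`. -/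
noncomputable def expLp (a b u : ℝ) : Lp ℂ 2 (volume.restrict (Icc a b)) :=
  (memLp_expI a b u).toLp _

theorem inner_expLp (a b u : ℝ) (f : Lp ℂ 2 (volume.restrict (Icc a b))) :
    inner ℂ (expLp a b u) f = ∫ x in Icc a b, f x * Complex.exp (-(Complex.I * x * u)) := by
  rw [L2.inner_def]
  apply integral_congr_ae
  filter_upwards [(memLp_expI a b u).coeFn_toLp] with x hx
  rw [expLp, hx]
  simp [← Complex.exp_conj]

theorem inner_expLp' (a b u : ℝ) (f : Lp ℂ 2 (volume.restrict (Icc a b))) :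
    inner ℂ f (expLp a b u)
      = (starRingEnd ℂ) (∫ x in Icc a b, f x * Complex.exp (-(Complex.I * x * u))) := by
  rw [← inner_expLp, inner_conj_symm]

theorem inner_eq_integral (a b : ℝ) (f g : Lp ℂ 2 (volume.restrict (Icc a b))) :
    ∫ x in Icc a b, f x * (starRingEnd ℂ) (g x) = inner ℂ g f := by
  rw [L2.inner_def]
  simp

theorem continuous_expLp (a b : ℝ) : Continuous (expLp a b) := by
  set C : ℝ := (measureUnivNNReal (volume.restrict (Icc a b)) : ℝ) ^ ((2 : ENNReal).toReal⁻¹) with hC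
  have hC0 : 0 ≤ C := by positivity
  have : LipschitzWith (Real.toNNReal (C * (|a| + |b|))) (expLp a b) := by
    refine LipschitzWith.of_dist_le_mul fun u v => ?_
    rw [dist_eq_norm, Real.coe_toNNReal _ (by positivity), mul_assoc]
    refine Lp.norm_le_of_ae_bound (by positivity) ?_
    filter_upwards [Lp.coeFn_sub (expLp a b u) (expLp a b v), (memLp_expI a b u).coeFn_toLp, 
      (memLp_expI a b v).coeFn_toLp, ae_restrict_mem measurableSet_Icc] with x h1 h2 h3 hx
    rw [h1, Pi.sub_apply]
    change ‖((memLp_expI a b u).toLp _) x - ((memLp_expI a b v).toLp _) x‖ ≤ _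
    rw [h2, h3]
    have e1 : Complex.exp (Complex.I * x * u) - Complex.exp (Complex.I * x * v)
      = Complex.exp (((x * v : ℝ) : ℂ) * Complex.I) * (Complex.exp (Complex.I * ((x * (u - v) : ℝ) : ℂ)) - 1) := by
      rw [mul_sub, ← Complex.exp_add, mul_one]
      congr 2 <;> push_cast <;> ring
    rw [e1, norm_mul, Complex.norm_exp_ofReal_mul_I, one_mul]
    refine Real.norm_exp_I_mul_ofReal_sub_one_le.trans ?_
    rw [Real.norm_eq_abs, abs_mul, Real.dist_eq]
    gcongr
    rw [abs_le]
    exact ⟨by linarith [hx.1, neg_abs_le a, abs_nonneg b], by linarith [hx.2, le_abs_self b, abs_nonneg a]⟩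
  exact this.continuous

theorem frame_expLp (a b : ℝ) (f g : Lp ℂ 2 (volume.restrict (Icc a b))) :
    Integrable (fun u => inner ℂ (expLp a b u) f * inner ℂ g (expLp a b u)) ∧
    ∫ u, inner ℂ (expLp a b u) f * inner ℂ g (expLp a b u) = 2 * Real.pi * inner ℂ g f := by
  simp only [inner_expLp, inner_expLp']
  rw [← inner_eq_integral]
  exact plancherel_Icc (Lp.memLp f) (Lp.memLp g)

theorem frame_expLp_sq (a b : ℝ) (f : Lp ℂ 2 (volume.restrict (Icc a b))) :
    Integrable (fun u => ‖inner ℂ (expLp a b u) f‖ ^ 2) ∧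
    ∫ u, ‖inner ℂ (expLp a b u) f‖ ^ 2 = 2 * Real.pi * ‖f‖ ^ 2 := by
  obtain ⟨h1, h2⟩ := frame_expLp a b f f
  have e : ∀ u, inner ℂ (expLp a b u) f * inner ℂ f (expLp a b u) 
      = ((‖inner ℂ (expLp a b u) f‖ ^ 2 : ℝ) : ℂ) := fun u => by
    rw [← inner_conj_symm f, Complex.mul_conj, Complex.normSq_eq_norm_sq]
  simp only [e] at h1 h2
  refine ⟨by simpa [← Complex.ofReal_pow] using h1.re, ?_⟩
  rw [integral_complex_ofReal, inner_self_eq_norm_sq_to_K] at h2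
  apply Complex.ofReal_injective
  rw [h2]
  simp

theorem integral_cos_kernel (a b u : ℝ) (f g : Lp ℂ 2 (volume.restrict (Icc a b))) :
    ∫ p : ℝ × ℝ, (f p.2 * (starRingEnd ℂ) (g p.1)) * ((Real.cos ((p.1 - p.2) * u) : ℝ) : ℂ) 
      ∂((volume.restrict (Icc a b)).prod (volume.restrict (Icc a b)))
    = (inner ℂ (expLp a b u) f * inner ℂ g (expLp a b u)
      + inner ℂ (expLp a b (-u)) f * inner ℂ g (expLp a b (-u))) / 2 := by
  have hfi : Integrable (fun x => f x) (volume.restrict (Icc a b)) := (Lp.memLp f).integrable (by norm_num)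
  have hgi : Integrable (fun x => g x) (volume.restrict (Icc a b)) := (Lp.memLp g).integrable (by norm_num)
  have hb : ∀ {h : ℝ → ℂ}, Integrable h (volume.restrict (Icc a b)) → ∀ v : ℝ,
      Integrable (fun x : ℝ => h x * Complex.exp (-(Complex.I * x * v))) (volume.restrict (Icc a b)) := by
    intro h hh v
    refine hh.mul_bdd (c := 1) (Continuous.aestronglyMeasurable (by fun_prop)) (Eventually.of_forall fun t => ?_)
    rw [show -(Complex.I * t * v) = ((-(t * v) : ℝ) : ℂ) * Complex.I by push_cast; ring,
      Complex.norm_exp_ofReal_mul_I]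
  have hb' : ∀ v : ℝ, Integrable (fun x : ℝ => (starRingEnd ℂ) (g x * Complex.exp (-(Complex.I * x * v)))) (volume.restrict (Icc a b)) :=
    fun v => (Complex.conjCLE.toContinuousLinearMap.integrable_comp (hb hgi v))
  have hpt : ∀ p : ℝ × ℝ, (f p.2 * (starRingEnd ℂ) (g p.1)) * ((Real.cos ((p.1 - p.2) * u) : ℝ) : ℂ)
     = ((starRingEnd ℂ) (g p.1 * Complex.exp (-(Complex.I * p.1 * u))) * (f p.2 * Complex.exp (-(Complex.I * p.2 * u)))
       + (starRingEnd ℂ) (g p.1 * Complex.exp (-(Complex.I * p.1 * (-u : ℝ)))) * (f p.2 * Complex.exp (-(Complex.I * p.2 * (-u : ℝ))))) / 2 := by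
    intro p
    simp only [map_mul, ← Complex.exp_conj, map_neg, Complex.conj_I, Complex.conj_ofReal]
    have e1 : ((Real.cos ((p.1 - p.2) * u) : ℝ) : ℂ) = (Complex.exp (-(-Complex.I * p.1 * u)) * Complex.exp (-(Complex.I * p.2 * u)) + Complex.exp (-(-Complex.I * p.1 * (-u : ℝ))) * Complex.exp (-(Complex.I * p.2 * (-u : ℝ)))) / 2 := by
      rw [Complex.ofReal_cos, Complex.cos, ← Complex.exp_add, ← Complex.exp_add]
      congr 3 <;> push_cast <;> ring
    rw [e1]; ring
  simp only [hpt]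
  have hpm : ∀ v : ℝ, ∫ p : ℝ × ℝ, (starRingEnd ℂ) (g p.1 * Complex.exp (-(Complex.I * p.1 * v))) *
      (f p.2 * Complex.exp (-(Complex.I * p.2 * v)))
      ∂((volume.restrict (Icc a b)).prod (volume.restrict (Icc a b))) = 
      (starRingEnd ℂ) (∫ x in Icc a b, g x * Complex.exp (-(Complex.I * x * v))) *
      ∫ x in Icc a b, f x * Complex.exp (-(Complex.I * x * v)) := fun v => by
    rw [← integral_conj]
    exact integral_prod_mul (fun x : ℝ => (starRingEnd ℂ) (g x * Complex.exp (-(Complex.I * x * v))))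
      (fun x : ℝ => f x * Complex.exp (-(Complex.I * x * v)))
  rw [integral_div, integral_add, hpm, hpm]
  · simp only [inner_expLp, inner_expLp']
    ring
  · exact (hb' u).mul_prod (hb hfi u)
  · exact (hb' (-u)).mul_prod (hb hfi (-u))

theorem prelimit_eq (a b : ℝ) (f g : Lp ℂ 2 (volume.restrict (Icc a b))) (K : ℝ → ℝ)
    (hK : IntegrableOn K (Ioi 0)) (hKP : Integrable (fun u : ℝ => (K |u| : ℂ) *
      (inner ℂ (expLp a b u) f * inner ℂ g (expLp a b u)))) :
    ∫ t in Icc a b, (∫ τ in Icc a b, f τ * ((∫ u in Ioi (0:ℝ), K u * Real.cos ((t - τ) * u) : ℝ) : ℂ))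
      * (starRingEnd ℂ) (g t)
    = (∫ u, (K |u| : ℂ) * (inner ℂ (expLp a b u) f * inner ℂ g (expLp a b u))) / 2 := by
  set ν := volume.restrict (Ioi (0:ℝ))
  have hfi : Integrable (fun x => f x) (volume.restrict (Icc a b)) := (Lp.memLp f).integrable (by norm_num)
  have hgi : Integrable (fun x => g x) (volume.restrict (Icc a b)) := (Lp.memLp g).integrable (by norm_num)
  have hgi' : Integrable (fun x => (starRingEnd ℂ) (g x)) (volume.restrict (Icc a b)) := 
    (Complex.conjCLE.toContinuousLinearMap.integrable_comp hgi)
  let D : ℝ × ℝ → ℝ → ℂ := fun p u => 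
    (f p.2 * (starRingEnd ℂ) (g p.1)) * ((K u : ℂ) * ((Real.cos ((p.1 - p.2) * u) : ℝ) : ℂ))
  have hD : Integrable (Function.uncurry D) (((volume.restrict (Icc a b)).prod (volume.restrict (Icc a b))).prod ν) := by
    have h1 := (hgi'.mul_prod hfi).mul_prod (hK.ofReal (𝕜 := ℂ))
    have h2 := h1.mul_bdd (c := 1) (g := fun z : (ℝ × ℝ) × ℝ => ((Real.cos ((z.1.1 - z.1.2) * z.2) : ℝ) : ℂ))
      (Continuous.aestronglyMeasurable (by fun_prop)) (Eventually.of_forall fun t => by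
        rw [Complex.norm_real]; exact Real.abs_cos_le_one _)
    refine h2.congr (Eventually.of_forall fun z => ?_)
    simp only [D, Function.uncurry]
    simp
    ring
  have s1 : ∀ t τ : ℝ, ∫ u, D (t, τ) u ∂ν = 
      (f τ * ((∫ u, K u * Real.cos ((t - τ) * u) ∂ν : ℝ) : ℂ)) * (starRingEnd ℂ) (g t) := by
    intro t τ
    simp only [D]
    rw [integral_const_mul, ← integral_complex_ofReal]
    push_cast
    ring
  have s2 : ∫ t, (∫ τ, f τ * ((∫ u, K u * Real.cos ((t - τ) * u) ∂ν : ℝ) : ℂ) ∂(volume.restrict (Icc a b)))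
      * (starRingEnd ℂ) (g t) ∂(volume.restrict (Icc a b)) = ∫ p, ∫ u, D p u ∂ν ∂((volume.restrict (Icc a b)).prod (volume.restrict (Icc a b))) := by
    have hI : Integrable (fun p => ∫ u, D p u ∂ν) ((volume.restrict (Icc a b)).prod (volume.restrict (Icc a b))) := hD.integral_prod_left
    rw [integral_prod _ hI]
    congr 1 with t
    rw [← integral_mul_const]
    congr 1 with τ
    rw [s1]
  rw [s2, integral_integral_swap hD]
  set P : ℝ → ℂ := fun u => inner ℂ (expLp a b u) f * inner ℂ g (expLp a b u) with hP
  have s3 : ∀ u, ∫ p, D p u ∂((volume.restrict (Icc a b)).prod (volume.restrict (Icc a b))) = (K u : ℂ) * ((P u + P (-u)) / 2) := by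
    intro u
    rw [hP, ← integral_cos_kernel, ← integral_const_mul]
    congr 1 with p
    simp only [D]; ring
  simp only [s3]
  have s4 : ∫ u, (K u : ℂ) * ((P u + P (-u)) / 2) ∂ν = 
      ∫ u, ((K |u| : ℂ) * P u + (K |(-u)| : ℂ) * P (-u)) / 2 ∂ν := by
    refine setIntegral_congr_fun measurableSet_Ioi fun u hu => ?_
    simp only [abs_neg, abs_of_pos (show (0:ℝ) < u from hu)]
    ring
  rw [s4, integral_div, integral_add hKP.integrableOn hKP.comp_neg.integrableOn,
    integral_comp_neg_Ioi 0 (fun u => (K |u| : ℂ) * P u), neg_zero, add_comm, 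
    intervalIntegral.integral_Iic_add_Ioi hKP.integrableOn hKP.integrableOn]


/-- **Main theorem, forward direction.**  Let `S : [0,∞) → ℝ` be non-decreasing, with
`G(s) = ∫₀^∞ S(e^u) e^{−su} du` converging for `Re s > 1`, and suppose
`S(e^u)/e^u → A`.  Then for every symmetric interval `I = [−L/2, L/2]` there is a compact
operator `Ψ` on `L²(I)` such that the operators `W_{S,I,ε}` with kernel
`(1/π)·Re G(1+ε+i(t−τ))` converge, in the weak operator topology as `ε → 0⁺`, to
`A·Id + Ψ`:  for all `f, g ∈ L²(I)`,
`lim_{ε→0⁺} (1/π) ∫_I ∫_I f(τ)·Re G(1+ε+i(t−τ))·conj(g(t)) dτ dt = A⟨f,g⟩ + ⟨Ψf,g⟩`. -/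
theorem weak_limit_identity_add_compact_of_tendsto
    (S : ℝ → ℝ) (hmono : MonotoneOn S (Ici (0 : ℝ)))
    (hconv : ∀ s : ℂ, 1 < s.re →
      IntegrableOn (fun u : ℝ => (S (Real.exp u) : ℂ) * Complex.exp (-s * u)) (Ioi 0))
    (G : ℂ → ℂ)
    (hG : ∀ s : ℂ, 1 < s.re →
      G s = ∫ u in Ioi (0 : ℝ), (S (Real.exp u) : ℂ) * Complex.exp (-s * u))
    (A : ℝ)
    (hlim : Tendsto (fun u : ℝ => S (Real.exp u) / Real.exp u) atTop (nhds A))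
    (L : ℝ) (hL : 0 < L) :
    ∃ Ψ : Lp ℂ 2 (volume.restrict (Icc (-(L / 2)) (L / 2)))
        →L[ℂ] Lp ℂ 2 (volume.restrict (Icc (-(L / 2)) (L / 2))),
      IsCompactOperator Ψ ∧
      ∀ f g : Lp ℂ 2 (volume.restrict (Icc (-(L / 2)) (L / 2))),
        Tendsto
          (fun ε : ℝ => (1 / (Real.pi : ℂ)) *
            ∫ t in Icc (-(L / 2)) (L / 2),
              (∫ τ in Icc (-(L / 2)) (L / 2),
                f τ * ((G (1 + ε + Complex.I * (t - τ))).re : ℂ))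
              * (starRingEnd ℂ) (g t))
          (nhdsWithin 0 (Ioi 0))
          (nhds ((A : ℂ) * (∫ t in Icc (-(L / 2)) (L / 2), f t * (starRingEnd ℂ) (g t))
            + ∫ t in Icc (-(L / 2)) (L / 2), (Ψ f) t * (starRingEnd ℂ) (g t))) := by
  have hpi : (Real.pi : ℂ) ≠ 0 := by exact_mod_cast Real.pi_ne_zero
  set a := -(L / 2)
  set b := L / 2
  have hSm : Monotone (fun u : ℝ => S (Real.exp u)) := fun x y hxy =>
    hmono (Real.exp_pos x).le (Real.exp_pos y).le (Real.exp_le_exp.2 hxy)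
  let h : ℝ → ℝ := fun u => S (Real.exp |u|) * Real.exp (-|u|)
  have hhm : Measurable h :=
    (hSm.measurable.comp (continuous_abs.measurable)).mul (by fun_prop)
  have hsmall : ∀ δ > 0, ∃ N : ℕ, ∀ u : ℝ, (N : ℝ) ≤ |u| → |h u - A| ≤ δ := by
    intro δ hδ
    obtain ⟨M, hM⟩ := (Metric.tendsto_atTop.1 hlim) δ hδ
    obtain ⟨N, hN⟩ := exists_nat_ge M
    refine ⟨N, fun u hu => ?_⟩
    have := hM |u| (hN.trans hu)
    rw [Real.dist_eq, div_eq_mul_inv, ← Real.exp_neg] at this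
    exact this.le
  obtain ⟨B, hB⟩ : ∃ B : ℝ, ∀ u, |h u| ≤ B := by
    obtain ⟨N, hN⟩ := hsmall 1 one_pos
    refine ⟨max (|A| + 1) (|S (Real.exp 0)| + |S (Real.exp N)|), fun u => ?_⟩
    rcases le_total (N : ℝ) |u| with hu | hu
    · refine le_trans ?_ (le_max_left _ _)
      have h1 := hN u hu
      have h2 : |h u| ≤ |h u - A| + |A| := by
        simpa using abs_add_le (h u - A) A
      linarith
    · refine le_trans ?_ (le_max_right _ _)
      have h1 : S (Real.exp 0) ≤ S (Real.exp |u|) := hSm (abs_nonneg u)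
      have h2 : S (Real.exp |u|) ≤ S (Real.exp N) := hSm hu
      have h3 : |S (Real.exp |u|)| ≤ |S (Real.exp 0)| + |S (Real.exp N)| := by
        rw [abs_le]
        constructor
        · linarith [neg_abs_le (S (Real.exp 0)), abs_nonneg (S (Real.exp N))]
        · linarith [le_abs_self (S (Real.exp N)), abs_nonneg (S (Real.exp 0))]
      have h4 : Real.exp (-|u|) ≤ 1 := Real.exp_le_one_iff.2 (by simp)
      calc |h u| = |S (Real.exp |u|)| * Real.exp (-|u|) := by
            simp only [h]; rw [abs_mul, abs_of_pos (Real.exp_pos _)]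
        _ ≤ |S (Real.exp |u|)| * 1 := by gcongr
        _ ≤ _ := by linarith
  obtain ⟨Ψ, hΨc, hΨ⟩ := exists_compact_multiplier (expLp a b) (continuous_expLp a b) (2 * Real.pi)
    (frame_expLp_sq a b) (fun u => (((h u - A) / (2 * Real.pi) : ℝ) : ℂ))
    (Complex.measurable_ofReal.comp ((hhm.sub_const A).div_const _)).aestronglyMeasurable
    ((B + |A|) / (2 * Real.pi)) (fun u => by
      rw [Complex.norm_real, Real.norm_eq_abs, abs_div, abs_of_pos (by positivity : 0 < 2 * Real.pi)]
      gcongr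
      exact (abs_sub _ _).trans (by linarith [hB u]))
    (fun δ hδ => by
      obtain ⟨N, hN⟩ := hsmall (δ * (2 * Real.pi)) (by positivity)
      refine ⟨N, fun u hu => ?_⟩
      rw [Complex.norm_real, Real.norm_eq_abs, abs_div, abs_of_pos (by positivity : 0 < 2 * Real.pi),
        div_le_iff₀ (by positivity)]
      exact hN u hu)
  refine ⟨Ψ, hΨc, fun f g => ?_⟩
  rw [inner_eq_integral, inner_eq_integral, hΨ]
  set P : ℝ → ℂ := fun u => inner ℂ (expLp a b u) f * inner ℂ g (expLp a b u) with hP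
  obtain ⟨hPi, hPint⟩ := frame_expLp a b f g
  have hhP : Integrable (fun u => (h u : ℂ) * P u) :=
    hPi.bdd_mul (c := B) (Complex.measurable_ofReal.comp hhm).aestronglyMeasurable
      (Eventually.of_forall fun u => by rw [Complex.norm_real]; exact hB u)
  have hlimval : (A : ℂ) * inner ℂ g f + ∫ u, (((h u - A) / (2 * Real.pi) : ℝ) : ℂ) * P u
      = (1 / (Real.pi : ℂ)) * ((∫ u, (h u : ℂ) * P u) / 2) := by
    have e1 : ∀ u, (((h u - A) / (2 * Real.pi) : ℝ) : ℂ) * P u = 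
      ((h u : ℂ) * P u - A * P u) / (2 * Real.pi) := fun u => by push_cast; ring
    simp only [e1]
    rw [integral_div, integral_sub hhP (hPi.const_mul _), integral_const_mul, hPint]
    field_simp
    ring
  rw [hlimval]
  have hpre : ∀ ε : ℝ, 0 < ε → (∫ t in Icc a b,
              (∫ τ in Icc a b,
                f τ * ((G (1 + ε + Complex.I * (t - τ))).re : ℂ))
              * (starRingEnd ℂ) (g t))
      = (∫ u, ((h u * Real.exp (-ε * |u|) : ℝ) : ℂ) * P u) / 2 := by
    intro ε hε
    let K : ℝ → ℝ := fun u => S (Real.exp u) * Real.exp (-(1 + ε) * u)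
    have hKabs : ∀ u, K |u| = h u * Real.exp (-ε * |u|) := fun u => by
      simp only [K, h]
      rw [mul_assoc, ← Real.exp_add]
      congr 2; ring
    have hre : ∀ x u : ℝ, ((S (Real.exp u) : ℂ) * Complex.exp (-(1 + ε + Complex.I * x) * u)).re
        = K u * Real.cos (x * u) := by
      intro x u
      rw [Complex.re_ofReal_mul, Complex.exp_re]
      simp [K, mul_assoc]
    have hs : ∀ x : ℝ, 1 < (1 + ε + Complex.I * x : ℂ).re := fun x => by simpa using hε
    have hK : IntegrableOn K (Ioi 0) := by
      have h1 := (hconv _ (hs 0)).re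
      refine h1.congr (Eventually.of_forall fun u => ?_)
      have := hre 0 u
      simpa using this
    have hGre : ∀ x : ℝ, (G (1 + ε + Complex.I * x)).re = ∫ u in Ioi (0:ℝ), K u * Real.cos (x * u) := by
      intro x
      rw [hG _ (hs x)]
      have h1 := integral_re (hconv _ (hs x))
      simp only [RCLike.re_eq_complex_re] at h1
      rw [← h1]
      simp only [hre]
    have hGre' : ∀ t τ : ℝ, (G (1 + ε + Complex.I * (t - τ))).re
        = ∫ u in Ioi (0:ℝ), K u * Real.cos ((t - τ) * u) := fun t τ => by
      rw [← hGre]; push_cast; rfl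
    simp only [hGre']
    rw [prelimit_eq a b f g K hK]
    · simp only [hKabs, hP]
    · simp only [hKabs]
      refine hPi.bdd_mul (c := B) (Complex.measurable_ofReal.comp (hhm.mul (by fun_prop))).aestronglyMeasurable
        (Eventually.of_forall fun u => ?_)
      rw [Complex.norm_real, norm_mul, Real.norm_eq_abs, Real.norm_eq_abs, abs_of_pos (Real.exp_pos _)]
      refine le_trans ?_ (hB u)
      refine mul_le_of_le_one_right (abs_nonneg _) (Real.exp_le_one_iff.2 ?_)
      have : 0 ≤ ε * |u| := by positivity
      linarith
  have hmain : Tendsto (fun ε : ℝ => ∫ u, ((h u * Real.exp (-ε * |u|) : ℝ) : ℂ) * P u)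
      (nhdsWithin 0 (Ioi 0)) (nhds (∫ u, (h u : ℂ) * P u)) := by
    refine tendsto_integral_filter_of_dominated_convergence (fun u => B * ‖P u‖) ?_ ?_
      (hPi.norm.const_mul B) ?_
    · refine Eventually.of_forall fun ε => ?_
      exact (Complex.measurable_ofReal.comp (hhm.mul (by fun_prop))).aestronglyMeasurable.mul hPi.1
    · filter_upwards [self_mem_nhdsWithin] with ε hε
      refine Eventually.of_forall fun u => ?_
      rw [norm_mul, Complex.norm_real, norm_mul, Real.norm_eq_abs, Real.norm_eq_abs, abs_of_pos (Real.exp_pos _)]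
      refine mul_le_mul_of_nonneg_right (le_trans ?_ (hB u)) (norm_nonneg _)
      refine mul_le_of_le_one_right (abs_nonneg _) (Real.exp_le_one_iff.2 ?_)
      have : 0 ≤ ε * |u| := mul_nonneg (le_of_lt hε) (abs_nonneg _)
      linarith
    · refine Eventually.of_forall fun u => ?_
      have hc : Continuous (fun ε : ℝ => ((h u * Real.exp (-ε * |u|) : ℝ) : ℂ) * P u) := by fun_prop
      have := (hc.tendsto 0).mono_left (nhdsWithin_le_nhds (s := Ioi 0))
      simpa using this
  refine Tendsto.congr' ?_ ((hmain.div_const 2).const_mul (1 / (Real.pi : ℂ)))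
  filter_upwards [self_mem_nhdsWithin] with ε hε
  rw [hpre ε hε]
end

section
/- (Main theorem, converse direction.) Let S : [0,∞) → ℝ be non-decreasing and suppose G(s) = ∫₀^∞ S(e^u) e^{−su} du converges for every s with Re s > 1. Let A ∈ ℝ and suppose there exists L₀ > 0 such that for every L ≥ L₀, writing I = [−L/2, L/2], there exists a compact operator Ψ_L on L²(I) such that for all f, g ∈ L²(I), lim_{ε→0⁺} (1/π) ∫_I ∫_I f(τ) · Re G(1+ε+i(t−τ)) · conj(g(t)) dτ dt = A⟨f, g⟩ + ⟨Ψ_L f, g⟩. Then lim_{u→∞} S(e^u)/e^u = A. -/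
open MeasureTheory Set Filter


/-- weakly null bounded family and a compact operator -/
lemma aux_compact {E : Type*} [NormedAddCommGroup E] [InnerProductSpace ℂ E] [CompleteSpace E]
    (Ψ : E →L[ℂ] E) (hΨ : IsCompactOperator Ψ) (f : ℝ → E) (R : ℝ) (hR : ∀ x, ‖f x‖ ≤ R)
    (hw : ∀ g : E, Tendsto (fun x => inner ℂ g (f x)) atTop (nhds 0)) :
    Tendsto (fun x => inner ℂ (f x) (Ψ (f x))) atTop (nhds 0) := by
  have h1 : Tendsto (fun x => Ψ (f x)) atTop (nhds 0) := by
    refine IsCompact.tendsto_nhds_of_unique_mapClusterPt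
      (IsCompactOperator.isCompact_closure_image_closedBall (f := (Ψ : E →ₗ[ℂ] E)) hΨ R) ?_ ?_
    · refine Eventually.of_forall fun x => subset_closure ⟨f x, by simpa using hR x, rfl⟩
    · intro y _ hy
      have h2 : ∀ g : E, inner ℂ g y = 0 := by
        intro g
        have h3 : Tendsto (fun x => inner ℂ g (Ψ (f x))) atTop (nhds 0) := by
          have := hw (ContinuousLinearMap.adjoint Ψ g)
          simpa [ContinuousLinearMap.adjoint_inner_left] using this
        have h4 : MapClusterPt (inner ℂ g y) atTop (fun x => inner ℂ g (Ψ (f x))) := by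
          have hc : ContinuousAt (fun z : E => (inner ℂ g z : ℂ)) y := by fun_prop
          exact hy.continuousAt_comp hc
        have h5 : ClusterPt (inner ℂ g y) (nhds (0:ℂ)) := ClusterPt.mono h4 h3
        by_contra hne
        exact hne (eq_of_nhds_neBot h5)
      exact inner_self_eq_zero.1 (h2 y)
  have h2 : Tendsto (fun x => R * ‖Ψ (f x)‖) atTop (nhds 0) := by
    simpa using (h1.norm.const_mul R)
  refine squeeze_zero_norm (fun x => ?_) h2
  exact (norm_inner_le_norm _ _).trans (by gcongr; exact hR x)

lemma aux_mono (B : ℝ → ℝ) (hB : ∀ u, 0 ≤ B u)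
    (hi : ∀ ε : ℝ, 0 < ε → Integrable (fun u => Real.exp (-ε * |u|) * B u))
    (l : ℝ) (hl : Tendsto (fun ε : ℝ => ∫ u, Real.exp (-ε * |u|) * B u)
      (nhdsWithin 0 (Ioi 0)) (nhds l)) :
    Integrable B ∧ ∫ u, B u = l := by
  have he : Tendsto (fun n : ℕ => 1 / ((n : ℝ) + 1)) atTop (nhdsWithin 0 (Ioi 0)) := by
    refine tendsto_nhdsWithin_iff.2 ⟨tendsto_one_div_add_atTop_nhds_zero_nat, ?_⟩
    exact Eventually.of_forall fun n => by simp only [mem_Ioi]; positivity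
  have hp : ∀ u, Tendsto (fun ε : ℝ => Real.exp (-ε * |u|) * B u) (nhdsWithin 0 (Ioi 0))
      (nhds (B u)) := by
    intro u
    have : Continuous (fun ε : ℝ => Real.exp (-ε * |u|) * B u) := by fun_prop
    have h := (this.tendsto 0).mono_left (nhdsWithin_le_nhds (s := Ioi 0))
    simpa using h
  have hI : Integrable B := by
    refine integrable_of_tendsto (G := fun n u => Real.exp (-(1 / ((n : ℝ) + 1)) * |u|) * B u)
      (Eventually.of_forall fun u => (hp u).comp he) (fun n => (hi _ (by positivity)).1) ?_
    have : Tendsto (fun n : ℕ => ∫⁻ u, ‖Real.exp (-(1 / ((n : ℝ) + 1)) * |u|) * B u‖ₑ) atTop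
        (nhds (ENNReal.ofReal l)) := by
      have h := (ENNReal.continuous_ofReal.tendsto l).comp (hl.comp he)
      refine h.congr fun n => ?_
      simp only [Function.comp]
      rw [ofReal_integral_eq_lintegral_ofReal (hi _ (by positivity))
        (Eventually.of_forall fun u => mul_nonneg (Real.exp_pos _).le (hB u))]
      refine lintegral_congr fun u => ?_
      rw [Real.enorm_eq_ofReal (mul_nonneg (Real.exp_pos _).le (hB u))]
    rw [this.liminf_eq]
    exact ENNReal.ofReal_ne_top
  refine ⟨hI, ?_⟩
  have h := tendsto_integral_filter_of_dominated_convergence (l := nhdsWithin (0:ℝ) (Ioi 0))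
    (F := fun (ε : ℝ) u => Real.exp (-ε * |u|) * B u) (f := B) (μ := volume) B
    (by filter_upwards [self_mem_nhdsWithin] with ε hε using (hi ε hε).1)
    (by
      filter_upwards [self_mem_nhdsWithin] with ε hε
      refine Eventually.of_forall fun u => ?_
      rw [Real.norm_of_nonneg (mul_nonneg (Real.exp_pos _).le (hB u))]
      refine mul_le_of_le_one_left (hB u) (Real.exp_le_one_iff.2 ?_)
      have : 0 < ε := hε
      have := mul_nonneg this.le (abs_nonneg u)
      linarith) hI (Eventually.of_forall hp)
  exact tendsto_nhds_unique h hl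

lemma aux_swap (p q : ℝ → ℂ) (hp : Integrable p) (hq : Integrable q) (c : ℝ) :
    ∫ t, p t * ∫ u, q u * Complex.exp (Complex.I * u * (c * t)) =
      ∫ u, q u * ∫ t, p t * Complex.exp (Complex.I * u * (c * t)) := by
  simp_rw [← integral_const_mul]
  rw [integral_integral_swap]
  · refine integral_congr_ae (Eventually.of_forall fun u => ?_)
    refine integral_congr_ae (Eventually.of_forall fun t => ?_)
    simp only; ring
  · have h := hp.mul_prod hq
    have hc : Continuous (fun z : ℝ × ℝ => Complex.exp (Complex.I * z.2 * (c * z.1))) := by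
      fun_prop
    have := h.mul_bdd (c := 1) hc.aestronglyMeasurable (Eventually.of_forall fun z => by
        rw [show Complex.I * z.2 * (c * z.1) = ((z.2 * (c * z.1) : ℝ) : ℂ) * Complex.I by
          push_cast; ring, Complex.norm_exp_ofReal_mul_I])
    refine this.congr (Eventually.of_forall fun z => ?_)
    simp only [Function.uncurry]; ring

lemma aux_form (f : ℝ → ℂ) (hf : Integrable f) (H : ℝ → ℝ) (hH : Integrable H) :
    ∫ t : ℝ, (∫ τ : ℝ, f τ * ∫ u : ℝ, (H u : ℂ) * Complex.exp (Complex.I * u * (t - τ)))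
        * (starRingEnd ℂ) (f t)
      = ((∫ u, H u * ‖∫ t, f t * Complex.exp (-(Complex.I * u * t))‖ ^ 2 : ℝ) : ℂ) := by
  set F : ℝ → ℂ := fun u => ∫ t, f t * Complex.exp (-(Complex.I * u * t)) with hF
  have hexp : ∀ u t : ℝ, ‖Complex.exp (-(Complex.I * u * t))‖ = 1 := fun u t => by
    rw [show -(Complex.I * u * t) = ((-(u * t) : ℝ) : ℂ) * Complex.I by
          push_cast; ring, Complex.norm_exp_ofReal_mul_I]
  have hexp' : ∀ u t : ℝ, ‖Complex.exp ((Complex.I * u * t))‖ = 1 := fun u t => by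
    rw [show (Complex.I * u * t) = (((u * t) : ℝ) : ℂ) * Complex.I by
          push_cast; ring, Complex.norm_exp_ofReal_mul_I]
  have hFc : Continuous F := by
    refine continuous_of_dominated (bound := fun t => ‖f t‖) (fun u => ?_) (fun u => ?_) hf.norm ?_
    · exact hf.1.mul (Continuous.aestronglyMeasurable (by fun_prop))
    · exact Eventually.of_forall fun t => by rw [norm_mul, hexp, mul_one]
    · exact Eventually.of_forall fun t => by fun_prop
  have hFb : ∀ u, ‖F u‖ ≤ ∫ t, ‖f t‖ := fun u => by
    refine (norm_integral_le_integral_norm _).trans (le_of_eq ?_)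
    refine integral_congr_ae (Eventually.of_forall fun t => ?_)
    simp only; rw [norm_mul, hexp, mul_one]
  have hHF : Integrable (fun u => (H u : ℂ) * F u) :=
    hH.ofReal.mul_bdd hFc.aestronglyMeasurable (Eventually.of_forall hFb)
  have h1 : ∀ t : ℝ, (∫ τ : ℝ, f τ * ∫ u : ℝ, (H u : ℂ) * Complex.exp (Complex.I * u * (t - τ)))
      = ∫ u, ((H u : ℂ) * F u) * Complex.exp (Complex.I * u * (((1:ℝ):ℂ) * t)) := by
    intro t
    have hq : Integrable (fun u : ℝ => (H u : ℂ) * Complex.exp (Complex.I * u * t)) :=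
      hH.ofReal.mul_bdd (c := 1) (Continuous.aestronglyMeasurable (by fun_prop))
        (Eventually.of_forall fun u => (hexp' u t).le)
    have := aux_swap f _ hf hq (-1)
    calc _ = _ := ?_
      _ = _ := this
      _ = _ := ?_
    · refine integral_congr_ae (Eventually.of_forall fun τ => ?_)
      simp only
      congr 1
      refine integral_congr_ae (Eventually.of_forall fun u => ?_)
      simp only
      rw [mul_assoc (H u : ℂ), ← Complex.exp_add]
      congr 2; push_cast; ring
    · refine integral_congr_ae (Eventually.of_forall fun u => ?_)
      simp only [hF]
      have : ∀ τ : ℝ, Complex.I * u * (((-1 : ℝ) : ℂ) * τ) = -(Complex.I * u * τ) := by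
        intro τ; push_cast; ring
      simp only [this]
      rw [Complex.ofReal_one, one_mul]
      ring
  have h1' : ∀ t : ℝ, (∫ τ : ℝ, f τ * ∫ u : ℝ, (H u : ℂ) * Complex.exp (Complex.I * u * (t - τ)))
        * (starRingEnd ℂ) (f t) = (starRingEnd ℂ) (f t) *
        ∫ u, ((H u : ℂ) * F u) * Complex.exp (Complex.I * u * (((1:ℝ):ℂ) * t)) := by
    intro t; rw [h1 t, mul_comm]
  rw [integral_congr_ae (Eventually.of_forall h1')]
  have hfc : Integrable (fun t => (starRingEnd ℂ) (f t)) := by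
    exact (Complex.conjCLE.toContinuousLinearMap.integrable_comp hf)
  have := aux_swap _ _ hfc hHF 1
  refine this.trans ?_
  · rw [← integral_complex_ofReal]
    refine integral_congr_ae (Eventually.of_forall fun u => ?_)
    simp only
    have h3 : ∫ t, (starRingEnd ℂ) (f t) * Complex.exp (Complex.I * u * (((1:ℝ):ℂ) * t))
        = (starRingEnd ℂ) (F u) := by
      rw [hF, ← integral_conj]
      refine integral_congr_ae (Eventually.of_forall fun t => ?_)
      simp [← Complex.exp_conj]
    rw [h3, mul_assoc, Complex.mul_conj, Complex.normSq_eq_norm_sq]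
    push_cast; rfl


lemma aux_tauber (T b k : ℝ → ℝ) (hT0 : ∀ u, 0 ≤ u → 0 ≤ T u) (hTm : MonotoneOn T (Ici 0))
    (hb : ∀ u, b u = Real.exp (-|u|) * T |u|)
    (hk : Integrable k) (hk0 : ∀ v, 0 ≤ k v) (κ : ℝ) (hκ : 0 < κ) (hkκ : ∫ v, k v = κ)
    (A L₀ : ℝ) (hL₀ : 0 < L₀)
    (hint : ∀ L, L₀ ≤ L → ∀ x, Integrable (fun u => b u * (L * k (L * u - L * x))))
    (hlim : ∀ L, L₀ ≤ L → Tendsto (fun x => ∫ u, b u * (L * k (L * u - L * x))) atTop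
      (nhds (A * κ))) :
    Tendsto b atTop (nhds A) := by
  have hb0 : ∀ u, 0 ≤ b u := fun u => by
    rw [hb]; exact mul_nonneg (Real.exp_pos _).le (hT0 _ (abs_nonneg u))
  have hA : 0 ≤ A := by
    have : 0 ≤ A * κ := ge_of_tendsto' (hlim L₀ le_rfl) fun x =>
      integral_nonneg fun u => mul_nonneg (hb0 u) (mul_nonneg hL₀.le (hk0 _))
    exact nonneg_of_mul_nonneg_left this hκ
  -- comparison of values of b
  have hcmp : ∀ u v d, 0 ≤ u → u ≤ v → v ≤ u + d → b u ≤ Real.exp d * b v := by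
    intro u v d hu huv hvd
    rw [hb, hb, abs_of_nonneg hu, abs_of_nonneg (hu.trans huv), ← mul_assoc, ← Real.exp_add]
    have h1 : T u ≤ T v := hTm hu (hu.trans huv) huv
    have h2 : Real.exp (-u) ≤ Real.exp (d + -v) := Real.exp_le_exp.2 (by linarith)
    exact mul_le_mul h2 h1 (hT0 u hu) (Real.exp_pos _).le
  have hQ : ∀ h : ℝ, 0 < h → Tendsto (fun L : ℝ => ∫ v in (-(L * h))..(L * h), k v) atTop
      (nhds κ) := by
    intro h hh
    rw [← hkκ]
    have h1 : Tendsto (fun L : ℝ => L * h) atTop atTop := tendsto_id.atTop_mul_const hh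
    exact intervalIntegral_tendsto_integral hk (tendsto_neg_atTop_atBot.comp h1) h1
  have hKint : ∀ L, L₀ ≤ L → ∀ y, Integrable (fun u => L * k (L * u - L * y)) := by
    intro L hL y
    have hL' : L ≠ 0 := (hL₀.trans_le hL).ne'
    exact ((hk.comp_sub_right (L * y)).comp_mul_left' hL').const_mul L
  have hKtot : ∀ L, L₀ ≤ L → ∀ y, ∫ u, L * k (L * u - L * y) = κ := by
    intro L hL y
    have hL' : 0 < L := (hL₀.trans_le hL)
    rw [integral_const_mul, Measure.integral_comp_mul_left (fun v => k (v - L * y)) L,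
      integral_sub_right_eq_self, hkκ, abs_of_pos (inv_pos.2 hL'), smul_eq_mul,
      mul_inv_cancel_left₀ hL'.ne']
  have hKQ : ∀ L, L₀ ≤ L → ∀ y h, 0 < h → ∫ u in Ioc (y - h) (y + h), L * k (L * u - L * y)
      = ∫ v in (-(L * h))..(L * h), k v := by
    intro L hL y h hh
    rw [← intervalIntegral.integral_of_le (by linarith), intervalIntegral.integral_const_mul,
      intervalIntegral.mul_integral_comp_mul_sub]
    congr 1 <;> ring
  have hexp : Tendsto (fun h : ℝ => Real.exp (2 * h)) (nhdsWithin 0 (Ioi 0)) (nhds 1) := by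
    have : Continuous (fun h : ℝ => Real.exp (2 * h)) := by fun_prop
    simpa using (this.tendsto 0).mono_left (nhdsWithin_le_nhds (s := Ioi 0))
  have hup : ∀ A' > A, ∀ᶠ x in atTop, b x < A' := by
    intro A' hA'
    obtain ⟨h, h1, hh⟩ := (((hexp.mul_const A).eventually (gt_mem_nhds (by simpa using hA'))).and
      self_mem_nhdsWithin).exists
    replace hh : 0 < h := hh
    obtain ⟨L, ⟨h2, h3⟩, hL⟩ := ((((hQ h hh).const_mul A').eventually
      (lt_mem_nhds (mul_lt_mul_of_pos_right h1 hκ))).and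
      ((hQ h hh).eventually (lt_mem_nhds hκ))|>.and (eventually_ge_atTop L₀)).exists
    set Q := ∫ v in (-(L * h))..(L * h), k v with hQd
    have h4 : Tendsto (fun x : ℝ => x + h) atTop atTop := tendsto_atTop_add_const_right _ _ tendsto_id
    have h5 := ((hlim L hL).comp h4).const_mul (Real.exp (2 * h))
    filter_upwards [h5.eventually (gt_mem_nhds (show Real.exp (2 * h) * (A * κ) < A' * Q by linarith)),
      eventually_ge_atTop 0] with x hx hx0
    simp only [Function.comp] at hx
    have h6 : b x * Q ≤ Real.exp (2 * h) * ∫ u, b u * (L * k (L * u - L * (x + h))) := by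
      rw [hQd, ← hKQ L hL (x + h) h hh, ← integral_const_mul, ← integral_const_mul]
      have hLp : 0 < L := hL₀.trans_le hL
      calc ∫ u in Ioc (x + h - h) (x + h + h), b x * (L * k (L * u - L * (x + h)))
          ≤ ∫ u in Ioc (x + h - h) (x + h + h),
            Real.exp (2 * h) * (b u * (L * k (L * u - L * (x + h)))) := by
            refine setIntegral_mono_on ((hKint L hL _).const_mul _).integrableOn
              ((hint L hL _).const_mul _).integrableOn measurableSet_Ioc fun u hu => ?_
            rw [← mul_assoc (Real.exp (2 * h))]
            refine mul_le_mul_of_nonneg_right ?_ (mul_nonneg hLp.le (hk0 _))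
            exact hcmp x u (2 * h) hx0 (by linarith [hu.1]) (by linarith [hu.2])
        _ ≤ _ := by
            refine setIntegral_le_integral ((hint L hL _).const_mul _)
              (Eventually.of_forall fun u => ?_)
            exact mul_nonneg (Real.exp_pos _).le (mul_nonneg (hb0 u) (mul_nonneg hLp.le (hk0 _)))
    exact lt_of_mul_lt_mul_right (h6.trans_lt hx) h3.le
  obtain ⟨M, hM⟩ : ∃ M, ∀ u, b u ≤ M := by
    obtain ⟨X, hX⟩ := eventually_atTop.1 (hup (A + 1) (by linarith))
    refine ⟨max (A + 1) (T (max X 0)), fun u => ?_⟩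
    have hbu : b u = b |u| := by rw [hb, hb, abs_abs]
    rcases le_total X |u| with h | h
    · rw [hbu]; exact (hX _ h).le.trans (le_max_left _ _)
    · refine le_trans ?_ (le_max_right _ _)
      rw [hb]
      have h1 : T |u| ≤ T (max X 0) := hTm (abs_nonneg u) (mem_Ici.2 (le_max_right _ _)) (h.trans (le_max_left _ _))
      refine le_trans (mul_le_of_le_one_left (hT0 _ (abs_nonneg u)) ?_) h1
      exact Real.exp_le_one_iff.2 (by linarith [abs_nonneg u])
  have hlow : ∀ A' < A, ∀ᶠ x in atTop, A' < b x := by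
    intro A' hA'
    obtain ⟨h, h1, hh⟩ := (((hexp.mul_const A').eventually (gt_mem_nhds (show 1 * A' < A by simpa using hA'))).and
      self_mem_nhdsWithin).exists
    replace hh : 0 < h := hh
    have h2 : Tendsto (fun L : ℝ => Real.exp (2 * h) * A' * κ +
        M * (κ - ∫ v in (-(L * h))..(L * h), k v)) atTop (nhds (Real.exp (2 * h) * A' * κ)) := by
      simpa using (((hQ h hh).const_sub κ).const_mul M).const_add (Real.exp (2 * h) * A' * κ)
    obtain ⟨L, h3, hL⟩ := ((h2.eventually (gt_mem_nhds (mul_lt_mul_of_pos_right h1 hκ))).and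
       (eventually_ge_atTop L₀)).exists
    set Q := ∫ v in (-(L * h))..(L * h), k v with hQd
    have h4 : Tendsto (fun x : ℝ => x - h) atTop atTop := tendsto_atTop_add_const_right _ _ tendsto_id
    have h5 := ((hlim L hL).comp h4)
    filter_upwards [h5.eventually (lt_mem_nhds h3), eventually_ge_atTop (2 * h)] with x hx hx0
    simp only [Function.comp] at hx
    have hLp : 0 < L := hL₀.trans_le hL
    have h6 : ∫ u, b u * (L * k (L * u - L * (x - h))) ≤ Real.exp (2 * h) * b x * κ + M * (κ - Q) := by
      have hi1 := (hKint L hL (x - h)).const_mul (Real.exp (2 * h) * b x + M)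
      have hi2 := ((hKint L hL (x - h)).indicator
        (measurableSet_Ioc (a := x - h - h) (b := x - h + h))).const_mul M
      calc _ ≤ ∫ u, ((Real.exp (2 * h) * b x + M) * (L * k (L * u - L * (x - h))) -
            M * (Ioc (x - h - h) (x - h + h)).indicator (fun u => L * k (L * u - L * (x - h))) u) := by
            refine integral_mono (hint L hL _) (hi1.sub hi2) fun u => ?_
            have hK : 0 ≤ L * k (L * u - L * (x - h)) := mul_nonneg hLp.le (hk0 _)
            simp only
            by_cases hu : u ∈ Ioc (x - h - h) (x - h + h)
            · rw [indicator_of_mem hu]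
              have := hcmp u x (2 * h) (by linarith [hu.1]) (by linarith [hu.2])
                (by linarith [hu.1])
              nlinarith
            · rw [indicator_of_notMem hu]
              have := hM u
              have := mul_nonneg (Real.exp_pos (2 * h)).le (hb0 x)
              nlinarith
        _ = _ := by
            rw [integral_sub hi1 hi2, integral_const_mul (Real.exp (2 * h) * b x + M),
              integral_const_mul M,
              integral_indicator measurableSet_Ioc, hKQ L hL _ h hh, hKtot L hL]
            ring
    have h7 : Real.exp (2 * h) * κ * A' < Real.exp (2 * h) * κ * b x := by linarith
    exact lt_of_mul_lt_mul_left h7 (mul_nonneg (Real.exp_pos _).le hκ.le)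
  exact tendsto_order.2 ⟨hlow, hup⟩


lemma aux_kernel : ∃ (φ : ℝ → ℂ) (k : ℝ → ℝ) (m : ℝ), Continuous φ ∧
    (∀ t, t ∉ Icc (-(1/2) : ℝ) (1/2) → φ t = 0) ∧ Integrable φ ∧ Integrable k ∧ Continuous k ∧
    (∀ v, 0 ≤ k v) ∧ (∃ M, ∀ v, k v ≤ M) ∧ Tendsto k (cocompact ℝ) (nhds 0) ∧ 0 < m ∧
    ∫ t, ‖φ t‖ ^ 2 = m ∧ ∫ v, k v = 2 * Real.pi * m ∧
    ∀ v : ℝ, ‖∫ t, φ t * Complex.exp (-(Complex.I * v * t))‖ ^ 2 = k v := by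
  let β : ContDiffBump (0 : ℝ) := ⟨1/4, 1/2, by norm_num, by norm_num⟩
  let φ₀ : ℝ → ℂ := fun t => ((β t : ℝ) : ℂ)
  have hcs : HasCompactSupport φ₀ := β.hasCompactSupport.comp_left (g := fun x : ℝ => (x : ℂ)) (by simp)
  have hcd : ContDiff ℝ (⊤ : ℕ∞) φ₀ := Complex.ofRealCLM.contDiff.comp β.contDiff
  let φ : SchwartzMap ℝ ℂ := hcs.toSchwartzMap hcd
  have hφ : ∀ t, φ t = φ₀ t := fun t => rfl
  let Φ : SchwartzMap ℝ ℂ := FourierTransform.fourier φ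
  have hΦ : ∀ v : ℝ, ∫ t, φ t * Complex.exp (-(Complex.I * v * t)) = Φ (v * (2 * Real.pi)⁻¹) := by
    intro v
    change _ = (FourierTransform.fourier φ : SchwartzMap ℝ ℂ) _
    rw [SchwartzMap.fourier_coe, Real.fourier_real_eq_integral_exp_smul]
    refine integral_congr_ae (Eventually.of_forall fun t => ?_)
    simp only [smul_eq_mul]
    rw [mul_comm]
    congr 2
    have : (Real.pi : ℂ) ≠ 0 := by exact_mod_cast Real.pi_ne_zero
    push_cast
    field_simp
  have hpi : (2 * Real.pi)⁻¹ ≠ 0 := by positivity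
  have hΦi : Integrable (fun v => ‖Φ v‖ ^ 2) := by
    have := (SchwartzMap.memLp Φ 2 volume)
    exact (memLp_two_iff_integrable_sq_norm this.1).1 this
  have hφi : Integrable (fun v => ‖φ v‖ ^ 2) := by
    have := (SchwartzMap.memLp φ 2 volume)
    exact (memLp_two_iff_integrable_sq_norm this.1).1 this
  have hz : Tendsto (fun v => ‖Φ v‖ ^ 2) (cocompact ℝ) (nhds 0) := by
    have := (Real.zero_at_infty_fourier (φ : ℝ → ℂ)).norm.pow 2
    rw [norm_zero, zero_pow two_ne_zero] at this
    exact this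
  refine ⟨φ, fun v => ‖Φ (v * (2 * Real.pi)⁻¹)‖ ^ 2, ∫ t, ‖φ t‖ ^ 2, φ.continuous, ?_,
    φ.integrable, ?_, ?_, fun v => by positivity, ?_, ?_, ?_, rfl, ?_, fun v => by rw [hΦ]⟩
  · intro t ht
    rw [hφ]
    have : β t = 0 := by
      refine β.zero_of_le_dist ?_
      rw [Real.dist_eq, sub_zero]
      change 1 / 2 ≤ |t|
      by_contra hcon
      push Not at hcon
      rw [abs_lt] at hcon
      exact ht ⟨hcon.1.le, hcon.2.le⟩
    simp [φ₀, this]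
  · exact hΦi.comp_mul_right' hpi
  · have := Φ.continuous
    fun_prop
  · obtain ⟨C, hC⟩ := Φ.decay 0 0
    refine ⟨C ^ 2, fun v => ?_⟩
    have := hC.2 (v * (2 * Real.pi)⁻¹)
    simp only [pow_zero, one_mul, norm_iteratedFDeriv_zero] at this
    exact pow_le_pow_left₀ (norm_nonneg _) this 2
  · have h := (Homeomorph.mulRight₀ ((2 * Real.pi)⁻¹) hpi).isClosedEmbedding.tendsto_cocompact
    exact hz.comp h
  · rw [integral_pos_iff_support_of_nonneg (fun t => by positivity) hφi]
    have hc : Continuous (fun t => ‖φ t‖ ^ 2) := by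
      have := φ.continuous
      fun_prop
    refine hc.isOpen_support.measure_pos _ ⟨0, ?_⟩
    have : β 0 = 1 := β.one_of_mem_closedBall (by simp [β.rIn_pos.le])
    simp [hφ, φ₀, this]
  · rw [Measure.integral_comp_mul_right (fun v => ‖Φ v‖ ^ 2), SchwartzMap.integral_norm_sq_fourier]
    rw [inv_inv, abs_of_pos (by positivity), smul_eq_mul]


lemma aux_op (ψ : ℝ → ℂ) (hψ : Continuous ψ) (B : ℝ) (hB : ∀ t, ‖ψ t‖ ≤ B) (a b : ℝ)
    (Ψ : Lp ℂ 2 (volume.restrict (Icc a b)) →L[ℂ] Lp ℂ 2 (volume.restrict (Icc a b)))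
    (hΨ : IsCompactOperator Ψ) :
    ∃ F : ℝ → Lp ℂ 2 (volume.restrict (Icc a b)),
      (∀ x : ℝ, F x =ᵐ[volume.restrict (Icc a b)]
        fun t : ℝ => ψ t * Complex.exp (Complex.I * x * t)) ∧
      Tendsto (fun x => ∫ t in Icc a b, (Ψ (F x)) t * (starRingEnd ℂ) (F x t)) atTop (nhds 0) := by
  have hbd : ∀ x t : ℝ, ‖ψ t * Complex.exp (Complex.I * x * t)‖ ≤ B := fun x t => by
    rw [norm_mul, show Complex.I * x * t = ((x * t : ℝ) : ℂ) * Complex.I by push_cast; ring,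
      Complex.norm_exp_ofReal_mul_I, mul_one]
    exact hB t
  have hm : ∀ x : ℝ, MemLp (fun t : ℝ => ψ t * Complex.exp (Complex.I * x * t)) 2
      (volume.restrict (Icc a b)) := fun x =>
    MemLp.of_bound (Continuous.aestronglyMeasurable (by fun_prop)) B
      (Eventually.of_forall (hbd x))
  refine ⟨fun x => (hm x).toLp _, fun x => (hm x).coeFn_toLp, ?_⟩
  have hB0 : 0 ≤ B := (norm_nonneg _).trans (hB 0)
  have := aux_compact Ψ hΨ (fun x => (hm x).toLp _)
    ((measureUnivNNReal (volume.restrict (Icc a b)) : ℝ) ^ (ENNReal.toReal 2)⁻¹ * B)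
    (fun x => Lp.norm_le_of_ae_bound hB0 (by
      filter_upwards [(hm x).coeFn_toLp] with t ht
      rw [ht]; exact hbd x t)) ?_
  · refine this.congr fun x => ?_
    rw [L2.inner_def]
    refine integral_congr_ae (Eventually.of_forall fun t => ?_)
    simp
  · intro g
    have h1 := Real.tendsto_integral_exp_smul_cocompact
      (fun t => (Icc a b).indicator (fun t => ψ t * (starRingEnd ℂ) (g t)) t)
    have h2 : Tendsto (fun x : ℝ => x * (-(2 * Real.pi)⁻¹)) atTop (cocompact ℝ) := by
      have : Tendsto (fun x : ℝ => x * (-(2 * Real.pi)⁻¹)) atTop atBot :=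
        tendsto_id.atTop_mul_const_of_neg (by simp [Real.pi_pos])
      exact this.mono_right atBot_le_cocompact
    refine (h1.comp h2).congr fun x => ?_
    simp only [Function.comp]
    rw [L2.inner_def, ← integral_indicator measurableSet_Icc]
    have h3 : (fun t => inner ℂ (g t) ((hm x).toLp _ t)) =ᵐ[volume.restrict (Icc a b)]
        fun t => (ψ t * (starRingEnd ℂ) (g t)) * Complex.exp (Complex.I * x * t) := by
      filter_upwards [(hm x).coeFn_toLp] with t ht
      rw [ht]
      simp only [RCLike.inner_apply]
      ring
    rw [integral_indicator measurableSet_Icc, integral_congr_ae h3,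
      ← integral_indicator measurableSet_Icc]
    refine integral_congr_ae (Eventually.of_forall fun t => ?_)
    simp only
    by_cases ht : t ∈ Icc a b
    · rw [indicator_of_mem ht, indicator_of_mem ht, Circle.smul_def, Real.fourierChar_apply,
        smul_eq_mul, mul_comm]
      congr 2
      have : (Real.pi : ℂ) ≠ 0 := by exact_mod_cast Real.pi_ne_zero
      push_cast
      field_simp
    · rw [indicator_of_notMem ht, indicator_of_notMem ht, smul_zero]

lemma aux_even (a : ℝ → ℝ) (ha : IntegrableOn a (Ioi 0)) : Integrable (fun u => a |u|) := by
  have h1 : IntegrableOn (fun u => a |u|) (Ioi 0) :=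
    ha.congr_fun (fun u hu => by rw [abs_of_pos hu]) measurableSet_Ioi
  have h2 : IntegrableOn (fun u => a |u|) (Iic 0) := by
    have := Iff.mpr integrableOn_Ici_iff_integrableOn_Ioi h1
    rw [← integrable_indicator_iff measurableSet_Ici] at this
    rw [← integrable_indicator_iff measurableSet_Iic]
    refine this.comp_neg.congr (Eventually.of_forall fun u => ?_)
    simp [indicator]
  rw [← integrableOn_univ, ← Iic_union_Ioi (a := (0:ℝ))]
  exact h2.union h1

lemma aux_re (a : ℝ → ℝ) (ha : IntegrableOn a (Ioi 0)) (y : ℝ) :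
    ∫ u : ℝ, (a |u| : ℂ) * Complex.exp (Complex.I * u * y) =
      2 * ((∫ u in Ioi (0:ℝ), (a u : ℂ) * Complex.exp (-(Complex.I * u * y))).re : ℂ) := by
  have hi : Integrable (fun u : ℝ => (a |u| : ℂ) * Complex.exp (Complex.I * u * y)) := by
    refine (aux_even a ha).ofReal.mul_bdd (c := 1) (Continuous.aestronglyMeasurable (by fun_prop))
      (Eventually.of_forall fun u => ?_)
    rw [show Complex.I * u * y = ((u * y : ℝ) : ℂ) * Complex.I by push_cast; ring,
      Complex.norm_exp_ofReal_mul_I]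
  rw [← intervalIntegral.integral_Iic_add_Ioi (b := 0) hi.integrableOn hi.integrableOn]
  have h1 := integral_comp_neg_Ioi (0:ℝ) (fun u : ℝ => (a |u| : ℂ) * Complex.exp (Complex.I * u * y))
  rw [neg_zero] at h1
  rw [← h1]
  set Z := ∫ u in Ioi (0:ℝ), (a u : ℂ) * Complex.exp (-(Complex.I * u * y)) with hZ
  have h2 : ∫ x in Ioi (0:ℝ), (a |(-x)| : ℂ) * Complex.exp (Complex.I * (-x : ℝ) * y) = Z := by
    refine setIntegral_congr_fun measurableSet_Ioi fun u hu => ?_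
    rw [mem_Ioi] at hu
    rw [abs_neg, abs_of_pos hu]
    congr 2; push_cast; ring
  have h3 : ∫ x in Ioi (0:ℝ), (a |x| : ℂ) * Complex.exp (Complex.I * x * y)
      = (starRingEnd ℂ) Z := by
    rw [hZ, ← integral_conj]
    refine setIntegral_congr_fun measurableSet_Ioi fun u hu => ?_
    rw [mem_Ioi] at hu
    rw [abs_of_pos hu]
    simp [← Complex.exp_conj]
  rw [h2, h3, Complex.add_conj]
  push_cast; rfl

lemma aux_scale (φ : ℝ → ℂ) (k : ℝ → ℝ) (L x u : ℝ) (hL : 0 < L)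
    (hk : ∀ v : ℝ, ‖∫ t, φ t * Complex.exp (-(Complex.I * v * t))‖ ^ 2 = k v) :
    ‖∫ t, (φ (t / L) * Complex.exp (Complex.I * x * t)) *
        Complex.exp (-(Complex.I * u * t))‖ ^ 2 = L ^ 2 * k (L * u - L * x) := by
  have h1 := Measure.integral_comp_div
    (fun t : ℝ => φ t * Complex.exp (-(Complex.I * ((L * u - L * x : ℝ) : ℂ) * t))) L
  have h2 : ∫ t, (φ (t / L) * Complex.exp (Complex.I * x * t)) *
        Complex.exp (-(Complex.I * u * t)) =
      ∫ t : ℝ, φ (t / L) * Complex.exp (-(Complex.I * ((L * u - L * x : ℝ) : ℂ) * (t / L : ℝ))) := by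
    refine integral_congr_ae (Eventually.of_forall fun t => ?_)
    simp only
    rw [mul_assoc, ← Complex.exp_add]
    congr 2
    have : (L : ℂ) ≠ 0 := by exact_mod_cast hL.ne'
    push_cast
    field_simp
    ring
  rw [h2, h1, norm_smul, mul_pow, hk]
  simp

lemma aux_limit (φ : ℝ → ℂ) (hφc : Continuous φ)
    (hφ0 : ∀ t, t ∉ Icc (-(1/2) : ℝ) (1/2) → φ t = 0) (hφi : Integrable φ) (k : ℝ → ℝ)
    (hk : ∀ v : ℝ, ‖∫ t, φ t * Complex.exp (-(Complex.I * v * t))‖ ^ 2 = k v)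
    (m : ℝ) (hm : ∫ t, ‖φ t‖ ^ 2 = m)
    (L : ℝ) (hL : 0 < L) (A : ℝ) (H : ℝ → ℝ → ℝ) (hH : ∀ ε, 0 < ε → Integrable (H ε))
    (N : ℝ → ℝ → ℝ) (hN : ∀ ε, 0 < ε → ∀ y : ℝ,
      ∫ u : ℝ, (H ε u : ℂ) * Complex.exp (Complex.I * u * y) = 2 * (N ε y : ℂ))
    (Ψ : Lp ℂ 2 (volume.restrict (Icc (-(L / 2)) (L / 2)))
          →L[ℂ] Lp ℂ 2 (volume.restrict (Icc (-(L / 2)) (L / 2))))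
    (hΨ : IsCompactOperator Ψ)
    (hw : ∀ f g : Lp ℂ 2 (volume.restrict (Icc (-(L / 2)) (L / 2))),
          Tendsto
            (fun ε : ℝ => (1 / (Real.pi : ℂ)) *
              ∫ t in Icc (-(L / 2)) (L / 2),
                (∫ τ in Icc (-(L / 2)) (L / 2), f τ * (N ε (t - τ) : ℂ))
                * (starRingEnd ℂ) (g t))
            (nhdsWithin 0 (Ioi 0))
            (nhds ((A : ℂ) * (∫ t in Icc (-(L / 2)) (L / 2), f t * (starRingEnd ℂ) (g t))
              + ∫ t in Icc (-(L / 2)) (L / 2), (Ψ f) t * (starRingEnd ℂ) (g t)))) :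
    ∃ E : ℝ → ℝ, Tendsto E atTop (nhds 0) ∧ ∀ x, Tendsto (fun ε => ∫ u, H ε u *
      (L * k (L * u - L * x))) (nhdsWithin 0 (Ioi 0)) (nhds (A * (2 * Real.pi * m) + E x)) := by
  obtain ⟨B, hB⟩ := isCompact_Icc.exists_bound_of_continuousOn (s := Icc (-(1/2) : ℝ) (1/2))
    hφc.continuousOn
  have hB' : ∀ t, ‖φ (t / L)‖ ≤ max B 0 := fun t => by
    by_cases h : t / L ∈ Icc (-(1/2) : ℝ) (1/2)
    · exact (hB _ h).trans (le_max_left _ _)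
    · rw [hφ0 _ h, norm_zero]; exact le_max_right _ _
  have hz : ∀ t, t ∉ Icc (-(L / 2)) (L / 2) → φ (t / L) = 0 := by
    intro t ht
    refine hφ0 _ fun h => ht ?_
    have h1 := h.1
    have h2 := h.2
    rw [le_div_iff₀ hL] at h1
    rw [div_le_iff₀ hL] at h2
    exact ⟨by linarith, by linarith⟩
  obtain ⟨F, hF, hE⟩ := aux_op (fun t => φ (t / L)) (by fun_prop) _ hB' _ _ Ψ hΨ
  refine ⟨fun x => 2 * Real.pi / L *
    (∫ t in Icc (-(L / 2)) (L / 2), (Ψ (F x)) t * (starRingEnd ℂ) (F x t)).re, ?_, fun x => ?_⟩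
  · simpa using ((Complex.continuous_re.tendsto _).comp hE).const_mul (2 * Real.pi / L)
  set f : ℝ → ℂ := fun t => φ (t / L) * Complex.exp (Complex.I * x * t) with hf
  have hfz : ∀ t, t ∉ Icc (-(L / 2)) (L / 2) → f t = 0 := fun t ht => by simp [hf, hz t ht]
  have hnexp : ∀ t : ℝ, ‖Complex.exp (Complex.I * x * t)‖ = 1 := fun t => by
    rw [show Complex.I * x * t = ((x * t : ℝ) : ℂ) * Complex.I by push_cast; ring,
      Complex.norm_exp_ofReal_mul_I]
  have hfi : Integrable f := by
    refine (hφi.comp_div hL.ne').mul_bdd (c := 1) (Continuous.aestronglyMeasurable (by fun_prop))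
      (Eventually.of_forall fun t => (hnexp t).le)
  have hnorm : ∫ t in Icc (-(L / 2)) (L / 2), F x t * (starRingEnd ℂ) (F x t) = ((L * m : ℝ) : ℂ) := by
    have h1 : ∫ t in Icc (-(L / 2)) (L / 2), F x t * (starRingEnd ℂ) (F x t) = ∫ t in Icc (-(L / 2)) (L / 2), ((‖φ (t / L)‖ ^ 2 : ℝ) : ℂ) := by
      refine integral_congr_ae ?_
      filter_upwards [hF x] with t ht
      rw [ht, Complex.mul_conj, Complex.normSq_eq_norm_sq, norm_mul, hnexp, mul_one]
    rw [h1, setIntegral_eq_integral_of_forall_compl_eq_zero (fun t ht => by simp [hz t ht]),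
      integral_complex_ofReal, Measure.integral_comp_div (fun t => ‖φ t‖ ^ 2), hm,
      abs_of_pos hL, smul_eq_mul]
  have hform : ∀ ε : ℝ, 0 < ε → ∫ t in Icc (-(L / 2)) (L / 2), (∫ τ in Icc (-(L / 2)) (L / 2), F x τ * (N ε (t - τ) : ℂ))
      * (starRingEnd ℂ) (F x t) = ((L / 2 * ∫ u, H ε u * (L * k (L * u - L * x)) : ℝ) : ℂ) := by
    intro ε hε
    have h1 : ∀ t : ℝ, ∫ τ in Icc (-(L / 2)) (L / 2), F x τ * (N ε (t - τ) : ℂ) = 2⁻¹ *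
        ∫ τ, f τ * ∫ u : ℝ, (H ε u : ℂ) * Complex.exp (Complex.I * u * (t - τ)) := by
      intro t
      rw [← integral_const_mul]
      have : ∫ τ in Icc (-(L / 2)) (L / 2), F x τ * (N ε (t - τ) : ℂ) = ∫ τ in Icc (-(L / 2)) (L / 2), f τ * (N ε (t - τ) : ℂ) := by
        refine integral_congr_ae ?_
        filter_upwards [hF x] with τ hτ
        rw [hτ]
      rw [this, setIntegral_eq_integral_of_forall_compl_eq_zero
        (fun τ hτ => by simp [hfz τ hτ])]
      refine integral_congr_ae (Eventually.of_forall fun τ => ?_)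
      have h2 := hN ε hε (t - τ)
      push_cast at h2
      simp only
      rw [h2]; ring
    have h2 : ∫ t in Icc (-(L / 2)) (L / 2), (∫ τ in Icc (-(L / 2)) (L / 2), F x τ * (N ε (t - τ) : ℂ)) * (starRingEnd ℂ) (F x t)
        = ∫ t in Icc (-(L / 2)) (L / 2), 2⁻¹ * ((∫ τ, f τ * ∫ u : ℝ, (H ε u : ℂ) *
          Complex.exp (Complex.I * u * (t - τ))) * (starRingEnd ℂ) (f t)) := by
      refine integral_congr_ae ?_
      filter_upwards [hF x] with t ht
      rw [ht, h1, mul_assoc]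
    rw [h2, setIntegral_eq_integral_of_forall_compl_eq_zero
        (fun t ht => by simp [hfz t ht]), integral_const_mul, aux_form f hfi (H ε) (hH ε hε)]
    have h3 : ∫ u, H ε u * ‖∫ t, f t * Complex.exp (-(Complex.I * u * t))‖ ^ 2
        = L * ∫ u, H ε u * (L * k (L * u - L * x)) := by
      rw [← integral_const_mul]
      refine integral_congr_ae (Eventually.of_forall fun u => ?_)
      simp only [hf]
      rw [aux_scale φ k L x u hL hk]; ring
    rw [h3]; push_cast; ring
  have h := (Complex.continuous_re.tendsto _).comp (hw (F x) (F x))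
  have h' := h.const_mul (2 * Real.pi / L)
  rw [hnorm] at h'
  have e1 : 2 * Real.pi / L * ((A : ℂ) * ((L * m : ℝ) : ℂ) +
      ∫ t in Icc (-(L / 2)) (L / 2), (Ψ (F x)) t * (starRingEnd ℂ) (F x t)).re = A * (2 * Real.pi * m) +
      2 * Real.pi / L * (∫ t in Icc (-(L / 2)) (L / 2), (Ψ (F x)) t * (starRingEnd ℂ) (F x t)).re := by
    rw [Complex.add_re, ← Complex.ofReal_mul, Complex.ofReal_re]
    field_simp
  rw [e1] at h'
  refine h'.congr' ?_
  filter_upwards [self_mem_nhdsWithin] with ε hε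
  simp only [Function.comp]
  rw [hform ε hε, show (1 / (Real.pi : ℂ)) = ((1 / Real.pi : ℝ) : ℂ) by push_cast; rfl,
    ← Complex.ofReal_mul, Complex.ofReal_re]
  have := Real.pi_ne_zero
  field_simp


/-- **Main theorem, converse direction.**  Let `S : [0,∞) → ℝ` be non-decreasing, with
`G(s) = ∫₀^∞ S(e^u) e^{−su} du` converging for `Re s > 1`.  Suppose that for every
sufficiently large symmetric interval `I = [−L/2, L/2]` the operators `W_{S,I,ε}` with
kernel `(1/π)·Re G(1+ε+i(t−τ))` converge, in the weak operator topology as `ε → 0⁺`, to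
`A·Id + Ψ_L` with `Ψ_L` compact.  Then `S(e^u)/e^u → A` as `u → ∞`. -/
theorem tendsto_of_weak_limit_identity_add_compact
    (S : ℝ → ℝ) (hmono : MonotoneOn S (Ici (0 : ℝ)))
    (hconv : ∀ s : ℂ, 1 < s.re →
      IntegrableOn (fun u : ℝ => (S (Real.exp u) : ℂ) * Complex.exp (-s * u)) (Ioi 0))
    (G : ℂ → ℂ)
    (hG : ∀ s : ℂ, 1 < s.re →
      G s = ∫ u in Ioi (0 : ℝ), (S (Real.exp u) : ℂ) * Complex.exp (-s * u))
    (A : ℝ)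
    (hweak : ∃ L₀ : ℝ, 0 < L₀ ∧ ∀ L : ℝ, L₀ ≤ L →
      ∃ Ψ : Lp ℂ 2 (volume.restrict (Icc (-(L / 2)) (L / 2)))
          →L[ℂ] Lp ℂ 2 (volume.restrict (Icc (-(L / 2)) (L / 2))),
        IsCompactOperator Ψ ∧
        ∀ f g : Lp ℂ 2 (volume.restrict (Icc (-(L / 2)) (L / 2))),
          Tendsto
            (fun ε : ℝ => (1 / (Real.pi : ℂ)) *
              ∫ t in Icc (-(L / 2)) (L / 2),
                (∫ τ in Icc (-(L / 2)) (L / 2),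
                  f τ * ((G (1 + ε + Complex.I * (t - τ))).re : ℂ))
                * (starRingEnd ℂ) (g t))
            (nhdsWithin 0 (Ioi 0))
            (nhds ((A : ℂ) * (∫ t in Icc (-(L / 2)) (L / 2), f t * (starRingEnd ℂ) (g t))
              + ∫ t in Icc (-(L / 2)) (L / 2), (Ψ f) t * (starRingEnd ℂ) (g t)))) :
    Tendsto (fun u : ℝ => S (Real.exp u) / Real.exp u) atTop (nhds A) := by
  obtain ⟨L₀, hL₀, hweak⟩ := hweak
  obtain ⟨φ, k, m, hφc, hφ0, hφi, hki, hkc, hk0, ⟨M, hM⟩, hkz, hm0, hm, hkm, hk⟩ := aux_kernel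
  -- the one-sided density
  set a : ℝ → ℝ → ℝ := fun ε u => Real.exp (-ε * u) * (Real.exp (-u) * S (Real.exp u)) with ha
  have hac : ∀ ε y u : ℝ, (S (Real.exp u) : ℂ) * Complex.exp (-(1 + ε + Complex.I * y) * u)
      = (a ε u : ℂ) * Complex.exp (-(Complex.I * u * y)) := by
    intro ε y u
    simp only [ha]
    push_cast
    rw [show -(1 + (ε : ℂ) + Complex.I * y) * u = -ε * u + (-u + -(Complex.I * u * y)) by ring,
      Complex.exp_add, Complex.exp_add]
    ring
  have hre : ∀ ε y : ℝ, 0 < ε → 1 < (1 + (ε : ℂ) + Complex.I * (y : ℂ)).re := by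
    intro ε y hε; simpa using hε
  have hai : ∀ ε, 0 < ε → IntegrableOn (a ε) (Ioi 0) := by
    intro ε hε
    have h := hconv _ (hre ε 0 hε)
    have h2 := h.re
    refine h2.congr (Eventually.of_forall fun u => ?_)
    simp only
    rw [hac]
    simp
  set H : ℝ → ℝ → ℝ := fun ε u => a ε |u| with hHd
  have hH : ∀ ε, 0 < ε → Integrable (H ε) := fun ε hε => aux_even _ (hai ε hε)
  have hN : ∀ ε : ℝ, 0 < ε → ∀ y : ℝ,
      ∫ u : ℝ, (H ε u : ℂ) * Complex.exp (Complex.I * u * y)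
        = 2 * ((G (1 + ε + Complex.I * y)).re : ℂ) := by
    intro ε hε y
    rw [aux_re (a ε) (hai ε hε) y, hG _ (hre ε y hε)]
    simp_rw [hac]
  set T : ℝ → ℝ := fun u => S (Real.exp u) - S 1 with hT
  set b : ℝ → ℝ := fun u => Real.exp (-|u|) * T |u| with hb
  have hT0 : ∀ u, 0 ≤ u → 0 ≤ T u := fun u hu =>
    sub_nonneg.2 (hmono (mem_Ici.2 zero_le_one) (mem_Ici.2 (Real.exp_pos u).le)
      (Real.one_le_exp hu))
  have hTm : MonotoneOn T (Ici 0) := fun u _ v _ huv =>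
    sub_le_sub_right (hmono (mem_Ici.2 (Real.exp_pos u).le) (mem_Ici.2 (Real.exp_pos v).le)
      (Real.exp_le_exp.2 huv)) _
  have hb0 : ∀ u, 0 ≤ b u := fun u => mul_nonneg (Real.exp_pos _).le (hT0 _ (abs_nonneg u))
  have hHb : ∀ ε u, H ε u = Real.exp (-ε * |u|) * b u +
      S 1 * (Real.exp (-ε * |u|) * Real.exp (-|u|)) := by
    intro ε u; simp only [hHd, ha, hb, hT]; ring
  have hei : Integrable (fun u : ℝ => Real.exp (-|u|)) :=
    aux_even (fun u => Real.exp (-u)) (by simpa using exp_neg_integrableOn_Ioi 0 one_pos)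
  have hexp1 : ∀ ε u : ℝ, 0 < ε → Real.exp (-ε * |u|) ≤ 1 := fun ε u hε => by
    refine Real.exp_le_one_iff.2 ?_
    have := mul_nonneg hε.le (abs_nonneg u)
    linarith
  have hM0 : 0 ≤ M := (hk0 0).trans (hM 0)
  have key : ∀ L, L₀ ≤ L → (∀ x, Integrable (fun u => b u * (L * k (L * u - L * x)))) ∧
      Tendsto (fun x => ∫ u, b u * (L * k (L * u - L * x))) atTop
        (nhds (A * (2 * Real.pi * m))) := by
    intro L hL
    have hLp : 0 < L := hL₀.trans_le hL
    obtain ⟨Ψ, hΨ, hw⟩ := hweak L hL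
    obtain ⟨E, hE, hlim⟩ := aux_limit φ hφc hφ0 hφi k hk m hm L hLp A H hH
      (fun ε y => (G (1 + ε + Complex.I * y)).re) hN Ψ hΨ (by
        intro f g
        have := hw f g
        simpa only [Complex.ofReal_sub] using this)
    have hKc : ∀ x : ℝ, Continuous (fun u => L * k (L * u - L * x)) := fun x => by fun_prop
    have hKb : ∀ x u : ℝ, ‖L * k (L * u - L * x)‖ ≤ L * M := fun x u => by
      rw [Real.norm_of_nonneg (mul_nonneg hLp.le (hk0 _))]
      exact mul_le_mul_of_nonneg_left (hM _) hLp.le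
    have heKi : ∀ x : ℝ, Integrable (fun u => Real.exp (-|u|) * (L * k (L * u - L * x))) :=
      fun x => hei.mul_bdd (hKc x).aestronglyMeasurable (Eventually.of_forall (hKb x))
    have hei2 : ∀ ε x : ℝ, 0 < ε → Integrable (fun u => Real.exp (-ε * |u|) *
        (Real.exp (-|u|) * (L * k (L * u - L * x)))) := fun ε x hε =>
      (heKi x).bdd_mul (c := 1) (Continuous.aestronglyMeasurable (by fun_prop))
        (Eventually.of_forall fun u => by
          rw [Real.norm_of_nonneg (Real.exp_pos _).le]; exact hexp1 ε u hε)
    set D : ℝ → ℝ := fun x => ∫ u, Real.exp (-|u|) * (L * k (L * u - L * x)) with hD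
    have hDε : ∀ x, Tendsto (fun ε : ℝ => ∫ u, Real.exp (-ε * |u|) *
        (Real.exp (-|u|) * (L * k (L * u - L * x)))) (nhdsWithin 0 (Ioi 0)) (nhds (D x)) := by
      intro x
      refine tendsto_integral_filter_of_dominated_convergence
        (fun u => Real.exp (-|u|) * (L * k (L * u - L * x))) ?_ ?_ (heKi x) ?_
      · filter_upwards [self_mem_nhdsWithin] with ε hε using (hei2 ε x hε).1
      · filter_upwards [self_mem_nhdsWithin] with ε hε
        refine Eventually.of_forall fun u => ?_
        have h0 : 0 ≤ Real.exp (-|u|) * (L * k (L * u - L * x)) :=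
          mul_nonneg (Real.exp_pos _).le (mul_nonneg hLp.le (hk0 _))
        rw [Real.norm_of_nonneg (mul_nonneg (Real.exp_pos _).le h0)]
        exact mul_le_of_le_one_left h0 (hexp1 ε u hε)
      · refine Eventually.of_forall fun u => ?_
        have : Continuous (fun ε : ℝ => Real.exp (-ε * |u|) *
          (Real.exp (-|u|) * (L * k (L * u - L * x)))) := by fun_prop
        simpa using (this.tendsto 0).mono_left (nhdsWithin_le_nhds (s := Ioi 0))
    have hD0 : Tendsto D atTop (nhds 0) := by
      have := tendsto_integral_filter_of_dominated_convergence (l := (atTop : Filter ℝ))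
        (F := fun x u => Real.exp (-|u|) * (L * k (L * u - L * x))) (f := fun _ => (0:ℝ))
        (μ := volume)
        (fun u => Real.exp (-|u|) * (L * M)) (Eventually.of_forall fun x => (heKi x).1) ?_
        (hei.mul_const _) ?_
      · simpa using this
      · refine Eventually.of_forall fun x => Eventually.of_forall fun u => ?_
        rw [norm_mul, Real.norm_of_nonneg (Real.exp_pos _).le]
        exact mul_le_mul_of_nonneg_left (hKb x u) (Real.exp_pos _).le
      · refine Eventually.of_forall fun u => ?_
        have h1 : Tendsto (fun x : ℝ => L * u - L * x) atTop (cocompact ℝ) := by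
          have : Tendsto (fun x : ℝ => L * u - L * x) atTop atBot :=
            tendsto_atBot_add_const_left _ _ (tendsto_neg_atTop_atBot.comp
              (tendsto_id.const_mul_atTop hLp))
          exact this.mono_right atBot_le_cocompact
        simpa using ((hkz.comp h1).const_mul L).const_mul (Real.exp (-|u|))
    have hbi : ∀ ε x : ℝ, 0 < ε → Integrable (fun u => Real.exp (-ε * |u|) *
        (b u * (L * k (L * u - L * x)))) := by
      intro ε x hε
      have h1 : Integrable (fun u => H ε u * (L * k (L * u - L * x))) :=
        (hH ε hε).mul_bdd (hKc x).aestronglyMeasurable (Eventually.of_forall (hKb x))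
      refine (h1.sub ((hei2 ε x hε).const_mul (S 1))).congr (Eventually.of_forall fun u => ?_)
      simp only [Pi.sub_apply, hHb]; ring
    have hfin : ∀ x, Integrable (fun u => b u * (L * k (L * u - L * x))) ∧
        ∫ u, b u * (L * k (L * u - L * x)) = A * (2 * Real.pi * m) + E x - S 1 * D x := by
      intro x
      refine aux_mono _ (fun u => mul_nonneg (hb0 u) (mul_nonneg hLp.le (hk0 _)))
        (fun ε hε => hbi ε x hε) _ ?_
      refine ((hlim x).sub ((hDε x).const_mul (S 1))).congr' ?_
      filter_upwards [self_mem_nhdsWithin] with ε hε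
      rw [sub_eq_iff_eq_add, ← integral_const_mul,
        ← integral_add (hbi ε x hε) ((hei2 ε x hε).const_mul (S 1))]
      refine integral_congr_ae (Eventually.of_forall fun u => ?_)
      simp only [hHb]; ring
    refine ⟨fun x => (hfin x).1, ?_⟩
    simp_rw [fun x => (hfin x).2]
    simpa using (hE.const_add (A * (2 * Real.pi * m))).sub (hD0.const_mul (S 1))
  have htau := aux_tauber T b k hT0 hTm (fun u => rfl) hki hk0 (2 * Real.pi * m)
    (by positivity) hkm A L₀ hL₀ (fun L hL => (key L hL).1) (fun L hL => (key L hL).2)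
  have hz : Tendsto (fun u : ℝ => S 1 * Real.exp (-u)) atTop (nhds 0) := by
    simpa using (Real.tendsto_exp_neg_atTop_nhds_zero).const_mul (S 1)
  have := htau.add hz
  rw [add_zero] at this
  refine this.congr' ?_
  filter_upwards [eventually_ge_atTop 0] with u hu
  simp only [hb, hT, abs_of_nonneg hu, Real.exp_neg]
  field_simp
  ring
end

section
/- For every L > 0, writing I = [−L/2, L/2], there exists a compact operator Ψ_I on L²(I) such that for all f, g ∈ L²(I), lim_{ε→0⁺} (1/π) ∫_I ∫_I f(τ) · Re( ζ(1+ε+i(t−τ)) / (1+ε+i(t−τ)) ) · conj(g(t)) dτ dt = ⟨f, g⟩ + ⟨Ψ_I f, g⟩, where ζ is the Riemann zeta function and ⟨·,·⟩ is the inner product of L²(I). -/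
open MeasureTheory Set Filter

theorem aux_compact_s13 {α : Type*} [MeasurableSpace α] (μ : Measure α)
    {E : Type*} [NormedAddCommGroup E] [NormedSpace ℂ E] [CompleteSpace E] (κ : Lp E 2 μ) :
    IsCompactOperator ((ContinuousLinearMap.lsmul ℂ ℂ : ℂ →L[ℂ] E →L[ℂ] E).flip.lpPairing μ 2 2 κ) := by
  refine Lp.induction (p := 2) (by simp) (motive := fun κ => IsCompactOperator
    ((ContinuousLinearMap.lsmul ℂ ℂ : ℂ →L[ℂ] E →L[ℂ] E).flip.lpPairing μ 2 2 κ)) ?_ ?_ ?_ κ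
  · intro c s hs hμs
    have : ∀ f : Lp ℂ 2 μ,
        (ContinuousLinearMap.lsmul ℂ ℂ : ℂ →L[ℂ] E →L[ℂ] E).flip.lpPairing μ 2 2
          (Lp.simpleFunc.indicatorConst 2 hs hμs.ne c) f
        = (ContinuousLinearMap.toSpanSingleton ℂ c)
          ((ContinuousLinearMap.lsmul ℂ ℂ : ℂ →L[ℂ] ℂ →L[ℂ] ℂ).flip.lpPairing μ 2 2
          (Lp.simpleFunc.indicatorConst 2 hs hμs.ne (1:ℂ)) f) := by
      intro f
      rw [ContinuousLinearMap.lpPairing_eq_integral, ContinuousLinearMap.lpPairing_eq_integral]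
      rw [ContinuousLinearMap.toSpanSingleton_apply, ← integral_smul_const]
      apply integral_congr_ae
      rw [Lp.simpleFunc.coe_indicatorConst, Lp.simpleFunc.coe_indicatorConst]
      filter_upwards [indicatorConstLp_coeFn (p := 2) (hs := hs) (hμs := hμs.ne) (c := c),
        indicatorConstLp_coeFn (p := 2) (hs := hs) (hμs := hμs.ne) (c := (1:ℂ))] with x h1 h2
      rw [h1, h2]
      by_cases hx : x ∈ s <;> simp [hx]
    rw [funext this]
    exact (isCompactOperator_of_locallyCompactSpace_rng
      (ContinuousLinearMap.toSpanSingleton ℂ c)).comp_clm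
      ((ContinuousLinearMap.lsmul ℂ ℂ : ℂ →L[ℂ] ℂ →L[ℂ] ℂ).flip.lpPairing μ 2 2
          (Lp.simpleFunc.indicatorConst 2 hs hμs.ne (1:ℂ)))
  · intro f g hf hg _ h1 h2
    rw [map_add]
    exact h1.add h2
  · exact (isClosed_setOfPred_isCompactOperator (σ₁₂ := RingHom.id ℂ)).preimage
      (ContinuousLinearMap.continuous _)

theorem aux_kernel_s13 (μ : Measure ℝ) [IsFiniteMeasure μ] (k : ℝ → ℂ) (hk : UniformContinuous k)
    (C : ℝ) (hC : ∀ x, ‖k x‖ ≤ C) :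
    ∃ Ψ : Lp ℂ 2 μ →L[ℂ] Lp ℂ 2 μ, IsCompactOperator Ψ ∧ ∀ f g : Lp ℂ 2 μ,
      ∫ t, Ψ f t * (starRingEnd ℂ) (g t) ∂μ =
      ∫ t, (∫ τ, f τ * k (t - τ) ∂μ) * (starRingEnd ℂ) (g t) ∂μ := by
  let b : ℝ → BoundedContinuousFunction ℝ ℂ := fun τ =>
    BoundedContinuousFunction.ofNormedAddCommGroup (fun t => k (t - τ))
      (hk.continuous.comp (by fun_prop)) C (fun x => hC _)
  have hb : Continuous b := by
    rw [Metric.continuous_iff]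
    intro τ ε hε
    obtain ⟨δ, hδ, h⟩ := Metric.uniformContinuous_iff.1 hk (ε/2) (by positivity)
    refine ⟨δ, hδ, fun a ha => ?_⟩
    refine lt_of_le_of_lt ((BoundedContinuousFunction.dist_le (by positivity)).2 fun x => ?_)
      (half_lt_self hε)
    have : dist (x - a) (x - τ) < δ := by rw [dist_sub_left]; exact ha
    exact (h this).le
  have hbC : ∀ τ, ‖b τ‖ ≤ C := fun τ =>
    (BoundedContinuousFunction.norm_le ((norm_nonneg _).trans (hC 0))).2 fun x => hC _
  let κ : ℝ → Lp ℂ 2 μ := fun τ => BoundedContinuousFunction.toLp 2 μ ℂ (b τ)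
  have hκc : Continuous κ := (ContinuousLinearMap.continuous _).comp hb
  have hκ : MemLp κ 2 μ := by
    refine MemLp.of_bound hκc.aestronglyMeasurable
      (‖BoundedContinuousFunction.toLp (E := ℂ) 2 μ ℂ‖ * C) (Eventually.of_forall fun τ => ?_)
    exact (ContinuousLinearMap.le_opNorm _ _).trans (by gcongr; exact hbC τ)
  refine ⟨_, aux_compact_s13 μ (hκ.toLp κ), fun f g => ?_⟩
  have hf : Integrable f μ := (Lp.memLp f).integrable (by norm_num)
  have hg : Integrable (fun t => (starRingEnd ℂ) (g t)) μ := by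
    have := (Lp.memLp g).integrable (by norm_num : (1:ENNReal) ≤ 2)
    exact (Complex.conjCLE : ℂ →L[ℝ] ℂ).integrable_comp this
  have e1 : ∀ u : Lp ℂ 2 μ, ∫ t, u t * (starRingEnd ℂ) (g t) ∂μ = inner ℂ g u := by
    intro u
    rw [L2.inner_def]; rfl
  have hint : Integrable (fun τ => f τ • κ τ) μ := by
    refine hf.smul_bdd (‖BoundedContinuousFunction.toLp (E := ℂ) 2 μ ℂ‖ * C) hκc.aestronglyMeasurable (Eventually.of_forall fun τ => ?_)
    exact (ContinuousLinearMap.le_opNorm _ _).trans (mul_le_mul_of_nonneg_left (hbC τ) (norm_nonneg _))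
  rw [e1, ContinuousLinearMap.lpPairing_eq_integral]
  have e2 : ∫ x, ((ContinuousLinearMap.lsmul ℂ ℂ).flip ((hκ.toLp κ) x)) (f x) ∂μ
      = ∫ τ, f τ • κ τ ∂μ := by
    apply integral_congr_ae
    filter_upwards [hκ.coeFn_toLp] with x hx
    rw [hx]; simp
  refine (congrArg (inner ℂ g) e2).trans ?_
  rw [← integral_inner hint]
  have e3 : ∀ τ, inner ℂ g (f τ • κ τ) = ∫ t, (f τ * k (t - τ)) * (starRingEnd ℂ) (g t) ∂μ := by
    intro τ
    rw [inner_smul_right, ← e1, ← integral_const_mul]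
    apply integral_congr_ae
    filter_upwards [BoundedContinuousFunction.coeFn_toLp 2 μ ℂ (b τ)] with x hx
    rw [hx]
    simp [b, mul_assoc]
  simp_rw [e3]
  rw [integral_integral_swap]
  · simp_rw [integral_mul_const]
  · have := (hf.mul_prod hg).mul_bdd (g := fun p : ℝ × ℝ => k (p.2 - p.1)) (c := C)
      (hk.continuous.comp (by fun_prop)).aestronglyMeasurable (Eventually.of_forall fun τ => hC _)
    convert this using 2
    simp only [Function.uncurry]; ring

theorem aux_poisson (f g : ℝ → ℂ) (hf : Integrable f) (hf2 : MemLp f 2) (hg : Integrable g)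
    (hg2 : MemLp g 2) :
    Tendsto (fun ε : ℝ => (1 / (Real.pi : ℂ)) * ∫ t, (∫ τ, f τ * ((ε / (ε^2 + (t-τ)^2) : ℝ) : ℂ)) * (starRingEnd ℂ) (g t))
      (nhdsWithin 0 (Ioi 0)) (nhds (∫ t, f t * (starRingEnd ℂ) (g t))) := by
  have hgc : Integrable (fun t => (starRingEnd ℂ) (g t)) :=
    (Complex.conjCLE : ℂ →L[ℝ] ℂ).integrable_comp hg
  let A : ℝ → ℂ := fun u => ∫ t, f (t - u) * (starRingEnd ℂ) (g t)
  have hw : Integrable (fun p : ℝ × ℝ => f (p.2 - p.1) * (starRingEnd ℂ) (g p.2))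
      (volume.prod volume) := by
    have := hgc.convolution_integrand (ContinuousLinearMap.mul ℂ ℂ) hf.comp_neg
    convert this using 2 with p
    simp [mul_comm]
  have hA : Integrable A := hw.integral_prod_left
  have hAc : Continuous A := by
    have h1 : A = fun u : ℝ => inner ℂ (hg2.toLp g) ((DomAddAct.mk (-u)) +ᵥ (hf2.toLp f)) := by
      ext u
      rw [L2.inner_def]
      apply integral_congr_ae
      filter_upwards [hg2.coeFn_toLp, DomAddAct.vadd_Lp_ae_eq (DomAddAct.mk (-u)) (hf2.toLp f),
        (measurePreserving_add_left volume (-u)).quasiMeasurePreserving.ae hf2.coeFn_toLp]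
        with t h1 h2 h3
      rw [h1, h2]
      simp only [Equiv.symm_apply_apply, vadd_eq_add]
      rw [h3]
      simp [RCLike.inner_apply, neg_add_eq_sub]
    rw [h1]
    have : Fact ((2:ENNReal) ≠ ⊤) := ⟨by simp⟩
    refine continuous_const.inner (Continuous.fun_vadd ?_ continuous_const)
    exact DomAddAct.continuous_mk.comp continuous_neg
  have key := tendsto_integral_comp_smul_smul_of_integrable (μ := (volume : Measure ℝ))
    (φ := fun x : ℝ => Real.pi⁻¹ * (1 + x^2)⁻¹) (fun x => by positivity)
    (by rw [integral_const_mul, integral_univ_inv_one_add_sq]; field_simp)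
    (by
      simp only [Module.finrank_self, pow_one]
      have h0 : Tendsto (fun x : ℝ => Real.pi⁻¹ * ‖x‖⁻¹) (Bornology.cobounded ℝ) (nhds 0) := by
        simpa only [mul_zero, Pi.inv_apply] using ((tendsto_norm_cobounded_atTop (E := ℝ)).inv_tendsto_atTop).const_mul (Real.pi⁻¹)
      refine squeeze_zero' (Eventually.of_forall fun x => by positivity) ?_ h0
      filter_upwards [(tendsto_norm_cobounded_atTop (E := ℝ)).eventually_gt_atTop 0] with x hx
      have : ‖x‖ * (1 + x^2)⁻¹ ≤ ‖x‖⁻¹ := by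
        rw [← div_eq_mul_inv, div_le_iff₀ (by positivity), ← sq_abs, ← Real.norm_eq_abs]
        field_simp
        linarith
      calc _ = Real.pi⁻¹ * (‖x‖ * (1 + x^2)⁻¹) := by ring
        _ ≤ _ := by gcongr)
    hA hAc.continuousAt
  have key2 := key.comp tendsto_inv_nhdsGT_zero
  have hA0 : A 0 = ∫ t, f t * (starRingEnd ℂ) (g t) := by simp [A]
  rw [hA0] at key2
  refine key2.congr' ?_
  filter_upwards [self_mem_nhdsWithin] with ε hε
  have hε : 0 < ε := hε
  simp only [Function.comp, Module.finrank_self, pow_one]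
  have hsub : ∀ t, ∫ τ, f τ * ((ε / (ε^2 + (t-τ)^2) : ℝ) : ℂ)
      = ∫ u, f (t - u) * ((ε / (ε^2 + u^2) : ℝ) : ℂ) := by
    intro t
    rw [← integral_sub_left_eq_self _ volume t]
    simp
  simp_rw [hsub, ← integral_mul_const]
  rw [integral_integral_swap, ← integral_const_mul]
  · apply integral_congr_ae
    refine Eventually.of_forall fun u => ?_
    simp only [A]
    rw [← integral_smul, ← integral_const_mul]
    congr 1
    ext t
    simp only [Complex.real_smul, smul_eq_mul]
    have : ε⁻¹ * (Real.pi⁻¹ * (1 + (ε⁻¹ * u)^2)⁻¹) = 1 / Real.pi * (ε / (ε^2 + u^2)) := by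
      have : ε^2 + u^2 ≠ 0 := by positivity
      have : 1 + (ε⁻¹ * u)^2 ≠ 0 := by positivity
      field_simp
    rw [this]
    push_cast
    ring
  · have := hw.swap.mul_bdd (g := fun p : ℝ × ℝ => ((ε / (ε^2 + p.2^2) : ℝ) : ℂ)) (c := ε⁻¹)
      (by
        apply Continuous.aestronglyMeasurable
        apply Complex.continuous_ofReal.comp
        apply Continuous.div (by fun_prop) (by fun_prop)
        intro x; positivity)
      (Eventually.of_forall fun p => by
        rw [Complex.norm_real, Real.norm_of_nonneg (by positivity), div_le_iff₀ (by positivity)]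
        field_simp
        nlinarith [sq_nonneg p.2])
    convert this using 2 with p
    simp only [Function.uncurry, Function.comp, Prod.swap]; ring

theorem aux_mem (L : ℝ) :
    ∀ᵐ p : ℝ × ℝ ∂((volume.restrict (Icc (-(L / 2)) (L / 2))).prod
      (volume.restrict (Icc (-(L / 2)) (L / 2)))), p.1 - p.2 ∈ Icc (-L) L := by
  rw [Measure.prod_restrict]
  filter_upwards [ae_restrict_mem (measurableSet_Icc.prod measurableSet_Icc)] with p hp
  simp only [mem_prod, mem_Icc] at hp ⊢
  constructor <;> linarith

theorem aux_prod (L : ℝ) (f g : ℝ → ℂ)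
    (hf : Integrable f (volume.restrict (Icc (-(L / 2)) (L / 2))))
    (hg : Integrable g (volume.restrict (Icc (-(L / 2)) (L / 2)))) (K : ℝ → ℂ)
    (hK : Continuous K) :
    Integrable (fun p : ℝ × ℝ => g p.1 * f p.2 * K (p.1 - p.2))
      ((volume.restrict (Icc (-(L / 2)) (L / 2))).prod (volume.restrict (Icc (-(L / 2)) (L / 2))))
    ∧ ∫ t in Icc (-(L / 2)) (L / 2), (∫ τ in Icc (-(L / 2)) (L / 2), f τ * K (t - τ)) * g t
      = ∫ p : ℝ × ℝ, g p.1 * f p.2 * K (p.1 - p.2) ∂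
      ((volume.restrict (Icc (-(L / 2)) (L / 2))).prod
        (volume.restrict (Icc (-(L / 2)) (L / 2)))) := by
  obtain ⟨C, hC⟩ := (isCompact_Icc (a := -L) (b := L)).exists_bound_of_continuousOn hK.continuousOn
  have h1 : Integrable (fun p : ℝ × ℝ => g p.1 * f p.2 * K (p.1 - p.2))
      ((volume.restrict (Icc (-(L / 2)) (L / 2))).prod
        (volume.restrict (Icc (-(L / 2)) (L / 2)))) := by
    refine (hg.mul_prod hf).mul_bdd (c := C) (hK.comp (by fun_prop)).aestronglyMeasurable ?_
    filter_upwards [aux_mem L] with p hp using hC _ hp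
  refine ⟨h1, ?_⟩
  rw [integral_prod _ h1]
  congr 1
  ext t
  rw [← integral_mul_const]
  congr 1
  ext τ
  ring

/-- The regular part of the kernel. -/
noncomputable def auxH (ε x : ℝ) : ℝ :=
  ((riemannZeta₀ (1 + (|ε| : ℝ) + Complex.I * x) - 1) / (1 + (|ε| : ℝ) + Complex.I * x)).re

theorem auxH_cont : Continuous (fun p : ℝ × ℝ => auxH p.1 p.2) := by
  unfold auxH
  apply Complex.continuous_re.comp
  have h := differentiable_riemannZeta₀.continuous
  refine Continuous.div (by fun_prop) (by fun_prop) ?_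
  intro p h0
  have := congrArg Complex.re h0
  simp at this
  have := abs_nonneg p.1
  linarith

theorem auxH_eq (ε x : ℝ) (hε : 0 < ε) :
    (riemannZeta (1 + ε + Complex.I * x) / (1 + ε + Complex.I * x)).re
      = ε / (ε^2 + x^2) + auxH ε x := by
  unfold auxH
  rw [abs_of_pos hε]
  have h0 : (ε + Complex.I * x : ℂ) ≠ 0 := by
    intro h
    have := congrArg Complex.re h
    simp at this
    linarith
  have h1 : (1 + ε + Complex.I * x : ℂ) ≠ 0 := by
    intro h
    have := congrArg Complex.re h
    simp at this
    linarith
  have hs1 : (1 + ε + Complex.I * x : ℂ) ≠ 1 := by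
    intro h
    apply h0
    linear_combination h
  have hs : (1 + ε + Complex.I * x : ℂ) - 1 = ε + Complex.I * x := by ring
  rw [riemannZeta_eq_inv_sub_add hs1, hs]
  have e : ∀ z : ℂ, ((ε + Complex.I * x : ℂ)⁻¹ + z) / (1 + ε + Complex.I * x)
      = (ε + Complex.I * x : ℂ)⁻¹ + (z - 1) / (1 + ε + Complex.I * x) := by
    intro z
    field_simp
    ring
  rw [e, Complex.add_re]
  congr 1
  rw [Complex.inv_re]
  simp [Complex.normSq_apply, sq]

/-- For every symmetric interval `I = [−L/2, L/2]` there is a compact operator `Ψ_I` on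
`L²(I)` such that the integral operators with kernel
`(1/π)·Re(ζ(1+ε+i(t−τ))/(1+ε+i(t−τ)))` converge, in the weak operator topology as
`ε → 0⁺`, to `Id + Ψ_I`: for all `f, g ∈ L²(I)`,
`lim_{ε→0⁺} (1/π) ∫_I ∫_I f(τ)·Re(ζ(1+ε+i(t−τ))/(1+ε+i(t−τ)))·conj(g(t)) dτ dt
   = ⟨f,g⟩ + ⟨Ψ_I f,g⟩`. -/
theorem zeta_weak_limit_identity_add_compact (L : ℝ) (hL : 0 < L) :
    ∃ Ψ : Lp ℂ 2 (volume.restrict (Icc (-(L / 2)) (L / 2)))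
        →L[ℂ] Lp ℂ 2 (volume.restrict (Icc (-(L / 2)) (L / 2))),
      IsCompactOperator Ψ ∧
      ∀ f g : Lp ℂ 2 (volume.restrict (Icc (-(L / 2)) (L / 2))),
        Tendsto
          (fun ε : ℝ => (1 / (Real.pi : ℂ)) *
            ∫ t in Icc (-(L / 2)) (L / 2),
              (∫ τ in Icc (-(L / 2)) (L / 2),
                f τ * (((riemannZeta (1 + ε + Complex.I * (t - τ))
                  / (1 + ε + Complex.I * (t - τ))).re : ℝ) : ℂ))
              * (starRingEnd ℂ) (g t))
          (nhdsWithin 0 (Ioi 0))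
          (nhds ((∫ t in Icc (-(L / 2)) (L / 2), f t * (starRingEnd ℂ) (g t))
            + ∫ t in Icc (-(L / 2)) (L / 2), (Ψ f) t * (starRingEnd ℂ) (g t))) := by
  set μ := (volume : Measure ℝ).restrict (Icc (-(L / 2)) (L / 2)) with hμ
  let k : ℝ → ℂ := fun x =>
    (1 / (Real.pi : ℂ)) * ((auxH 0 (projIcc (-L) L (by linarith) x) : ℝ) : ℂ)
  let k' : Icc (-L) L → ℂ := fun x => (1 / (Real.pi : ℂ)) * ((auxH 0 x : ℝ) : ℂ)
  have hk'c : Continuous k' := by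
    have : Continuous (fun x : Icc (-L) L => auxH 0 x) :=
      auxH_cont.comp (f := fun x : Icc (-L) L => ((0 : ℝ), (x : ℝ))) (by fun_prop)
    fun_prop
  have hk : UniformContinuous k :=
    (CompactSpace.uniformContinuous_of_continuous hk'c).comp
      (LipschitzWith.projIcc (by linarith : -L ≤ L)).uniformContinuous
  obtain ⟨C, hC⟩ := isCompact_univ.exists_bound_of_continuousOn hk'c.continuousOn
  obtain ⟨Ψ, hΨ, hΨ2⟩ := aux_kernel_s13 μ k hk C (fun x => hC _ (mem_univ _))
  refine ⟨Ψ, hΨ, fun f g => ?_⟩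
  rw [hΨ2]
  have hf : Integrable f μ := (Lp.memLp f).integrable (by norm_num)
  have hg : Integrable g μ := (Lp.memLp g).integrable (by norm_num)
  have hgc : Integrable (fun t => (starRingEnd ℂ) (g t)) μ :=
    (Complex.conjCLE : ℂ →L[ℝ] ℂ).integrable_comp hg
  have hHc : ∀ ε, Continuous (fun x => ((auxH ε x : ℝ) : ℂ)) := fun ε =>
    Complex.continuous_ofReal.comp
      (auxH_cont.comp (f := fun x : ℝ => (ε, x)) (by fun_prop))
  have hPc : ∀ ε : ℝ, 0 < ε → Continuous (fun x : ℝ => ((ε / (ε^2 + x^2) : ℝ) : ℂ)) := by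
    intro ε hε
    apply Complex.continuous_ofReal.comp
    apply Continuous.div (by fun_prop) (by fun_prop)
    intro x; positivity
  -- Poisson part
  have hP : Tendsto (fun ε : ℝ => (1 / (Real.pi : ℂ)) * ∫ t in Icc (-(L / 2)) (L / 2),
      (∫ τ in Icc (-(L / 2)) (L / 2), f τ * ((ε / (ε^2 + (t-τ)^2) : ℝ) : ℂ))
        * (starRingEnd ℂ) (g t))
      (nhdsWithin 0 (Ioi 0))
      (nhds (∫ t in Icc (-(L / 2)) (L / 2), f t * (starRingEnd ℂ) (g t))) := by
    have := aux_poisson ((Icc (-(L / 2)) (L / 2)).indicator f) ((Icc (-(L / 2)) (L / 2)).indicator g)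
      ((integrable_indicator_iff measurableSet_Icc).2 hf)
      ((memLp_indicator_iff_restrict measurableSet_Icc).2 (Lp.memLp f))
      ((integrable_indicator_iff measurableSet_Icc).2 hg)
      ((memLp_indicator_iff_restrict measurableSet_Icc).2 (Lp.memLp g))
    have e1 : ∀ (u : ℝ → ℂ) (t : ℝ), u t * (starRingEnd ℂ) ((Icc (-(L / 2)) (L / 2)).indicator g t)
        = (Icc (-(L / 2)) (L / 2)).indicator (fun t => u t * (starRingEnd ℂ) (g t)) t := by
      intro u t
      by_cases ht : t ∈ Icc (-(L / 2)) (L / 2) <;> simp [ht]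
    have e2 : ∀ (u : ℝ → ℂ) (t : ℝ), ((Icc (-(L / 2)) (L / 2)).indicator f t) * u t
        = (Icc (-(L / 2)) (L / 2)).indicator (fun t => f t * u t) t := by
      intro u t
      by_cases ht : t ∈ Icc (-(L / 2)) (L / 2) <;> simp [ht]
    have i1 : ∀ (u : ℝ → ℂ), ∫ t, u t * (starRingEnd ℂ) ((Icc (-(L / 2)) (L / 2)).indicator g t)
        = ∫ t in Icc (-(L / 2)) (L / 2), u t * (starRingEnd ℂ) (g t) := by
      intro u
      simp_rw [e1 u]
      exact integral_indicator measurableSet_Icc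
    have i2 : ∀ (u : ℝ → ℂ), ∫ t, ((Icc (-(L / 2)) (L / 2)).indicator f t) * u t
        = ∫ t in Icc (-(L / 2)) (L / 2), f t * u t := by
      intro u
      simp_rw [e2 u]
      exact integral_indicator measurableSet_Icc
    have i3 : ∫ t in Icc (-(L / 2)) (L / 2),
        ((Icc (-(L / 2)) (L / 2)).indicator f t) * (starRingEnd ℂ) (g t)
        = ∫ t in Icc (-(L / 2)) (L / 2), f t * (starRingEnd ℂ) (g t) :=
      setIntegral_congr_fun measurableSet_Icc fun t ht => by simp [ht]
    rw [i1, i3] at this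
    refine this.congr fun ε => ?_
    rw [i1 (fun t => ∫ τ, (Icc (-(L / 2)) (L / 2)).indicator f τ *
      ((ε / (ε^2 + (t-τ)^2) : ℝ) : ℂ))]
    congr 2
    ext t
    rw [i2 (fun τ => ((ε / (ε^2 + (t-τ)^2) : ℝ) : ℂ))]
  -- regular part
  have hR : Tendsto (fun ε : ℝ => (1 / (Real.pi : ℂ)) * ∫ t, (∫ τ, f τ * ((auxH ε (t - τ) : ℝ) : ℂ) ∂μ)
        * (starRingEnd ℂ) (g t) ∂μ) (nhdsWithin 0 (Ioi 0))
      (nhds (∫ t, (∫ τ, f τ * k (t - τ) ∂μ) * (starRingEnd ℂ) (g t) ∂μ)) := by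
    have hk0 : ∫ t, (∫ τ, f τ * k (t - τ) ∂μ) * (starRingEnd ℂ) (g t) ∂μ
        = (1 / (Real.pi : ℂ)) * ∫ t, (∫ τ, f τ * ((auxH 0 (t - τ) : ℝ) : ℂ) ∂μ)
        * (starRingEnd ℂ) (g t) ∂μ := by
      rw [(aux_prod L f _ hf hgc k hk.continuous).2, (aux_prod L f _ hf hgc _ (hHc 0)).2,
        ← integral_const_mul]
      apply integral_congr_ae
      filter_upwards [aux_mem L] with p hp
      simp only [k]
      rw [projIcc_of_mem _ hp]
      ring
    rw [hk0]
    refine Tendsto.const_mul _ ?_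
    rw [(aux_prod L f _ hf hgc _ (hHc 0)).2]
    refine Tendsto.congr (fun ε => (aux_prod L f _ hf hgc _ (hHc ε)).2.symm) ?_
    obtain ⟨B, hB⟩ := ((isCompact_Icc (a := (-1 : ℝ)) (b := 1)).prod
      (isCompact_Icc (a := -L) (b := L))).exists_bound_of_continuousOn auxH_cont.continuousOn
    refine tendsto_integral_filter_of_dominated_convergence
      (fun p : ℝ × ℝ => ‖(starRingEnd ℂ) (g p.1) * f p.2‖ * B) ?_ ?_ ?_ ?_
    · exact Eventually.of_forall fun ε =>
        (aux_prod L f _ hf hgc _ (hHc ε)).1.aestronglyMeasurable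
    · have : Icc (-1 : ℝ) 1 ∈ nhdsWithin (0 : ℝ) (Ioi 0) :=
        mem_nhdsWithin_of_mem_nhds (Icc_mem_nhds (by norm_num) (by norm_num))
      filter_upwards [this] with ε hε
      filter_upwards [aux_mem L] with p hp
      rw [norm_mul _ (Complex.ofReal _), Complex.norm_real]
      gcongr
      exact hB (ε, p.1 - p.2) ⟨hε, hp⟩
    · exact (hgc.mul_prod hf).norm.mul_const B
    · refine Eventually.of_forall fun p => Tendsto.const_mul _ ?_
      refine Tendsto.mono_left ?_ nhdsWithin_le_nhds
      have : Continuous fun ε => ((auxH ε (p.1 - p.2) : ℝ) : ℂ) :=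
        Complex.continuous_ofReal.comp
          (auxH_cont.comp (f := fun ε : ℝ => (ε, p.1 - p.2)) (by fun_prop))
      exact this.tendsto 0
  refine (hP.add hR).congr' ?_
  filter_upwards [self_mem_nhdsWithin] with ε hε
  have hε : 0 < ε := hε
  rw [← mul_add, (aux_prod L f _ hf hgc _ (hPc ε hε)).2, (aux_prod L f _ hf hgc _ (hHc ε)).2,
    ← integral_add (aux_prod L f _ hf hgc _ (hPc ε hε)).1 (aux_prod L f _ hf hgc _ (hHc ε)).1]
  congr 1
  simp_rw [← mul_add, ← Complex.ofReal_add, ← auxH_eq ε _ hε]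
  have hKc : Continuous fun x : ℝ => (((riemannZeta (1 + ε + Complex.I * x)
      / (1 + ε + Complex.I * x)).re : ℝ) : ℂ) := by
    simp_rw [auxH_eq ε _ hε, Complex.ofReal_add]
    exact (hPc ε hε).add (hHc ε)
  rw [← (aux_prod L f _ hf hgc _ hKc).2]
  simp only [Complex.ofReal_sub]
  rfl
end
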